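/- Let n ≥ 2, α ∈ ℝ, let Σ be a domain of class C² in S^{n−1}, and let Ω = C_Σ ∩ Bⁿ or Ω = C_Σ ∖ B̄ⁿ, where Bⁿ is the open unit ball. Then for every u ∈ C²_c(Ω̄∖{0}) with ∇u = 0 on S^{n−1} ∩ ∂Ω, ∫_Ω |x|^α |Δu|² dx − μ_N(C_Σ;α) ∫_Ω |x|^{α−4} |u|² dx ≥ ((γ̄_{n,α} + λ_Σ)/2) ∫_Ω |x|^{α−4} |log|x||^{−2} |u|² dx + (9/16) ∫_Ω |x|^{α−4} |log|x||^{−4} |u|² dx. -/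

import Mathlib

open MeasureTheory Metric Set Filter
open scoped RealInnerProductSpace

noncomputable section

/-- The Euclidean Laplacian of `u : ℝⁿ → ℝ` at a point. -/
def lap {n : ℕ} (u : EuclideanSpace ℝ (Fin n) → ℝ) (x : EuclideanSpace ℝ (Fin n)) : ℝ :=
  ∑ i : Fin n, iteratedFDeriv ℝ 2 u x ![EuclideanSpace.single i 1, EuclideanSpace.single i 1]

/-- The Laplace–Beltrami operator on the unit sphere, computed via the
`0`-homogeneous extension: for a `0`-homogeneous function the Euclidean Laplacian
restricted to the unit sphere is exactly the Laplace–Beltrami operator. -/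
def sphLap {n : ℕ} (φ : EuclideanSpace ℝ (Fin n) → ℝ) (σ : EuclideanSpace ℝ (Fin n)) : ℝ :=
  lap (fun x => φ (‖x‖⁻¹ • x)) σ

/-- Squared norm of the spherical gradient, via the `0`-homogeneous extension. -/
def sphGradNormSq {n : ℕ} (φ : EuclideanSpace ℝ (Fin n) → ℝ) (σ : EuclideanSpace ℝ (Fin n)) : ℝ :=
  ‖fderiv ℝ (fun x => φ (‖x‖⁻¹ • x)) σ‖ ^ 2

/-- The open cone `C_Σ = {rσ : r > 0, σ ∈ Σ}` over a subset of the unit sphere. -/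
def coneOf {n : ℕ} (S : Set (EuclideanSpace ℝ (Fin n))) : Set (EuclideanSpace ℝ (Fin n)) :=
  {x | x ≠ 0 ∧ ‖x‖⁻¹ • x ∈ S}

/-- The canonical surface measure `dσ` on the unit sphere of `ℝⁿ`, as a measure on `ℝⁿ`. -/
def sphMeasure (n : ℕ) : Measure (EuclideanSpace ℝ (Fin n)) :=
  Measure.map Subtype.val
    ((volume : Measure (EuclideanSpace ℝ (Fin n))).toSphere)

/-- A (Dirichlet) eigenfunction of the Laplace–Beltrami operator on `S ⊆ 𝕊^{n-1}`
relative to the eigenvalue `lam`. -/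
def IsEigenfun {n : ℕ} (S : Set (EuclideanSpace ℝ (Fin n))) (lam : ℝ)
    (φ : EuclideanSpace ℝ (Fin n) → ℝ) : Prop :=
  ContinuousOn (fun x => φ (‖x‖⁻¹ • x)) (coneOf (closure S)) ∧
  ContDiffOn ℝ 2 (fun x => φ (‖x‖⁻¹ • x)) (coneOf S) ∧
  (∀ σ ∈ closure S \ S, φ σ = 0) ∧
  (∃ σ ∈ S, φ σ ≠ 0) ∧
  (∀ σ ∈ S, - sphLap φ σ = lam * φ σ)

/-- The Dirichlet spectrum `Λ(Σ)` of the Laplace–Beltrami operator on `S`. -/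
def spec {n : ℕ} (S : Set (EuclideanSpace ℝ (Fin n))) : Set ℝ :=
  {lam | ∃ φ, IsEigenfun S lam φ}

/-- `S` is a domain in the unit sphere `𝕊^{n-1}`: a relatively open connected
nonempty subset. -/
def IsSphDomain {n : ℕ} (S : Set (EuclideanSpace ℝ (Fin n))) : Prop :=
  S ⊆ Metric.sphere (0 : EuclideanSpace ℝ (Fin n)) 1 ∧
  IsOpen (Subtype.val ⁻¹' S : Set (Metric.sphere (0 : EuclideanSpace ℝ (Fin n)) 1)) ∧
  IsConnected S

/-- `S` is a domain of class `C²` in the unit sphere: a domain such that the cone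
over it admits local `C²` defining functions away from the origin. -/
def IsC2SphDomain {n : ℕ} (S : Set (EuclideanSpace ℝ (Fin n))) : Prop :=
  IsSphDomain S ∧
  ∀ x ∈ frontier (coneOf S) \ {0}, ∃ (U : Set (EuclideanSpace ℝ (Fin n)))
    (f : EuclideanSpace ℝ (Fin n) → ℝ), IsOpen U ∧ x ∈ U ∧ ContDiff ℝ 2 f ∧
    fderiv ℝ f x ≠ 0 ∧ coneOf S ∩ U = {y ∈ U | f y < 0}

/-- `γ_{n,α} = ((n-2)/2)² - ((α-2)/2)²`. -/
def gam (n : ℕ) (α : ℝ) : ℝ := (((n : ℝ) - 2) / 2) ^ 2 - ((α - 2) / 2) ^ 2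

/-- `γ̄_{n,α} = ((n-2)/2)² + ((α-2)/2)²`. -/
def gbar (n : ℕ) (α : ℝ) : ℝ := (((n : ℝ) - 2) / 2) ^ 2 + ((α - 2) / 2) ^ 2

/-- The class `C²_c(Ω̄ ∖ {0})` of Navier test functions: `C²` up to the closure of
`Ω`, vanishing on `∂Ω` and in a neighborhood of `0` and of `∞`. -/
def NavierAdm {n : ℕ} (Ω : Set (EuclideanSpace ℝ (Fin n)))
    (u : EuclideanSpace ℝ (Fin n) → ℝ) : Prop :=
  ContDiffOn ℝ 2 u (closure Ω) ∧
  (∀ x ∈ frontier Ω, u x = 0) ∧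
  (∃ ε > 0, ∀ x : EuclideanSpace ℝ (Fin n), ‖x‖ < ε → u x = 0) ∧
  (∃ R : ℝ, ∀ x : EuclideanSpace ℝ (Fin n), R < ‖x‖ → u x = 0)

/-- The class `C²_c(Ω)` of Dirichlet test functions: globally `C²` with compact
support contained in `Ω`. -/
def DirichletAdm {n : ℕ} (Ω : Set (EuclideanSpace ℝ (Fin n)))
    (u : EuclideanSpace ℝ (Fin n) → ℝ) : Prop :=
  ContDiff ℝ 2 u ∧ HasCompactSupport u ∧ tsupport u ⊆ Ω

/-- The best Rellich constant `μ_N(Ω;α)` under Navier boundary conditions. -/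
def muN {n : ℕ} (Ω : Set (EuclideanSpace ℝ (Fin n))) (α : ℝ) : ℝ :=
  sInf {q : ℝ | ∃ u, NavierAdm Ω u ∧ (∃ x ∈ Ω, u x ≠ 0) ∧
    q = (∫ x in Ω, ‖x‖ ^ α * (lap u x) ^ 2) / (∫ x in Ω, ‖x‖ ^ (α - 4) * (u x) ^ 2)}

/-- The best Rellich constant `μ_D(Ω;α)` under Dirichlet boundary conditions. -/
def muD {n : ℕ} (Ω : Set (EuclideanSpace ℝ (Fin n))) (α : ℝ) : ℝ :=
  sInf {q : ℝ | ∃ u, DirichletAdm Ω u ∧ (∃ x ∈ Ω, u x ≠ 0) ∧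
    q = (∫ x in Ω, ‖x‖ ^ α * (lap u x) ^ 2) / (∫ x in Ω, ‖x‖ ^ (α - 4) * (u x) ^ 2)}

/-- The surrogate of `H² ∩ H¹₀(Σ)`: functions whose `0`-homogeneous extension is
`C²` up to the closure of the cone, vanishing on the relative boundary of `S`. -/
def NavAdmS {n : ℕ} (S : Set (EuclideanSpace ℝ (Fin n)))
    (φ : EuclideanSpace ℝ (Fin n) → ℝ) : Prop :=
  ContDiffOn ℝ 2 (fun x => φ (‖x‖⁻¹ • x)) (coneOf (closure S)) ∧
  (∀ σ ∈ closure S \ S, φ σ = 0)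

/-- The surrogate of `H²₀(Σ)`: as `NavAdmS`, with in addition vanishing gradient
on the relative boundary of `S`. -/
def DirAdmS {n : ℕ} (S : Set (EuclideanSpace ℝ (Fin n)))
    (φ : EuclideanSpace ℝ (Fin n) → ℝ) : Prop :=
  NavAdmS S φ ∧
  ∀ σ ∈ closure S \ S,
    fderivWithin ℝ (fun x => φ (‖x‖⁻¹ • x)) (coneOf (closure S)) σ = 0

/-- The Rayleigh-type quotient `∫_Σ |Lφ|² dσ / ∫_Σ |φ|² dσ` with
`Lφ = -Δ_σ φ + γ φ`. -/
def sphQuot {n : ℕ} (S : Set (EuclideanSpace ℝ (Fin n))) (γ : ℝ)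
    (φ : EuclideanSpace ℝ (Fin n) → ℝ) : ℝ :=
  (∫ σ in S, (- sphLap φ σ + γ * φ σ) ^ 2 ∂(sphMeasure n)) /
    (∫ σ in S, (φ σ) ^ 2 ∂(sphMeasure n))

/-- Partial derivative `w_s` of a function on the cylinder `ℝ × 𝕊^{n-1}`. -/
def ws {n : ℕ} (w : ℝ × EuclideanSpace ℝ (Fin n) → ℝ)
    (p : ℝ × EuclideanSpace ℝ (Fin n)) : ℝ :=
  deriv (fun t => w (t, p.2)) p.1

/-- Second partial derivative `w_ss` of a function on the cylinder. -/
def wss {n : ℕ} (w : ℝ × EuclideanSpace ℝ (Fin n) → ℝ)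
    (p : ℝ × EuclideanSpace ℝ (Fin n)) : ℝ :=
  deriv (fun t => ws w (t, p.2)) p.1

end

open MeasureTheory Metric Set Filter Topology
open scoped RealInnerProductSpace
noncomputable section

abbrev EE (n : ℕ) := EuclideanSpace ℝ (Fin n)
abbrev Sph (n : ℕ) := Metric.sphere (0 : EuclideanSpace ℝ (Fin n)) 1
def sg (n : ℕ) : Measure (Sph n) := (volume : Measure (EE n)).toSphere

instance (n : ℕ) : IsFiniteMeasure (sg n) := by unfold sg; infer_instance

def polPhi (n : ℕ) (ε : ℝ) (q : Sph n × ℝ) : EE n := Real.exp (ε * q.2) • (q.1 : EE n)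

lemma polPhi_norm {n : ℕ} (ε : ℝ) (q : Sph n × ℝ) : ‖polPhi n ε q‖ = Real.exp (ε * q.2) := by
  have : ‖(q.1 : EE n)‖ = 1 := by simp
  simp [polPhi, norm_smul, this]

lemma polPhi_emb (n : ℕ) (ε : ℝ) (hε : ε ≠ 0) : MeasurableEmbedding (polPhi n ε) := by
  have hc : Continuous (polPhi n ε) := by unfold polPhi; fun_prop
  refine hc.measurableEmbedding ?_
  intro q q' h
  have h1 : Real.exp (ε * q.2) = Real.exp (ε * q'.2) := by
    rw [← polPhi_norm ε q, ← polPhi_norm ε q', h]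
  have h2 : q.2 = q'.2 := by
    have := Real.exp_injective h1
    exact mul_left_cancel₀ hε this
  have h3 : (q.1 : EE n) = q'.1 := by
    unfold polPhi at h
    rw [h1] at h
    exact smul_right_injective _ (Real.exp_pos _).ne' h
  exact Prod.ext (Subtype.ext h3) h2

lemma lintegral_Ioi_exp (n : ℕ) (hn : 1 ≤ n) (ε : ℝ) (hε : ε = 1 ∨ ε = -1) (f : ℝ → ENNReal) :
    ∫⁻ r in Ioi (0:ℝ), ENNReal.ofReal (r ^ (n-1)) * f r
      = ∫⁻ s : ℝ, ENNReal.ofReal (Real.exp (n * (ε * s))) * f (Real.exp (ε * s)) := by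
  have hne : ε ≠ 0 := by rcases hε with h | h <;> simp [h]
  have himg : (fun s : ℝ => Real.exp (ε * s)) '' univ = Ioi 0 := by
    ext r
    simp only [image_univ, mem_range, mem_Ioi]
    constructor
    · rintro ⟨s, rfl⟩; positivity
    · intro hr
      refine ⟨ε⁻¹ * Real.log r, ?_⟩
      rw [← mul_assoc, mul_inv_cancel₀ hne, one_mul, Real.exp_log hr]
  rw [← himg]
  rw [lintegral_image_eq_lintegral_abs_deriv_mul (f' := fun s => Real.exp (ε * s) * ε)
    MeasurableSet.univ]
  · rw [setLIntegral_univ]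
    refine lintegral_congr fun s => ?_
    rw [← mul_assoc, ← ENNReal.ofReal_mul (abs_nonneg _)]
    congr 2
    have : |ε| = 1 := by rcases hε with h | h <;> simp [h]
    rw [abs_mul, this, mul_one, abs_of_pos (Real.exp_pos _), ← pow_succ', Nat.sub_add_cancel hn,
      ← Real.exp_nat_mul]
  · intro s _
    have : HasDerivAt (fun s : ℝ => ε * s) ε s := by simpa using (hasDerivAt_id s).const_mul ε
    exact (this.exp).hasDerivWithinAt
  · intro a _ b _ h
    exact mul_left_cancel₀ hne (Real.exp_injective h)

lemma polPhi_mp (n : ℕ) (hn : 1 ≤ n) (ε : ℝ) (hε : ε = 1 ∨ ε = -1) :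
    MeasurePreserving (polPhi n ε)
      (((sg n).prod volume).withDensity
        (fun q => ENNReal.ofReal (Real.exp (n * (ε * q.2))))) volume := by
  have hne : ε ≠ 0 := by rcases hε with h | h <;> simp [h]
  have : Nonempty (Fin n) := ⟨⟨0, hn⟩⟩
  have hc : Continuous (polPhi n ε) := by unfold polPhi; fun_prop
  refine ⟨hc.measurable, ?_⟩
  refine Measure.ext_of_lintegral _ fun F hF => ?_
  rw [lintegral_map hF hc.measurable]
  have h0 := lintegral_withDensity_eq_lintegral_mul ((sg n).prod (volume : Measure ℝ))
    (f := fun q => ENNReal.ofReal (Real.exp (n * (ε * q.2)))) (by fun_prop)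
    (hF.comp hc.measurable)
  simp only [Function.comp_apply] at h0
  rw [h0, lintegral_prod _ (by
      apply Measurable.aemeasurable
      apply Measurable.mul (by fun_prop) (hF.comp hc.measurable))]
  simp only [Pi.mul_apply]
  have key : ∫⁻ x, F x = ∫⁻ p : Sph n × Ioi (0:ℝ), F ((p.2:ℝ) • (p.1 : EE n))
      ∂((sg n).prod (Measure.volumeIoiPow (n-1))) := by
    have h1 := (volume : Measure (EE n)).measurePreserving_homeomorphUnitSphereProd
    rw [finrank_euclideanSpace_fin] at h1
    have h2 := h1.symm (homeomorphUnitSphereProd (EE n)).toMeasurableEquiv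
    have h3 := h2.lintegral_comp_emb (MeasurableEquiv.measurableEmbedding _)
      (fun x : ({(0:EE n)}ᶜ : Set (EE n)) => F x)
    rw [lintegral_subtype_comap (measurableSet_singleton _).compl, restrict_compl_singleton] at h3
    rw [← h3]
    rfl
  rw [key, lintegral_prod _ (by
    apply Measurable.aemeasurable
    apply hF.comp
    fun_prop)]
  refine lintegral_congr fun p => ?_
  unfold Measure.volumeIoiPow
  rw [lintegral_withDensity_eq_lintegral_mul _ (by fun_prop) (by apply hF.comp; fun_prop)]
  simp only [Pi.mul_apply]
  rw [lintegral_subtype_comap measurableSet_Ioi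
    (fun r : ℝ => ENNReal.ofReal (r ^ (n-1)) * F (r • (p : EE n)))]
  rw [lintegral_Ioi_exp n hn ε hε (fun r => F (r • (p : EE n)))]
  rfl

lemma polar_integral {n : ℕ} (hn : 1 ≤ n) {ε : ℝ} (hε : ε = 1 ∨ ε = -1) (F : EE n → ℝ) :
    ∫ x, F x = ∫ q : Sph n × ℝ, Real.exp (n * (ε * q.2)) * F (Real.exp (ε * q.2) • (q.1 : EE n))
      ∂((sg n).prod volume) := by
  have hne : ε ≠ 0 := by rcases hε with h | h <;> simp [h]
  rw [← (polPhi_mp n hn ε hε).integral_comp (polPhi_emb n ε hne) F]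
  have : (fun q : Sph n × ℝ => ENNReal.ofReal (Real.exp (n * (ε * q.2))))
     = fun q => ((Real.toNNReal (Real.exp (n * (ε * q.2))) : NNReal) : ENNReal) := rfl
  rw [this, integral_withDensity_eq_integral_smul (by fun_prop)]
  refine integral_congr_ae (ae_of_all _ fun q => ?_)
  simp only [NNReal.smul_def, Real.coe_toNNReal _ (Real.exp_pos _).le, smul_eq_mul]
  rfl

lemma polar_integrable {n : ℕ} (hn : 1 ≤ n) {ε : ℝ} (hε : ε = 1 ∨ ε = -1) (F : EE n → ℝ) :
    Integrable F ↔ Integrable (fun q : Sph n × ℝ => Real.exp (n * (ε * q.2)) *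
      F (Real.exp (ε * q.2) • (q.1 : EE n))) ((sg n).prod volume) := by
  have hne : ε ≠ 0 := by rcases hε with h | h <;> simp [h]
  rw [← (polPhi_mp n hn ε hε).integrable_comp_emb (polPhi_emb n ε hne) (g := F)]
  have : (fun q : Sph n × ℝ => ENNReal.ofReal (Real.exp (n * (ε * q.2))))
     = fun q => ((Real.toNNReal (Real.exp (n * (ε * q.2))) : NNReal) : ENNReal) := rfl
  rw [this, integrable_withDensity_iff_integrable_smul (by fun_prop)]
  refine integrable_congr (ae_of_all _ fun q => ?_)
  simp only [NNReal.smul_def, Real.coe_toNNReal _ (Real.exp_pos _).le, smul_eq_mul]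
  rfl

/-- polar formula for products of a radial function and a homogeneous one -/
lemma polar_hom {n : ℕ} (hn : 1 ≤ n) (g : ℝ → ℝ) (F : EE n → ℝ) (d : ℝ)
    (hF : ∀ t : ℝ, 0 < t → ∀ x : EE n, ‖x‖ = 1 → F (t • x) = t ^ d * F x) :
    ∫ x, g ‖x‖ * F x = (∫ s : ℝ, Real.exp (n * s) * (g (Real.exp s) * (Real.exp s) ^ d)) *
      ∫ p : Sph n, F p ∂(sg n) := by
  rw [polar_integral hn (Or.inl rfl), mul_comm, ← integral_prod_mul]
  refine integral_congr_ae (ae_of_all _ fun q => ?_)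
  have hq : ‖(q.1 : EE n)‖ = 1 := by simp
  simp only [one_mul]
  rw [hF _ (Real.exp_pos _) _ hq, norm_smul, hq, mul_one, Real.norm_of_nonneg (Real.exp_pos _).le]
  ring

/-- a.e. statement transfer from the space to the sphere for conic properties -/
lemma ae_sphere_of_ae {n : ℕ} (hn : 1 ≤ n) (P : EE n → Prop)
    (h : ∀ᵐ x : EE n, P x) (hP : ∀ t : ℝ, 0 < t → ∀ x : EE n, P (t • x) → P x) :
    ∀ᵐ p : Sph n ∂(sg n), P p := by
  have h1 := (polPhi_mp n hn 1 (Or.inl rfl)).quasiMeasurePreserving.ae h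
  have h2 : ∀ᵐ q : Sph n × ℝ ∂((sg n).prod volume), P (polPhi n 1 q) := by
    rw [ae_withDensity_iff (by fun_prop)] at h1
    filter_upwards [h1] with q hq
    apply hq
    simp [Real.exp_pos]
  have h3 := Measure.ae_ae_of_ae_prod h2
  filter_upwards [h3] with p hp
  obtain ⟨s, hs⟩ := hp.exists
  exact hP _ (Real.exp_pos _) _ hs
end

open MeasureTheory Metric Set Filter Topology
open scoped RealInnerProductSpace
noncomputable section

/-- second derivative -/
def dd {n : ℕ} (f : EE n → ℝ) (x : EE n) : EE n →L[ℝ] EE n →L[ℝ] ℝ := fderiv ℝ (fderiv ℝ f) x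

lemma lap_basis {n : ℕ} {ι : Type*} [Fintype ι] (b : OrthonormalBasis ι ℝ (EE n)) (f : EE n → ℝ)
    (x : EE n) : lap f x = ∑ i, dd f x (b i) (b i) := by
  have h1 := congrFun (InnerProductSpace.laplacian_eq_iteratedFDeriv_orthonormalBasis f b) x
  have h2 := congrFun (InnerProductSpace.laplacian_eq_iteratedFDeriv_orthonormalBasis f
    (EuclideanSpace.basisFun (Fin n) ℝ)) x
  have h3 : lap f x = ∑ i, iteratedFDeriv ℝ 2 f x ![b i, b i] := by
    rw [← h1, h2]; simp [lap]
  rw [h3]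
  refine Finset.sum_congr rfl fun i _ => ?_
  rw [iteratedFDeriv_two_apply]; rfl

lemma lap_eq {n : ℕ} (f : EE n → ℝ) (x : EE n) :
    lap f x = ∑ i, dd f x (EuclideanSpace.single i 1) (EuclideanSpace.single i 1) := by
  rw [lap_basis (EuclideanSpace.basisFun (Fin n) ℝ)]; simp

lemma dd_congr {n : ℕ} {f g : EE n → ℝ} {x : EE n} (h : f =ᶠ[𝓝 x] g) : dd f x = dd g x := by
  unfold dd
  exact Filter.EventuallyEq.fderiv_eq h.fderiv

lemma lap_congr {n : ℕ} {f g : EE n → ℝ} {x : EE n} (h : f =ᶠ[𝓝 x] g) : lap f x = lap g x := by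
  rw [lap_eq, lap_eq, dd_congr h]

lemma curve_deriv {n : ℕ} {f : EE n → ℝ} {c c1 : ℝ → EE n} {c2 : EE n} {t0 : ℝ}
    (hf : ContDiffAt ℝ 2 f (c t0)) (h1 : ∀ᶠ t in 𝓝 t0, HasDerivAt c (c1 t) t)
    (h2 : HasDerivAt c1 c2 t0) :
    (∀ᶠ t in 𝓝 t0, HasDerivAt (fun t => f (c t)) (fderiv ℝ f (c t) (c1 t)) t) ∧
    HasDerivAt (fun t => fderiv ℝ f (c t) (c1 t))
      (dd f (c t0) (c1 t0) (c1 t0) + fderiv ℝ f (c t0) c2) t0 := by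
  have hc : ContinuousAt c t0 := h1.self_of_nhds.continuousAt
  have hd : ∀ᶠ y in 𝓝 (c t0), DifferentiableAt ℝ f y := by
    have := hf.eventually (by simp)
    filter_upwards [this] with y hy using hy.differentiableAt (by simp)
  constructor
  · filter_upwards [h1, hc.eventually hd] with t ht hd
    exact hd.hasFDerivAt.comp_hasDerivAt t ht
  · have hdf : DifferentiableAt ℝ (fderiv ℝ f) (c t0) :=
      (hf.fderiv_right (m := 1) (by norm_num)).differentiableAt (by simp)
    have := (hdf.hasFDerivAt.comp_hasDerivAt t0 h1.self_of_nhds).clm_apply h2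
    exact this

lemma curve_deriv2 {n : ℕ} {f : EE n → ℝ} {c c1 : ℝ → EE n} {c2 : EE n} {t0 : ℝ}
    (hf : ContDiffAt ℝ 2 f (c t0)) (h1 : ∀ᶠ t in 𝓝 t0, HasDerivAt c (c1 t) t)
    (h2 : HasDerivAt c1 c2 t0) :
    deriv (deriv (fun t => f (c t))) t0 =
      dd f (c t0) (c1 t0) (c1 t0) + fderiv ℝ f (c t0) c2 := by
  obtain ⟨ha, hb⟩ := curve_deriv hf h1 h2
  have : deriv (fun t => f (c t)) =ᶠ[𝓝 t0] fun t => fderiv ℝ f (c t) (c1 t) := by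
    filter_upwards [ha] with t ht using ht.deriv
  rw [this.deriv_eq, hb.deriv]

lemma dd_line {n : ℕ} {f : EE n → ℝ} {x : EE n} (hf : ContDiffAt ℝ 2 f x) (v : EE n) :
    dd f x v v = deriv (deriv (fun t : ℝ => f (x + t • v))) 0 := by
  have h1 : ∀ t : ℝ, HasDerivAt (fun t : ℝ => x + t • v) v t := fun t => by
    simpa using ((hasDerivAt_id t).smul_const v).const_add x
  have := curve_deriv2 (f := f) (c := fun t : ℝ => x + t • v) (c1 := fun _ => v) (c2 := 0) (t0 := 0)
    (by simpa using hf) (Eventually.of_forall h1) (hasDerivAt_const _ _)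
  rw [this]; simp

/-- 0-homogeneous extension -/
abbrev hext {n : ℕ} (φ : EE n → ℝ) : EE n → ℝ := fun x => φ (‖x‖⁻¹ • x)

lemma nrm_contDiffAt {n : ℕ} {x : EE n} (hx : x ≠ 0) (m : WithTop ℕ∞) :
    ContDiffAt ℝ m (fun y : EE n => ‖y‖⁻¹ • y) x :=
  ((contDiffAt_norm ℝ hx).inv (norm_ne_zero_iff.2 hx)).smul contDiffAt_id

lemma polar_lap {n : ℕ} {f : EE n → ℝ} {σ : EE n} {ρ : ℝ} (hρ : 0 < ρ) (hσ : ‖σ‖ = 1)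
    (hf : ContDiffAt ℝ 2 f (ρ • σ)) :
    lap f (ρ • σ) = dd f (ρ • σ) σ σ + ((n : ℝ) - 1) / ρ * fderiv ℝ f (ρ • σ) σ
      + (ρ ^ 2)⁻¹ * lap (fun y => f (ρ • ‖y‖⁻¹ • y)) σ := by
  have hσ0 : σ ≠ 0 := by intro h; simp [h] at hσ
  have hn : 1 ≤ n := by
    rcases Nat.eq_zero_or_pos n with h | h
    · subst h; exact absurd (Subsingleton.elim σ 0) hσ0
    · exact h
  obtain ⟨m, rfl⟩ : ∃ m, n = m + 1 := ⟨n - 1, by omega⟩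
  have : ∃ b : OrthonormalBasis (Fin (m+1)) ℝ (EE (m+1)), b 0 = σ := by
    obtain ⟨b, hb⟩ := Orthonormal.exists_orthonormalBasis_extension_of_card_eq (𝕜 := ℝ)
      (E := EE (m+1)) (ι := Fin (m+1)) (by simp) (v := fun _ => σ) (s := {0}) (by
        constructor
        · intro i; simpa using hσ
        · intro i j hij; exact absurd (Subsingleton.elim i j) hij)
    exact ⟨b, hb 0 (by simp)⟩
  obtain ⟨b, hb⟩ := this
  set ψ : EE (m+1) → ℝ := fun y => f (ρ • ‖y‖⁻¹ • y) with hψ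
  have hψc : ContDiffAt ℝ 2 ψ σ := by
    refine ContDiffAt.comp (x := σ) (g := f) (f := fun y : EE (m+1) => ρ • ‖y‖⁻¹ • y) ?_
      ((nrm_contDiffAt hσ0 2).const_smul ρ)
    simpa [hσ] using hf
  have h0 : dd ψ σ (b 0) (b 0) = 0 := by
    rw [dd_line hψc, hb]
    have : (fun t : ℝ => ψ (σ + t • σ)) =ᶠ[𝓝 0] fun _ => ψ σ := by
      have : ∀ᶠ t : ℝ in 𝓝 0, -1 < t := lt_mem_nhds (by norm_num)
      filter_upwards [this] with t ht
      have h1 : σ + t • σ = (1 + t) • σ := by rw [add_smul, one_smul]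
      have h2 : 0 < 1 + t := by linarith
      simp only [hψ, h1, norm_smul, hσ, Real.norm_eq_abs, abs_of_pos h2, smul_smul]
      congr 2; field_simp
    rw [(this.deriv).deriv_eq]
    simp
  have hi : ∀ i : Fin m, dd ψ σ (b i.succ) (b i.succ) =
      ρ ^ 2 * dd f (ρ • σ) (b i.succ) (b i.succ) - ρ * fderiv ℝ f (ρ • σ) σ := by
    intro i
    set v := b i.succ with hv
    have hvn : ‖v‖ = 1 := b.orthonormal.1 _
    have hvs : inner ℝ σ v = 0 := by
      rw [← hb, hv]; exact b.orthonormal.2 (Fin.succ_ne_zero i).symm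
    have hnorm : ∀ t : ℝ, ‖σ + t • v‖ ^ 2 = 1 + t ^ 2 := by
      intro t
      rw [norm_add_sq_real, inner_smul_right, hvs, norm_smul, hσ, hvn]
      simp
    have hnorm' : ∀ t : ℝ, ‖σ + t • v‖ = √(1 + t ^ 2) := by
      intro t; rw [← hnorm, Real.sqrt_sq (norm_nonneg _)]
    rw [dd_line hψc]
    have hpos : ∀ t : ℝ, 0 < 1 + t ^ 2 := fun t => by positivity
    let g : ℝ → ℝ := fun t => ρ * (√(1 + t ^ 2))⁻¹
    let g1 : ℝ → ℝ := fun t => - ρ * t * (√(1 + t ^ 2))⁻¹ * (1 + t ^ 2)⁻¹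
    have hsq : ∀ t : ℝ, HasDerivAt (fun t : ℝ => 1 + t ^ 2) (2 * t) t := fun t => by
      simpa using (hasDerivAt_pow 2 t).const_add 1
    have hinvs : ∀ t : ℝ, HasDerivAt (fun t : ℝ => (√(1 + t ^ 2))⁻¹)
        (-t * (√(1 + t ^ 2))⁻¹ * (1 + t ^ 2)⁻¹) t := fun t => by
      have h := ((hsq t).sqrt (hpos t).ne').inv (Real.sqrt_pos.2 (hpos t)).ne'
      refine h.congr_deriv ?_
      have := Real.sq_sqrt (hpos t).le
      have h2 := (Real.sqrt_pos.2 (hpos t)).ne'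
      rw [this]
      field_simp
    have hg : ∀ t : ℝ, HasDerivAt g (g1 t) t := fun t => by
      have := (hinvs t).const_mul ρ
      refine this.congr_deriv ?_
      simp only [g1]; ring
    have hg1 : HasDerivAt g1 (-ρ) 0 := by
      have h1 : HasDerivAt (fun t : ℝ => -ρ * t) (-ρ) 0 := by
        simpa using (hasDerivAt_id (0:ℝ)).const_mul (-ρ)
      have h2 := ((h1.mul (hinvs 0)).mul ((hsq 0).inv (hpos 0).ne'))
      refine h2.congr_deriv ?_
      simp
    let c : ℝ → EE (m+1) := fun t => g t • (σ + t • v)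
    let c1 : ℝ → EE (m+1) := fun t => g t • v + g1 t • (σ + t • v)
    have hl : ∀ t : ℝ, HasDerivAt (fun t : ℝ => σ + t • v) v t := fun t => by
      simpa using ((hasDerivAt_id t).smul_const v).const_add σ
    have hc : ∀ t, HasDerivAt c (c1 t) t := fun t => (hg t).smul (hl t)
    have hc1 : HasDerivAt c1 (-ρ • σ) 0 := by
      have := ((hg 0).smul_const v).add (hg1.smul (hl 0))
      refine this.congr_deriv ?_
      simp [g1]
    have hc0 : c 0 = ρ • σ := by simp [c, g]
    have hc10 : c1 0 = ρ • v := by simp [c1, g, g1]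
    have hfc : (fun t : ℝ => ψ (σ + t • v)) = fun t => f (c t) := by
      funext t
      simp only [hψ, c, g, hnorm', smul_smul]
    rw [hfc, curve_deriv2 (c1 := c1) (by rw [hc0]; exact hf) (Eventually.of_forall hc) hc1, hc0, hc10]
    simp; ring
  rw [lap_basis b f, lap_basis b ψ, Fin.sum_univ_succ, Fin.sum_univ_succ, h0]
  simp only [hi, Finset.sum_sub_distrib, ← Finset.mul_sum, hb]
  simp
  field_simp
  ring

def Hom0 {n : ℕ} (ψ : EE n → ℝ) : Prop := ∀ t : ℝ, 0 < t → ∀ x, ψ (t • x) = ψ x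

lemma hext_hom0 {n : ℕ} (φ : EE n → ℝ) : Hom0 (hext φ) := by
  intro t ht x
  simp only [hext, norm_smul, Real.norm_eq_abs, abs_of_pos ht, smul_smul]
  congr 2
  field_simp

lemma Hom0.hext {n : ℕ} {ψ : EE n → ℝ} (h : Hom0 ψ) {x : EE n} (hx : x ≠ 0) : hext ψ x = ψ x :=
  h _ (inv_pos.2 (norm_pos_iff.2 hx)) x

lemma Hom0.hext_ev {n : ℕ} {ψ : EE n → ℝ} (h : Hom0 ψ) {x : EE n} (hx : x ≠ 0) :
    _root_.hext ψ =ᶠ[𝓝 x] ψ := by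
  filter_upwards [isOpen_ne.mem_nhds hx] with y hy using h.hext hy

lemma Hom0.sphLap {n : ℕ} {ψ : EE n → ℝ} (h : Hom0 ψ) {x : EE n} (hx : x ≠ 0) :
    sphLap ψ x = lap ψ x := lap_congr (h.hext_ev hx)

lemma Hom0.fderiv {n : ℕ} {ψ : EE n → ℝ} (h : Hom0 ψ) {t : ℝ} (ht : 0 < t) (x : EE n) :
    fderiv ℝ ψ (t • x) = t⁻¹ • fderiv ℝ ψ x := by
  have h1 : (fun y => ψ (t • y)) = ψ := funext fun y => h t ht y
  have h2 := fderiv_comp_smul (𝕜 := ℝ) (f := ψ) (x := x) t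
  rw [h1] at h2
  rw [h2, smul_smul, inv_mul_cancel₀ ht.ne', one_smul]

lemma Hom0.dd {n : ℕ} {ψ : EE n → ℝ} (h : Hom0 ψ) {t : ℝ} (ht : 0 < t) (x : EE n) :
    dd ψ (t • x) = (t ^ 2)⁻¹ • dd ψ x := by
  have h1 : (fun y => _root_.fderiv ℝ ψ (t • y)) = t⁻¹ • _root_.fderiv ℝ ψ :=
    funext fun y => h.fderiv ht y
  have h2 := fderiv_comp_smul (𝕜 := ℝ) (f := _root_.fderiv ℝ ψ) (x := x) t
  rw [h1] at h2
  have h4 : _root_.fderiv ℝ (t⁻¹ • _root_.fderiv ℝ ψ) x =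
      t⁻¹ • _root_.fderiv ℝ (_root_.fderiv ℝ ψ) x :=
    congrFun (fderiv_const_smul_field (𝕜 := ℝ) (f := _root_.fderiv ℝ ψ) t⁻¹) x
  rw [h4] at h2
  unfold _root_.dd
  have h3 : _root_.fderiv ℝ (_root_.fderiv ℝ ψ) (t • x) =
    t⁻¹ • (t⁻¹ • _root_.fderiv ℝ (_root_.fderiv ℝ ψ) x) := by
    rw [h2, smul_smul, inv_mul_cancel₀ ht.ne', one_smul]
  rw [h3, smul_smul]; congr 1; rw [pow_two, mul_inv]

lemma Hom0.lap {n : ℕ} {ψ : EE n → ℝ} (h : Hom0 ψ) {t : ℝ} (ht : 0 < t) (x : EE n) :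
    lap ψ (t • x) = (t ^ 2)⁻¹ * lap ψ x := by
  rw [lap_eq, lap_eq, h.dd ht, Finset.mul_sum]
  rfl

lemma Hom0.fderiv_self {n : ℕ} {ψ : EE n → ℝ} (h : Hom0 ψ) {x : EE n}
    (hd : DifferentiableAt ℝ ψ x) : _root_.fderiv ℝ ψ x x = 0 := by
  have h1 : HasDerivAt (fun t : ℝ => ψ (t • x)) (_root_.fderiv ℝ ψ x x) 1 := by
    have hl : HasDerivAt (fun t : ℝ => t • x) x 1 := by
      simpa using (hasDerivAt_id (1:ℝ)).smul_const x
    have := HasFDerivAt.comp_hasDerivAt (x := (1:ℝ)) (l := ψ) (f := fun t : ℝ => t • x)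
      (l' := _root_.fderiv ℝ ψ x) (by simpa using hd.hasFDerivAt) hl
    exact this
  have h2 : (fun t : ℝ => ψ (t • x)) =ᶠ[𝓝 1] fun _ => ψ x := by
    filter_upwards [lt_mem_nhds (zero_lt_one)] with t ht using h t ht x
  rw [← h1.deriv, h2.deriv_eq]; simp
end

open MeasureTheory Metric Set Filter Topology
open scoped RealInnerProductSpace
noncomputable section

lemma int_fderiv_zero {n : ℕ} (V : EE n → ℝ) (hV : ContDiff ℝ 1 V) (hc : HasCompactSupport V)
    (v : EE n) : ∫ x, fderiv ℝ V x v = 0 := by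
  have h1 : Integrable (fun x => fderiv ℝ V x v) :=
    ((hV.continuous_fderiv (by simp)).clm_apply continuous_const).integrable_of_hasCompactSupport
      (hc.fderiv_apply (𝕜 := ℝ) v)
  have h2 : Integrable V := hV.continuous.integrable_of_hasCompactSupport hc
  have := integral_mul_fderiv_eq_neg_fderiv_mul_of_integrable (μ := (volume : Measure (EE n)))
    (f := fun _ => (1:ℝ)) (g := V) (v := v) (by simp) (by simpa using h1) (by simpa using h2)
    (fun x _ => by fun_prop) (fun x _ => (hV.differentiable (by simp)) x)
  simpa using this

abbrev bv {n : ℕ} (i : Fin n) : EE n := EuclideanSpace.single i (1:ℝ)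

def gip {n : ℕ} (φ ψ : EE n → ℝ) (x : EE n) : ℝ := ∑ i, fderiv ℝ φ x (bv i) * fderiv ℝ ψ x (bv i)

lemma clm_sum {n : ℕ} (A : EE n →L[ℝ] ℝ) (x : EE n) : A x = ∑ i, x i * A (bv i) := by
  have h : x = ∑ i, x i • bv i := by
    have := (EuclideanSpace.basisFun (Fin n) ℝ).sum_repr x
    simpa using this.symm
  conv_lhs => rw [h]
  rw [map_sum]; simp

lemma gip_self {n : ℕ} (φ : EE n → ℝ) (x : EE n) : gip φ φ x = ∑ i, (fderiv ℝ φ x (bv i)) ^ 2 := by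
  unfold gip; simp [pow_two]

lemma gip_self_nonneg {n : ℕ} (φ : EE n → ℝ) (x : EE n) : 0 ≤ gip φ φ x := by
  rw [gip_self]; positivity

lemma clm_sq_le {n : ℕ} (φ : EE n → ℝ) (x v : EE n) :
    (fderiv ℝ φ x v) ^ 2 ≤ ‖v‖ ^ 2 * gip φ φ x := by
  rw [clm_sum, gip_self, EuclideanSpace.norm_sq_eq]
  simpa using Finset.sum_mul_sq_le_sq_mul_sq Finset.univ (fun i => v i) (fun i => fderiv ℝ φ x (bv i))

lemma Hom0.gip {n : ℕ} {φ ψ : EE n → ℝ} (h : Hom0 φ) (h' : Hom0 ψ) {t : ℝ} (ht : 0 < t) (x : EE n) :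
    gip φ ψ (t • x) = (t ^ 2)⁻¹ * gip φ ψ x := by
  unfold _root_.gip
  rw [h.fderiv ht, h'.fderiv ht, Finset.mul_sum]
  refine Finset.sum_congr rfl fun i _ => ?_
  simp; ring

/-- smooth radial bump supported in the annulus `1 < |x|^2 < 3`. -/
def rbump : ContDiffBump (2:ℝ) := ⟨1/2, 1, by norm_num, by norm_num⟩
def GG {n : ℕ} (x : EE n) : ℝ := rbump (‖x‖ ^ 2)

lemma GG_contDiff {n : ℕ} : ContDiff ℝ 2 (GG (n := n)) :=
  (rbump.contDiff (n := 2)).comp (contDiff_norm_sq ℝ)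

lemma GG_zero {n : ℕ} {x : EE n} (h : ‖x‖ ^ 2 ≤ 1 ∨ 3 ≤ ‖x‖ ^ 2) : GG x = 0 := by
  apply rbump.zero_of_le_dist
  rw [Real.dist_eq]
  show (1:ℝ) ≤ _
  rcases h with h | h
  · rw [abs_of_nonpos] <;> linarith
  · rw [abs_of_nonneg] <;> linarith

lemma GG_compact {n : ℕ} : HasCompactSupport (GG (n := n)) := by
  apply HasCompactSupport.intro (isCompact_closedBall (0 : EE n) 2)
  intro x hx
  apply GG_zero
  right
  simp at hx
  nlinarith

lemma GG_near0 {n : ℕ} : (GG (n := n)) =ᶠ[𝓝 0] 0 := by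
  filter_upwards [ball_mem_nhds (0 : EE n) zero_lt_one] with x hx
  apply GG_zero; left
  simp at hx
  nlinarith [norm_nonneg x]

lemma GG_fderiv {n : ℕ} (x v : EE n) :
    fderiv ℝ GG x v = deriv rbump (‖x‖ ^ 2) * (2 * inner ℝ x v) := by
  have h1 : HasFDerivAt (fun y : EE n => ‖y‖ ^ 2) (2 • innerSL ℝ x) x :=
    (hasStrictFDerivAt_norm_sq x).hasFDerivAt
  have h2 : HasDerivAt rbump (deriv rbump (‖x‖ ^ 2)) (‖x‖ ^ 2) :=
    ((rbump.contDiff (n := 1)).differentiable (by simp) _).hasDerivAt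
  have := (h2.comp_hasFDerivAt x h1).fderiv
  have h3 : fderiv ℝ GG x = deriv rbump (‖x‖ ^ 2) • 2 • innerSL ℝ x := this
  rw [h3]; simp

def cGG (n : ℕ) : ℝ := ∫ s : ℝ, Real.exp (n * s) * (rbump ((Real.exp s) ^ 2) * (Real.exp s) ^ (-2:ℝ))

lemma cGG_pos (n : ℕ) : 0 < cGG n := by
  refine Continuous.integral_pos_of_hasCompactSupport_nonneg_nonzero (x := Real.log (√2)) ?_ ?_ ?_ ?_
  · have : ∀ s : ℝ, (Real.exp s) ^ (-2:ℝ) = Real.exp (s * (-2)) := fun s => by rw [Real.exp_mul]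
    simp only [this]
    have := rbump.continuous
    fun_prop
  · apply HasCompactSupport.intro (isCompact_Icc (a := 0) (b := 3))
    intro s hs
    have : rbump ((Real.exp s) ^ 2) = 0 := by
      apply rbump.zero_of_le_dist
      rw [Real.dist_eq]
      show (1:ℝ) ≤ _
      simp only [mem_Icc, not_and_or, not_le] at hs
      rcases hs with h | h
      · have h1 : Real.exp s < 1 := by simpa using h
        have h2 := Real.exp_pos s
        rw [abs_of_nonpos] <;> nlinarith
      · have h1 : s + 1 ≤ Real.exp s := Real.add_one_le_exp s
        rw [abs_of_nonneg] <;> nlinarith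
    simp [this]
  · intro s
    have := rbump.nonneg (x := (Real.exp s) ^ 2)
    show (0:ℝ) ≤ _
    positivity
  · rw [Real.exp_log (by positivity), Real.sq_sqrt (by norm_num)]
    have : rbump (2:ℝ) = 1 := rbump.one_of_mem_closedBall (by simp [rbump])
    rw [this]
    positivity

/-- radial averaging for functions homogeneous of degree `-2` -/
lemma sphere_of_space {n : ℕ} (hn : 1 ≤ n) (F : EE n → ℝ)
    (hF : ∀ t : ℝ, 0 < t → ∀ x : EE n, F (t • x) = (t ^ 2)⁻¹ * F x) :
    ∫ x, GG x * F x = cGG n * ∫ p : Sph n, F p ∂(sg n) := by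
  have := polar_hom hn (fun r => rbump (r ^ 2)) F (-2) (by
    intro t ht x _
    rw [hF t ht x, Real.rpow_neg ht.le]; norm_num)
  simpa [GG, cGG] using this

lemma contSph {n : ℕ} {F : EE n → ℝ} (h : ∀ x ≠ 0, ContinuousAt F x) :
    Continuous (fun p : Sph n => F p) := by
  rw [continuous_iff_continuousAt]
  intro p
  have hp : (p : EE n) ≠ 0 := by
    intro h0; have := p.2; simp [h0] at this
  exact (h p hp).comp continuous_subtype_val.continuousAt

lemma intSph {n : ℕ} {F : EE n → ℝ} (h : ∀ x ≠ 0, ContinuousAt F x) :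
    Integrable (fun p : Sph n => F p) (sg n) := by
  exact (contSph h).integrable_of_hasCompactSupport (HasCompactSupport.of_compactSpace _)

lemma lap_cont {n : ℕ} {ψ : EE n → ℝ} {x : EE n} (h : ContDiffAt ℝ 2 ψ x) :
    ContinuousAt (lap ψ) x := by
  have : lap ψ = fun y => ∑ i, dd ψ y (bv i) (bv i) := funext fun y => lap_eq ψ y
  rw [this]
  have h1 : ContDiffAt ℝ 0 (dd ψ) x :=
    (h.fderiv_right (m := 1) (by norm_num)).fderiv_right (m := 0) (by norm_num)
  have h2 := h1.continuousAt
  exact tendsto_finsetSum _ fun i _ => (h2.clm_apply continuousAt_const).clm_apply continuousAt_const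

lemma gip_cont {n : ℕ} {φ ψ : EE n → ℝ} {x : EE n} (h : ContDiffAt ℝ 1 φ x) (h' : ContDiffAt ℝ 1 ψ x) :
    ContinuousAt (gip φ ψ) x := by
  have h1 := (h.fderiv_right (m := 0) (by norm_num)).continuousAt
  have h2 := (h'.fderiv_right (m := 0) (by norm_num)).continuousAt
  exact tendsto_finsetSum _ fun i _ => (h1.clm_apply continuousAt_const).mul
    (h2.clm_apply continuousAt_const)

lemma green_cont {n : ℕ} {φ ψ : EE n → ℝ}
    (hφ : ∀ x ≠ 0, ContDiffAt ℝ 1 φ x) (hψ : ∀ x ≠ 0, φ =ᶠ[𝓝 x] 0 ∨ ContDiffAt ℝ 2 ψ x) :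
    (∀ x ≠ 0, ContinuousAt (fun y => φ y * lap ψ y) x) ∧ (∀ x ≠ 0, ContinuousAt (gip φ ψ) x) := by
  constructor
  · intro x hx
    rcases hψ x hx with h | h
    · have : (fun y => φ y * lap ψ y) =ᶠ[𝓝 x] fun _ => 0 := by
        filter_upwards [h] with y hy; simp [hy]
      exact this.continuousAt
    · exact (hφ x hx).continuousAt.mul (lap_cont h)
  · intro x hx
    rcases hψ x hx with h | h
    · have : gip φ ψ =ᶠ[𝓝 x] fun _ => 0 := by
        filter_upwards [h.fderiv (𝕜 := ℝ)] with y hy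
        unfold gip
        simp [hy]
      exact this.continuousAt
    · exact gip_cont (hφ x hx) (h.of_le (by norm_num))

lemma green {n : ℕ} (hn : 1 ≤ n) {φ ψ : EE n → ℝ} (h0 : Hom0 φ) (h0' : Hom0 ψ)
    (hφ : ∀ x ≠ 0, ContDiffAt ℝ 1 φ x) (hψ : ∀ x ≠ 0, φ =ᶠ[𝓝 x] 0 ∨ ContDiffAt ℝ 2 ψ x) :
    ∫ p : Sph n, φ p * lap ψ p ∂(sg n) = - ∫ p : Sph n, gip φ ψ p ∂(sg n) := by
  obtain ⟨hc1, hc2⟩ := green_cont hφ hψ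
  let V : Fin n → EE n → ℝ := fun i x => GG x * (φ x * fderiv ℝ ψ x (bv i))
  have hV : ∀ i, ContDiff ℝ 1 (V i) := by
    intro i
    rw [contDiff_iff_contDiffAt]
    intro x
    rcases eq_or_ne x 0 with rfl | hx
    · have : V i =ᶠ[𝓝 0] fun _ => 0 := by
        filter_upwards [GG_near0] with y hy; simp [V, hy]
      exact contDiffAt_const.congr_of_eventuallyEq this
    · rcases hψ x hx with h | h
      · have : V i =ᶠ[𝓝 x] fun _ => 0 := by
          filter_upwards [h] with y hy; simp [V, hy]
        exact contDiffAt_const.congr_of_eventuallyEq this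
      · exact ((GG_contDiff.of_le (by norm_num)).contDiffAt).mul ((hφ x hx).mul
          ((h.fderiv_right (m := 1) (by norm_num)).clm_apply contDiffAt_const))
  have hVc : ∀ i, HasCompactSupport (V i) := fun i => GG_compact.mul_right
  have hz : ∑ i, ∫ x, fderiv ℝ (V i) x (bv i) = 0 :=
    Finset.sum_eq_zero fun i _ => int_fderiv_zero _ (hV i) (hVc i) _
  have hpt : ∀ x, ∑ i, fderiv ℝ (V i) x (bv i) = GG x * (gip φ ψ x + φ x * lap ψ x) := by
    intro x
    rcases eq_or_ne x 0 with rfl | hx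
    · have : ∀ i, V i =ᶠ[𝓝 0] fun _ => 0 := by
        intro i
        filter_upwards [GG_near0] with y hy; simp [V, hy]
      have h2 : ∀ i, fderiv ℝ (V i) 0 = 0 := fun i => by rw [(this i).fderiv_eq]; simp
      rw [GG_zero (by simp)]
      simp [h2]
    · rcases hψ x hx with h | h
      · have : ∀ i, V i =ᶠ[𝓝 x] fun _ => 0 := by
          intro i
          filter_upwards [h] with y hy; simp [V, hy]
        have h2 : ∀ i, fderiv ℝ (V i) x = 0 := fun i => by rw [(this i).fderiv_eq]; simp
        have h3 : fderiv ℝ φ x = 0 := by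
          rw [Filter.EventuallyEq.fderiv_eq h]; simp
        have h4 : φ x = 0 := h.self_of_nhds
        simp [h2, gip, h3, h4]
      · have hψd : DifferentiableAt ℝ ψ x := h.differentiableAt (by norm_num)
        have hs := h0'.fderiv_self hψd
        have hdG : DifferentiableAt ℝ GG x := (GG_contDiff.differentiable (by norm_num)) x
        have hdφ : DifferentiableAt ℝ φ x := (hφ x hx).differentiableAt (by norm_num)
        have hdψ : DifferentiableAt ℝ (fderiv ℝ ψ) x :=
          (h.fderiv_right (m := 1) (by norm_num)).differentiableAt (by norm_num)
        have hi : ∀ i, fderiv ℝ (V i) x (bv i) =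
            deriv rbump (‖x‖ ^ 2) * 2 * φ x * (x i * fderiv ℝ ψ x (bv i)) +
            GG x * (fderiv ℝ φ x (bv i) * fderiv ℝ ψ x (bv i)) +
            GG x * φ x * dd ψ x (bv i) (bv i) := by
          intro i
          have h5 : HasFDerivAt (fun y => fderiv ℝ ψ y (bv i)) ((dd ψ x).flip (bv i)) x := by
            have := hdψ.hasFDerivAt.clm_apply (hasFDerivAt_const (bv i) x)
            refine this.congr_fderiv ?_
            simp [dd]
          have h6 := (hdG.hasFDerivAt.mul (hdφ.hasFDerivAt.mul h5)).fderiv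
          have h7 : fderiv ℝ (V i) x = _ := h6
          rw [h7]
          have h8 := GG_fderiv x (bv i)
          simp only [add_apply, smul_apply, smul_eq_mul,
            Pi.mul_apply, h8, ContinuousLinearMap.flip_apply]
          have h9 : inner ℝ x (bv i) = x i := by simp [bv, EuclideanSpace.inner_single_right]
          rw [h9]
          ring
        simp only [hi, Finset.sum_add_distrib, ← Finset.mul_sum]
        rw [← clm_sum, hs, ← lap_eq]
        unfold gip; ring
  rw [← integral_finsetSum] at hz
  · simp only [hpt] at hz
    rw [sphere_of_space hn (fun x => gip φ ψ x + φ x * lap ψ x)] at hz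
    · have := (mul_eq_zero.1 hz).resolve_left (cGG_pos n).ne'
      rw [integral_add (intSph hc2) (intSph hc1)] at this
      linarith
    · intro t ht x
      rw [h0.gip h0' ht, h0'.lap ht, h0 t ht]; ring
  · intro i _
    exact (((hV i).continuous_fderiv (by simp)).clm_apply
      continuous_const).integrable_of_hasCompactSupport ((hVc i).fderiv_apply (𝕜 := ℝ) _)
end

open MeasureTheory Metric Set Filter Topology
open scoped RealInnerProductSpace
noncomputable section

def bet (η s : ℝ) : ℝ := ∫ x in (0:ℝ)..s, Real.smoothTransition (x / η)

lemma bet_cont (η : ℝ) : Continuous (fun x : ℝ => Real.smoothTransition (x / η)) :=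
  Real.smoothTransition.continuous.comp (by fun_prop)

lemma bet_deriv (η s : ℝ) : HasDerivAt (bet η) (Real.smoothTransition (s / η)) s :=
  intervalIntegral.integral_hasDerivAt_right ((bet_cont η).intervalIntegrable _ _)
    ((bet_cont η).stronglyMeasurableAtFilter _ _) (bet_cont η).continuousAt

lemma bet_deriv_eq (η : ℝ) : deriv (bet η) = fun s => Real.smoothTransition (s / η) :=
  funext fun s => (bet_deriv η s).deriv

lemma bet_contDiff (η : ℝ) : ContDiff ℝ 2 (bet η) := by
  have : ContDiff ℝ (1 + 1) (bet η) := by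
    rw [contDiff_succ_iff_deriv]
    refine ⟨fun s => (bet_deriv η s).differentiableAt, by simp, ?_⟩
    rw [bet_deriv_eq]
    exact Real.smoothTransition.contDiff.comp (by fun_prop)
  exact this.of_le (by norm_num)

lemma bet_of_nonpos {η : ℝ} (hη : 0 < η) {s : ℝ} (hs : s ≤ 0) : bet η s = 0 := by
  unfold bet
  rw [intervalIntegral.integral_symm, intervalIntegral.integral_congr (g := fun _ => (0:ℝ))]
  · simp
  · intro x hx
    rw [uIcc_of_le hs] at hx
    exact Real.smoothTransition.zero_of_nonpos (div_nonpos_of_nonpos_of_nonneg hx.2 hη.le)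

lemma bet_nonneg {η : ℝ} (hη : 0 < η) (s : ℝ) : 0 ≤ bet η s := by
  rcases le_total s 0 with h | h
  · rw [bet_of_nonpos hη h]
  · exact intervalIntegral.integral_nonneg h fun x _ => Real.smoothTransition.nonneg _

lemma bet_le {η : ℝ} (_hη : 0 < η) {s : ℝ} (hs : 0 ≤ s) : bet η s ≤ s := by
  have : bet η s ≤ ∫ x in (0:ℝ)..s, (1:ℝ) :=
    intervalIntegral.integral_mono_on hs ((bet_cont η).intervalIntegrable _ _)
      (by simp) fun x _ => Real.smoothTransition.le_one _
  simpa using this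

lemma bet_ge {η : ℝ} (hη : 0 < η) (s : ℝ) : s - η ≤ bet η s := by
  rcases le_total s η with h | h
  · linarith [bet_nonneg hη s]
  · have h1 : bet η s = bet η η + ∫ x in η..s, Real.smoothTransition (x / η) :=
      (intervalIntegral.integral_add_adjacent_intervals ((bet_cont η).intervalIntegrable _ _)
        ((bet_cont η).intervalIntegrable _ _)).symm
    have h2 : ∫ x in η..s, Real.smoothTransition (x / η) = ∫ x in η..s, (1:ℝ) := by
      apply intervalIntegral.integral_congr
      intro x hx
      rw [uIcc_of_le h] at hx
      exact Real.smoothTransition.one_of_one_le (by rw [le_div_iff₀ hη]; linarith [hx.1])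
    rw [h1, h2]
    simp
    exact bet_nonneg hη _

/-- smooth absolute value -/
def sabs (η s : ℝ) : ℝ := bet η s + bet η (-s)
/-- odd cutoff -/
def ocut (η s : ℝ) : ℝ := bet η (s - η) - bet η (-s - η)

lemma sabs_contDiff (η : ℝ) : ContDiff ℝ 2 (sabs η) :=
  (bet_contDiff η).add ((bet_contDiff η).comp contDiff_neg)

lemma ocut_contDiff (η : ℝ) : ContDiff ℝ 2 (ocut η) :=
  ((bet_contDiff η).comp (by fun_prop)).sub ((bet_contDiff η).comp (by fun_prop))

lemma sabs_nonneg {η : ℝ} (hη : 0 < η) (s : ℝ) : 0 ≤ sabs η s :=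
  add_nonneg (bet_nonneg hη _) (bet_nonneg hη _)

lemma sabs_zero {η : ℝ} (hη : 0 < η) : sabs η 0 = 0 := by
  simp [sabs, bet_of_nonpos hη]

lemma sabs_le {η : ℝ} (hη : 0 < η) (s : ℝ) : sabs η s ≤ |s| := by
  unfold sabs
  rcases le_total s 0 with h | h
  · rw [bet_of_nonpos hη h, abs_of_nonpos h, zero_add]; exact bet_le hη (by linarith)
  · rw [bet_of_nonpos hη (s := -s) (by linarith), abs_of_nonneg h, add_zero]; exact bet_le hη h

lemma sabs_ge {η : ℝ} (hη : 0 < η) (s : ℝ) : |s| - η ≤ sabs η s := by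
  unfold sabs
  rcases le_total s 0 with h | h
  · rw [abs_of_nonpos h]; linarith [bet_nonneg hη s, bet_ge hη (-s)]
  · rw [abs_of_nonneg h]; linarith [bet_nonneg hη (-s), bet_ge hη s]

lemma sabs_deriv {η : ℝ} (s : ℝ) : HasDerivAt (sabs η)
    (Real.smoothTransition (s / η) - Real.smoothTransition (-s / η)) s := by
  have h1 : HasDerivAt (fun s : ℝ => -s) (-1) s := (hasDerivAt_id s).neg
  have := (bet_deriv η s).add ((bet_deriv η (-s)).comp s h1)
  refine this.congr_deriv ?_
  ring

lemma sabs_deriv_le {η : ℝ} (s : ℝ) : |deriv (sabs η) s| ≤ 1 := by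
  rw [(sabs_deriv s).deriv, abs_le]
  have := Real.smoothTransition.nonneg (s / η)
  have := Real.smoothTransition.le_one (s / η)
  have := Real.smoothTransition.nonneg (-s / η)
  have := Real.smoothTransition.le_one (-s / η)
  constructor <;> linarith

lemma ocut_deriv {η : ℝ} (s : ℝ) : HasDerivAt (ocut η)
    (Real.smoothTransition ((s - η) / η) + Real.smoothTransition ((-s - η) / η)) s := by
  have h1 : HasDerivAt (fun s : ℝ => -s - η) (-1) s := ((hasDerivAt_id s).neg).sub_const η
  have h2 : HasDerivAt (fun s : ℝ => s - η) 1 s := (hasDerivAt_id s).sub_const η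
  have := ((bet_deriv η (s - η)).comp s h2).sub ((bet_deriv η (-s - η)).comp s h1)
  refine this.congr_deriv ?_
  ring

lemma ocut_zero {η : ℝ} (hη : 0 < η) {s : ℝ} (hs : |s| ≤ η) : ocut η s = 0 := by
  rw [abs_le] at hs
  unfold ocut
  rw [bet_of_nonpos hη, bet_of_nonpos hη] <;> linarith

lemma ocut_abs_le {η : ℝ} (hη : 0 < η) (s : ℝ) : |ocut η s| ≤ |s| := by
  unfold ocut
  rcases le_total s 0 with h | h
  · rw [bet_of_nonpos hη (s := s - η) (by linarith), abs_of_nonpos h, zero_sub, abs_neg,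
      abs_of_nonneg (bet_nonneg hη _)]
    rcases le_total 0 (-s - η) with h1 | h1
    · linarith [bet_le hη h1]
    · rw [bet_of_nonpos hη h1]; linarith
  · rw [bet_of_nonpos hη (s := -s - η) (by linarith), abs_of_nonneg h, sub_zero,
      abs_of_nonneg (bet_nonneg hη _)]
    rcases le_total 0 (s - η) with h1 | h1
    · linarith [bet_le hη h1]
    · rw [bet_of_nonpos hη h1]; linarith

lemma ocut_close {η : ℝ} (hη : 0 < η) (s : ℝ) : |ocut η s - s| ≤ 2 * η := by
  unfold ocut
  have h1 := bet_ge hη (s - η)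
  have h2 := bet_ge hη (-s - η)
  rcases le_total s 0 with h | h
  · rw [bet_of_nonpos hη (s := s - η) (by linarith)]
    rw [abs_le]
    rcases le_total 0 (-s - η) with h1 | h1
    · constructor <;> linarith [bet_le hη h1]
    · rw [bet_of_nonpos hη h1]; constructor <;> linarith
  · rw [bet_of_nonpos hη (s := -s - η) (by linarith)]
    rw [abs_le]
    rcases le_total 0 (s - η) with h1 | h1
    · constructor <;> linarith [bet_le hη h1]
    · rw [bet_of_nonpos hη h1]; constructor <;> linarith

lemma ocut_deriv_mem {η : ℝ} (hη : 0 < η) (s : ℝ) : 0 ≤ deriv (ocut η) s ∧ deriv (ocut η) s ≤ 1 := by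
  rw [(ocut_deriv s).deriv]
  refine ⟨add_nonneg (Real.smoothTransition.nonneg _) (Real.smoothTransition.nonneg _), ?_⟩
  rcases le_total s 0 with h | h
  · rw [Real.smoothTransition.zero_of_nonpos (x := (s - η) / η)
      (div_nonpos_of_nonpos_of_nonneg (by linarith) hη.le), zero_add]
    exact Real.smoothTransition.le_one _
  · rw [Real.smoothTransition.zero_of_nonpos (x := (-s - η) / η)
      (div_nonpos_of_nonpos_of_nonneg (by linarith) hη.le), add_zero]
    exact Real.smoothTransition.le_one _

lemma ocut_deriv_one {η : ℝ} (hη : 0 < η) {s : ℝ} (hs : 2 * η ≤ |s|) : deriv (ocut η) s = 1 := by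
  rw [(ocut_deriv s).deriv]
  rcases le_total s 0 with h | h
  · rw [abs_of_nonpos h] at hs
    rw [Real.smoothTransition.zero_of_nonpos (x := (s - η) / η)
      (div_nonpos_of_nonpos_of_nonneg (by linarith) hη.le), zero_add]
    exact Real.smoothTransition.one_of_one_le (by rw [le_div_iff₀ hη]; linarith)
  · rw [abs_of_nonneg h] at hs
    rw [Real.smoothTransition.zero_of_nonpos (x := (-s - η) / η)
      (div_nonpos_of_nonpos_of_nonneg (by linarith) hη.le), add_zero]
    exact Real.smoothTransition.one_of_one_le (by rw [le_div_iff₀ hη]; linarith)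

lemma ae_grad_zero {n : ℕ} (hn : 1 ≤ n) {φ : EE n → ℝ} {U : Set (EE n)} (hU : IsOpen U)
    (hd : ∀ x ∈ U, DifferentiableAt ℝ φ x) :
    ∀ᵐ x : EE n, x ∈ U → φ x = 0 → fderiv ℝ φ x = 0 := by
  let e : EE n := bv ⟨0, hn⟩
  have he : e ≠ 0 := by simp [e, bv]
  let s : Set (EE n) := U ∩ φ ⁻¹' {0}
  have hs : MeasurableSet s := by
    have hc : ContinuousOn φ U := fun x hx => (hd x hx).continuousAt.continuousWithinAt
    have h1 := (hc.isOpen_inter_preimage hU (isOpen_compl_singleton (x := (0:ℝ)))).measurableSet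
    have : s = U \ (U ∩ φ ⁻¹' {0}ᶜ) := by ext x; simp [s]
    rw [this]; exact hU.measurableSet.diff h1
  have hA : ApproximatesLinearOn (fun x => φ x • e) (0 : EE n →L[ℝ] EE n) s 0 := by
    intro x hx y hy
    have h1 : φ x = 0 := hx.2
    have h2 : φ y = 0 := hy.2
    simp [h1, h2]
  have := hA.norm_fderiv_sub_le (μ := volume) hs (fun x => (fderiv ℝ φ x).smulRight e)
    (fun x hx => ((hd x hx.1).hasFDerivAt.smul_const e).hasFDerivWithinAt)
  rw [ae_restrict_iff' hs] at this
  filter_upwards [this] with x hx hU h0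
  have h3 := hx ⟨hU, h0⟩
  simp at h3
  exact h3.resolve_right he
end

open MeasureTheory Metric Set Filter Topology
open scoped RealInnerProductSpace
noncomputable section

instance (n : ℕ) : (sg n).IsOpenPosMeasure := by unfold sg; infer_instance

lemma cone_smul {n : ℕ} {S : Set (EE n)} {t : ℝ} (ht : 0 < t) {x : EE n} :
    t • x ∈ coneOf S ↔ x ∈ coneOf S := by
  unfold coneOf
  simp only [mem_setOf_eq, norm_smul, Real.norm_eq_abs, abs_of_pos ht, smul_smul, ne_eq, smul_eq_zero,
    ht.ne', false_or]
  have : (t * ‖x‖)⁻¹ * t = ‖x‖⁻¹ := by field_simp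
  rw [this]

lemma cone_open {n : ℕ} {S : Set (EE n)} (hS : IsSphDomain S) : IsOpen (coneOf S) := by
  obtain ⟨h1, h2, -⟩ := hS
  obtain ⟨W, hW, hWS⟩ := isOpen_induced_iff.1 h2
  have : coneOf S = {0}ᶜ ∩ (fun x : EE n => ‖x‖⁻¹ • x) ⁻¹' W := by
    ext x
    simp only [coneOf, mem_setOf_eq, mem_inter_iff, mem_compl_iff, mem_singleton_iff, mem_preimage]
    refine and_congr_right fun hx => ?_
    have hxs : ‖x‖⁻¹ • x ∈ Metric.sphere (0 : EE n) 1 := by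
      simp [norm_smul, norm_ne_zero_iff.2 hx]
    have := Set.ext_iff.1 hWS ⟨_, hxs⟩
    simpa using this.symm
  rw [this]
  refine ContinuousOn.isOpen_inter_preimage ?_ isOpen_compl_singleton hW
  intro x hx
  exact (nrm_contDiffAt hx 1).continuousAt.continuousWithinAt

lemma cone_ne {n : ℕ} {S : Set (EE n)} {x : EE n} (h : x ∈ coneOf S) : x ≠ 0 := h.1

lemma sph_ne {n : ℕ} (p : Sph n) : (p : EE n) ≠ 0 := by
  intro h0; have := p.2; simp [h0] at this

lemma mem_cone_sph {n : ℕ} {S : Set (EE n)} {x : EE n} (hx : ‖x‖ = 1) : x ∈ coneOf S ↔ x ∈ S := by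
  have h0 : x ≠ 0 := by intro h; simp [h] at hx
  simp [coneOf, hx, h0]

/-- test functions -/
structure TT {n : ℕ} (S : Set (EE n)) (ψ : EE n → ℝ) : Prop where
  hom : Hom0 ψ
  cd : ∀ x ≠ 0, ContDiffAt ℝ 2 ψ x
  sup : ∀ x ≠ 0, x ∉ coneOf S → ψ =ᶠ[𝓝 x] 0

/-- test functions without support condition are `TT univ` -/
def sI {n : ℕ} (F : EE n → ℝ) : ℝ := ∫ p : Sph n, F p ∂(sg n)
def DD {n : ℕ} (φ ψ : EE n → ℝ) : ℝ := sI (gip φ ψ)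

lemma TT.mono {n : ℕ} {S : Set (EE n)} {ψ : EE n → ℝ} (h : TT S ψ) : TT univ ψ :=
  ⟨h.hom, h.cd, fun x hx hx' => absurd ⟨hx, mem_univ _⟩ hx'⟩

lemma TT.cd1 {n : ℕ} {S : Set (EE n)} {ψ : EE n → ℝ} (h : TT S ψ) (x : EE n) (hx : x ≠ 0) :
    ContDiffAt ℝ 1 ψ x := (h.cd x hx).of_le (by norm_num)

lemma TT.cont {n : ℕ} {S : Set (EE n)} {ψ : EE n → ℝ} (h : TT S ψ) (x : EE n) (hx : x ≠ 0) :
    ContinuousAt ψ x := (h.cd x hx).continuousAt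

lemma TT.da {n : ℕ} {S : Set (EE n)} {ψ : EE n → ℝ} (h : TT S ψ) (x : EE n) (hx : x ≠ 0) :
    DifferentiableAt ℝ ψ x := (h.cd x hx).differentiableAt (by norm_num)

lemma TT.contgip {n : ℕ} {S S' : Set (EE n)} {ψ φ : EE n → ℝ} (h : TT S ψ) (h' : TT S' φ)
    (x : EE n) (hx : x ≠ 0) : ContinuousAt (gip ψ φ) x := gip_cont (h.cd1 x hx) (h'.cd1 x hx)

lemma TT.contlap {n : ℕ} {S : Set (EE n)} {ψ : EE n → ℝ} (h : TT S ψ) (x : EE n) (hx : x ≠ 0) :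
    ContinuousAt (lap ψ) x := lap_cont (h.cd x hx)

lemma TT.comp {n : ℕ} {S : Set (EE n)} {ψ : EE n → ℝ} (h : TT S ψ) {B : ℝ → ℝ} (hB : ContDiff ℝ 2 B)
    (hB0 : B 0 = 0) : TT S (fun x => B (ψ x)) := by
  refine ⟨fun t ht x => by simp only [h.hom t ht x], fun x hx => ?_, fun x hx hx' => ?_⟩
  · exact hB.contDiffAt.comp x (h.cd x hx)
  · filter_upwards [h.sup x hx hx'] with y hy
    simp [hy, hB0]

lemma TT.add {n : ℕ} {S : Set (EE n)} {ψ φ : EE n → ℝ} (h : TT S ψ) (h' : TT S φ) :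
    TT S (fun x => ψ x + φ x) := by
  refine ⟨fun t ht x => by simp only [h.hom t ht x, h'.hom t ht x], fun x hx => ?_, fun x hx hx' => ?_⟩
  · exact (h.cd x hx).add (h'.cd x hx)
  · filter_upwards [h.sup x hx hx', h'.sup x hx hx'] with y hy hy'
    simp [hy, hy']

lemma TT.smul {n : ℕ} {S : Set (EE n)} {ψ : EE n → ℝ} (h : TT S ψ) (c : ℝ) :
    TT S (fun x => c * ψ x) := h.comp (B := fun s => c * s) (by fun_prop) (by simp)

lemma gip_comp {n : ℕ} {ψ : EE n → ℝ} {x : EE n} {B : ℝ → ℝ} (hB : DifferentiableAt ℝ B (ψ x))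
    (hψ : DifferentiableAt ℝ ψ x) (φ : EE n → ℝ) :
    gip (fun y => B (ψ y)) φ x = deriv B (ψ x) * gip ψ φ x := by
  have h : fderiv ℝ (fun y => B (ψ y)) x = deriv B (ψ x) • fderiv ℝ ψ x :=
    (hB.hasDerivAt.comp_hasFDerivAt x hψ.hasFDerivAt).fderiv
  unfold gip
  rw [h, Finset.mul_sum]
  refine Finset.sum_congr rfl fun i _ => ?_
  simp; ring

lemma gip_comm {n : ℕ} (φ ψ : EE n → ℝ) (x : EE n) : gip φ ψ x = gip ψ φ x := by
  unfold gip
  exact Finset.sum_congr rfl fun i _ => mul_comm _ _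

lemma gip_comp2 {n : ℕ} {ψ : EE n → ℝ} {x : EE n} {B : ℝ → ℝ} (hB : DifferentiableAt ℝ B (ψ x))
    (hψ : DifferentiableAt ℝ ψ x) :
    gip (fun y => B (ψ y)) (fun y => B (ψ y)) x = deriv B (ψ x) ^ 2 * gip ψ ψ x := by
  rw [gip_comp hB hψ, gip_comm, gip_comp hB hψ]; ring

/-- quadratic expansion -/
lemma gip_add_smul {n : ℕ} {ψ φ : EE n → ℝ} {x : EE n} (h : DifferentiableAt ℝ ψ x)
    (h' : DifferentiableAt ℝ φ x) (c : ℝ) :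
    gip (fun y => ψ y + c * φ y) (fun y => ψ y + c * φ y) x =
      gip ψ ψ x + 2 * c * gip ψ φ x + c ^ 2 * gip φ φ x := by
  have h1 : fderiv ℝ (fun y => ψ y + c * φ y) x = fderiv ℝ ψ x + c • fderiv ℝ φ x :=
    (h.hasFDerivAt.add (h'.hasFDerivAt.const_mul c)).fderiv
  unfold gip
  rw [h1, Finset.mul_sum, Finset.mul_sum, ← Finset.sum_add_distrib, ← Finset.sum_add_distrib]
  refine Finset.sum_congr rfl fun i _ => ?_
  simp; ring

lemma sI_congr {n : ℕ} {F G : EE n → ℝ} (h : ∀ x ≠ 0, F x = G x) : sI F = sI G := by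
  unfold sI; congr 1; funext p; exact h p (sph_ne p)

lemma sI_mono {n : ℕ} {F G : EE n → ℝ} (hF : ∀ x ≠ 0, ContinuousAt F x)
    (hG : ∀ x ≠ 0, ContinuousAt G x) (h : ∀ x ≠ 0, F x ≤ G x) : sI F ≤ sI G :=
  integral_mono (intSph hF) (intSph hG) fun p => h p (sph_ne p)

lemma sI_nonneg {n : ℕ} {F : EE n → ℝ} (h : ∀ x, 0 ≤ F x) : 0 ≤ sI F :=
  integral_nonneg fun p => h p

lemma sI_add {n : ℕ} {F G : EE n → ℝ} (hF : ∀ x ≠ 0, ContinuousAt F x)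
    (hG : ∀ x ≠ 0, ContinuousAt G x) : sI (fun x => F x + G x) = sI F + sI G :=
  integral_add (intSph hF) (intSph hG)

lemma sI_mul {n : ℕ} (c : ℝ) (F : EE n → ℝ) : sI (fun x => c * F x) = c * sI F :=
  integral_const_mul c _

def lam1 {n : ℕ} (S : Set (EE n)) : ℝ :=
  sInf {q | ∃ ψ, TT S ψ ∧ sI (fun x => ψ x ^ 2) = 1 ∧ q = DD ψ ψ}

lemma DD_nonneg {n : ℕ} (ψ : EE n → ℝ) : 0 ≤ DD ψ ψ := sI_nonneg fun x => gip_self_nonneg ψ x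

lemma lam1_nonneg {n : ℕ} (S : Set (EE n)) : 0 ≤ lam1 S := by
  apply Real.sInf_nonneg
  rintro q ⟨ψ, -, -, rfl⟩
  exact DD_nonneg ψ

lemma DD_smul {n : ℕ} {S : Set (EE n)} {ψ : EE n → ℝ} (h : TT S ψ) (c : ℝ) :
    DD (fun x => c * ψ x) (fun x => c * ψ x) = c ^ 2 * DD ψ ψ := by
  unfold DD
  rw [← sI_mul]
  refine sI_congr fun x hx => ?_
  rw [gip_comp2 (B := fun s => c * s) (by fun_prop) (h.da x hx)]
  congr 2
  simp

lemma lam1_le {n : ℕ} {S : Set (EE n)} {ψ : EE n → ℝ} (h : TT S ψ) :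
    lam1 S * sI (fun x => ψ x ^ 2) ≤ DD ψ ψ := by
  set a := sI (fun x => ψ x ^ 2) with ha
  have ha0 : 0 ≤ a := sI_nonneg fun x => sq_nonneg _
  rcases ha0.eq_or_lt with h0 | h0
  · rw [← h0, mul_zero]; exact DD_nonneg ψ
  · have hc : ((√a)⁻¹) ^ 2 = a⁻¹ := by rw [inv_pow, Real.sq_sqrt ha0]
    have h1 : lam1 S ≤ DD (fun x => (√a)⁻¹ * ψ x) (fun x => (√a)⁻¹ * ψ x) := by
      apply csInf_le
      · refine ⟨0, ?_⟩
        rintro q ⟨ψ, -, -, rfl⟩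
        exact DD_nonneg ψ
      · refine ⟨_, h.smul _, ?_, rfl⟩
        have : (fun x => ((√a)⁻¹ * ψ x) ^ 2) = fun x => a⁻¹ * (ψ x ^ 2) := by
          funext x; rw [mul_pow, hc]
        rw [this, sI_mul, ← ha, inv_mul_cancel₀ h0.ne']
    rw [DD_smul h, hc] at h1
    have := mul_le_mul_of_nonneg_right h1 ha0
    calc _ ≤ _ := this
      _ = _ := by field_simp

lemma TT_exists {n : ℕ} {S : Set (EE n)} (hS : IsSphDomain S) :
    ∃ ψ, TT S ψ ∧ sI (fun x => ψ x ^ 2) = 1 := by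
  obtain ⟨x0, hx0⟩ := hS.2.2.nonempty
  have hx1 : ‖x0‖ = 1 := by simpa using hS.1 hx0
  have hx00 : x0 ≠ 0 := by intro h; simp [h] at hx1
  have hx0c : x0 ∈ coneOf S := (mem_cone_sph hx1).2 hx0
  obtain ⟨r, hr, hrs⟩ := Metric.isOpen_iff.1 (cone_open hS) x0 hx0c
  let f : ContDiffBump x0 := ⟨r/4, r/2, by linarith, by linarith⟩
  have hT : TT S (hext f) := by
    refine ⟨hext_hom0 _, fun x hx => ?_, fun x hx hx' => ?_⟩
    · exact f.contDiff.contDiffAt.comp x (nrm_contDiffAt hx 2)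
    · have hc : ContinuousAt (fun y : EE n => ‖y‖⁻¹ • y) x := (nrm_contDiffAt hx 1).continuousAt
      have hnx : ‖x‖⁻¹ • x ∈ (closedBall x0 (r/2))ᶜ := by
        intro hm
        exact hx' ((cone_smul (inv_pos.2 (norm_pos_iff.2 hx))).1
          (hrs (closedBall_subset_ball (by linarith) hm)))
      filter_upwards [hc (isClosed_closedBall.isOpen_compl.mem_nhds hnx)] with y hy
      apply f.zero_of_le_dist
      have : y ∈ (fun y : EE n => ‖y‖⁻¹ • y) ⁻¹' (closedBall x0 (r/2))ᶜ := hy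
      simp only [mem_preimage, mem_compl_iff, mem_closedBall, not_le] at this
      exact this.le
  have hpos : 0 < sI (fun x => (hext f x) ^ 2) := by
    refine Continuous.integral_pos_of_hasCompactSupport_nonneg_nonzero (x := ⟨x0, hS.1 hx0⟩)
      (contSph fun x hx => (hT.cont x hx).pow 2) (HasCompactSupport.of_compactSpace _)
      (fun p => sq_nonneg _) ?_
    have : f x0 = 1 := f.one_of_mem_closedBall (by simp [f]; linarith)
    simp [hext, hx1, this]
  set a := sI (fun x => (hext f x) ^ 2) with ha
  refine ⟨fun x => (√a)⁻¹ * hext f x, hT.smul _, ?_⟩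
  have hc : ((√a)⁻¹) ^ 2 = a⁻¹ := by rw [inv_pow, Real.sq_sqrt hpos.le]
  have : (fun x => ((√a)⁻¹ * hext f x) ^ 2) = fun x => a⁻¹ * (hext f x ^ 2) := by
    funext x; rw [mul_pow, hc]
  rw [this, sI_mul, ← ha, inv_mul_cancel₀ hpos.ne']

lemma green' {n : ℕ} (hn : 1 ≤ n) {S S' : Set (EE n)} {φ ψ : EE n → ℝ} (h : TT S φ) (h' : TT S' ψ) :
    sI (fun x => φ x * lap ψ x) = - DD φ ψ :=
  green hn h.hom h'.hom h.cd1 fun x hx => Or.inr (h'.cd x hx)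
end

open MeasureTheory Metric Set Filter Topology
open scoped RealInnerProductSpace
noncomputable section

lemma bdd_near {n : ℕ} {f : EE n → ℝ} {T V : Set (EE n)} (hf : ContDiffOn ℝ 2 f T) (hV : IsOpen V)
    (hVT : V ⊆ T) {x0 : EE n} (hx0 : x0 ∈ T) :
    ∃ w ∈ 𝓝 x0, ∃ M : ℝ, ∀ x ∈ w ∩ V, |f x| ≤ M ∧ ‖fderiv ℝ f x‖ ≤ M ∧ ‖dd f x‖ ≤ M := by
  have h2 : ContDiffWithinAt ℝ (1 + 1) f T x0 := (hf x0 hx0).of_le (by norm_num)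
  obtain ⟨u, hu, -, f', hf', hc'⟩ := (contDiffWithinAt_succ_iff_hasFDerivWithinAt (by simp)).1 h2
  have h1 : ContDiffWithinAt ℝ (0 + 1) f' u x0 := hc'.of_le (by norm_num)
  obtain ⟨u2, hu2, -, f'', hf'', hc''⟩ := (contDiffWithinAt_succ_iff_hasFDerivWithinAt (by simp)).1 h1
  rw [insert_eq_of_mem hx0] at hu
  have hx0u : x0 ∈ u := mem_of_mem_nhdsWithin hx0 hu
  rw [insert_eq_of_mem hx0u] at hu2
  have hu2T : u2 ∈ 𝓝[T] x0 := by
    have := nhdsWithin_le_of_mem hu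
    exact this hu2
  have hbf : ∀ᶠ x in 𝓝[T] x0, |f x| < |f x0| + 1 :=
    (hf x0 hx0).continuousWithinAt.abs.eventually_lt_const (by linarith)
  have hbf' : ∀ᶠ x in 𝓝[u] x0, ‖f' x‖ < ‖f' x0‖ + 1 :=
    hc'.continuousWithinAt.norm.eventually_lt_const (by linarith)
  have hbf'' : ∀ᶠ x in 𝓝[u2] x0, ‖f'' x‖ < ‖f'' x0‖ + 1 :=
    hc''.continuousWithinAt.norm.eventually_lt_const (by linarith)
  have hA : ∀ᶠ x in 𝓝[T] x0, x ∈ u ∧ x ∈ u2 ∧ |f x| < |f x0| + 1 ∧ ‖f' x‖ < ‖f' x0‖ + 1 ∧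
      ‖f'' x‖ < ‖f'' x0‖ + 1 := by
    filter_upwards [hu, hu2T, hbf, nhdsWithin_le_of_mem hu hbf', nhdsWithin_le_of_mem hu2T hbf'']
      with x a b c d e using ⟨a, b, c, d, e⟩
  obtain ⟨w, hw, hwo, hwA⟩ := mem_nhdsWithin.1 hA
  refine ⟨w, hw.mem_nhds hwo, max (|f x0| + 1) (max (‖f' x0‖ + 1) (‖f'' x0‖ + 1)), ?_⟩
  have hopen : IsOpen (w ∩ V) := hw.inter hV
  have hsub : ∀ x ∈ w ∩ V, x ∈ u ∧ x ∈ u2 ∧ |f x| < |f x0| + 1 ∧ ‖f' x‖ < ‖f' x0‖ + 1 ∧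
      ‖f'' x‖ < ‖f'' x0‖ + 1 := fun x hx => hwA ⟨hx.1, hVT hx.2⟩
  have hd1 : ∀ x ∈ w ∩ V, fderiv ℝ f x = f' x := by
    intro x hx
    have : u ∈ 𝓝 x := mem_of_superset (hopen.mem_nhds hx) fun y hy => (hsub y hy).1
    exact ((hf' x (hsub x hx).1).hasFDerivAt this).fderiv
  have hd2 : ∀ x ∈ w ∩ V, dd f x = f'' x := by
    intro x hx
    have h : fderiv ℝ f =ᶠ[𝓝 x] f' := by
      filter_upwards [hopen.mem_nhds hx] with y hy using hd1 y hy
    have : u2 ∈ 𝓝 x := mem_of_superset (hopen.mem_nhds hx) fun y hy => (hsub y hy).2.1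
    unfold dd
    rw [h.fderiv_eq]
    exact ((hf'' x (hsub x hx).2.1).hasFDerivAt this).fderiv
  intro x hx
  obtain ⟨-, -, a, b, c⟩ := hsub x hx
  rw [hd1 x hx, hd2 x hx]
  exact ⟨a.le.trans (le_max_left _ _), b.le.trans ((le_max_left _ _).trans (le_max_right _ _)),
    c.le.trans ((le_max_right _ _).trans (le_max_right _ _))⟩

lemma bdd_compact {n : ℕ} {f : EE n → ℝ} {T V K : Set (EE n)} (hf : ContDiffOn ℝ 2 f T) (hV : IsOpen V)
    (hVT : V ⊆ T) (hK : IsCompact K) (hKT : K ⊆ T) :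
    ∃ M : ℝ, 0 ≤ M ∧ ∀ x ∈ K ∩ V, |f x| ≤ M ∧ ‖fderiv ℝ f x‖ ≤ M ∧ ‖dd f x‖ ≤ M := by
  suffices h : ∃ M : ℝ, ∀ x ∈ K ∩ V, |f x| ≤ M ∧ ‖fderiv ℝ f x‖ ≤ M ∧ ‖dd f x‖ ≤ M by
    obtain ⟨M, hM⟩ := h
    refine ⟨max M 0, le_max_right _ _, fun x hx => ?_⟩
    obtain ⟨a, b, c⟩ := hM x hx
    exact ⟨a.trans (le_max_left _ _), b.trans (le_max_left _ _), c.trans (le_max_left _ _)⟩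
  refine hK.induction_on (p := fun s => ∃ M : ℝ, ∀ x ∈ s ∩ V, |f x| ≤ M ∧ ‖fderiv ℝ f x‖ ≤ M ∧
    ‖dd f x‖ ≤ M) ⟨0, by simp⟩ ?_ ?_ ?_
  · rintro s t hst ⟨M, hM⟩
    exact ⟨M, fun x hx => hM x ⟨hst hx.1, hx.2⟩⟩
  · rintro s t ⟨M, hM⟩ ⟨M', hM'⟩
    refine ⟨max M M', fun x hx => ?_⟩
    rcases hx.1 with h | h
    · obtain ⟨a, b, c⟩ := hM x ⟨h, hx.2⟩
      exact ⟨a.trans (le_max_left _ _), b.trans (le_max_left _ _), c.trans (le_max_left _ _)⟩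
    · obtain ⟨a, b, c⟩ := hM' x ⟨h, hx.2⟩
      exact ⟨a.trans (le_max_right _ _), b.trans (le_max_right _ _), c.trans (le_max_right _ _)⟩
  · intro x hx
    obtain ⟨w, hw, M, hM⟩ := bdd_near hf hV hVT (hKT hx)
    exact ⟨w, mem_nhdsWithin_of_mem_nhds hw, M, hM⟩

lemma lap_abs_le {n : ℕ} (f : EE n → ℝ) (x : EE n) : |lap f x| ≤ n * ‖dd f x‖ := by
  rw [lap_eq]
  refine (Finset.abs_sum_le_sum_abs _ _).trans ?_
  refine (Finset.sum_le_card_nsmul _ _ (‖dd f x‖) fun i _ => ?_).trans (by simp)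
  have := (dd f x).le_opNorm₂ (bv i) (bv i)
  simpa [bv] using this

lemma gip_abs_le {n : ℕ} (f g : EE n → ℝ) (x : EE n) :
    |gip f g x| ≤ n * (‖fderiv ℝ f x‖ * ‖fderiv ℝ g x‖) := by
  unfold gip
  refine (Finset.abs_sum_le_sum_abs _ _).trans ?_
  refine (Finset.sum_le_card_nsmul _ _ (‖fderiv ℝ f x‖ * ‖fderiv ℝ g x‖) fun i _ => ?_).trans (by simp)
  rw [abs_mul]
  have h1 := (fderiv ℝ f x).le_opNorm (bv i)
  have h2 := (fderiv ℝ g x).le_opNorm (bv i)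
  simp only [bv, PiLp.norm_single, norm_one, mul_one, Real.norm_eq_abs] at h1 h2
  exact mul_le_mul h1 h2 (abs_nonneg _) (norm_nonneg _)

/-- The class of functions of Navier type on the sphere, extended by zero. -/
structure NN {n : ℕ} (S : Set (EE n)) (Ψ : EE n → ℝ) : Prop where
  hom : Hom0 Ψ
  cont : ∀ x ≠ 0, ContinuousAt Ψ x
  cd : ∀ x ∈ coneOf S, ContDiffAt ℝ 2 Ψ x
  zero : ∀ x, x ∉ coneOf S → Ψ x = 0
  bdd : ∃ M : ℝ, 0 ≤ M ∧ ∀ x ∈ coneOf S, ‖x‖ = 1 → |Ψ x| ≤ M ∧ ‖fderiv ℝ Ψ x‖ ≤ M ∧ ‖dd Ψ x‖ ≤ M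

lemma contAt_indicator {n : ℕ} {C T : Set (EE n)} {f : EE n → ℝ} {x : EE n} (hCT : C ⊆ T) (hx : x ∉ C)
    (h : x ∉ closure C ∨ (ContinuousWithinAt f T x ∧ f x = 0)) : ContinuousAt (C.indicator f) x := by
  rcases h with h | ⟨h, h0⟩
  · have : C.indicator f =ᶠ[𝓝 x] fun _ => 0 := by
      filter_upwards [isClosed_closure.isOpen_compl.mem_nhds h] with y hy
      exact indicator_of_notMem (fun hc => hy (subset_closure hc)) _
    exact this.continuousAt
  · have hv : C.indicator f x = 0 := indicator_of_notMem hx _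
    rw [Metric.continuousAt_iff]
    intro ε hε
    obtain ⟨δ, hδ, hd⟩ := Metric.continuousWithinAt_iff.1 h ε hε
    refine ⟨δ, hδ, fun y hy => ?_⟩
    rw [hv]
    by_cases hyc : y ∈ C
    · rw [indicator_of_mem hyc, ← h0]; exact hd (hCT hyc) hy
    · rw [indicator_of_notMem hyc]; simpa using hε

lemma cone_closure {n : ℕ} {S : Set (EE n)} {x : EE n} (hx : x ≠ 0) (h : x ∈ closure (coneOf S)) :
    x ∈ coneOf (closure S) := by
  refine ⟨hx, ?_⟩
  have hc : ContinuousWithinAt (fun y : EE n => ‖y‖⁻¹ • y) (coneOf S) x :=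
    (nrm_contDiffAt hx 1).continuousAt.continuousWithinAt
  exact hc.mem_closure h fun y hy => hy.2

lemma cone_mono {n : ℕ} {S T : Set (EE n)} (h : S ⊆ T) : coneOf S ⊆ coneOf T :=
  fun _ hx => ⟨hx.1, h hx.2⟩

lemma closure_sph {n : ℕ} {S : Set (EE n)} (hS : IsSphDomain S) : closure S ⊆ sphere 0 1 :=
  closure_minimal hS.1 isClosed_sphere

lemma NN_of_nav {n : ℕ} {S : Set (EE n)} (hS : IsSphDomain S) {φ : EE n → ℝ} (h : NavAdmS S φ) :
    NN S ((coneOf S).indicator (hext φ)) := by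
  have hCo := cone_open hS
  have hCT : coneOf S ⊆ coneOf (closure S) := cone_mono subset_closure
  have hev : ∀ x ∈ coneOf S, (coneOf S).indicator (hext φ) =ᶠ[𝓝 x] hext φ := fun x hx => by
    filter_upwards [hCo.mem_nhds hx] with y hy using indicator_of_mem hy _
  have hcd : ∀ x ∈ coneOf S, ContDiffAt ℝ 2 ((coneOf S).indicator (hext φ)) x := fun x hx =>
    ((h.1 x (hCT hx)).contDiffAt (mem_of_superset (hCo.mem_nhds hx) hCT)).congr_of_eventuallyEq
      (hev x hx)
  refine ⟨?_, ?_, hcd, fun x hx => indicator_of_notMem hx _, ?_⟩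
  · intro t ht x
    by_cases hx : x ∈ coneOf S
    · rw [indicator_of_mem hx, indicator_of_mem ((cone_smul ht).2 hx)]; exact hext_hom0 φ t ht x
    · rw [indicator_of_notMem hx, indicator_of_notMem (fun h => hx ((cone_smul ht).1 h))]
  · intro x hx0
    by_cases hx : x ∈ coneOf S
    · exact (hcd x hx).continuousAt
    · refine contAt_indicator hCT hx ?_
      by_cases hxc : x ∈ closure (coneOf S)
      · right
        have hxT := cone_closure hx0 hxc
        refine ⟨(h.1 x hxT).continuousWithinAt, h.2 _ ⟨hxT.2, fun hm => hx ⟨hx0, hm⟩⟩⟩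
      · left; exact hxc
  · obtain ⟨M, hM0, hM⟩ := bdd_compact h.1 hCo hCT
      (Metric.isCompact_of_isClosed_isBounded (isClosed_closure (s := S))
        ((Metric.isBounded_sphere (x := (0 : EE n)) (r := 1)).subset (closure_sph hS)))
      (fun x hx => by
        have : ‖x‖ = 1 := by simpa using closure_sph hS hx
        exact (mem_cone_sph this).2 hx)
    refine ⟨M, hM0, fun x hx hx1 => ?_⟩
    rw [(hev x hx).fderiv_eq, dd_congr (hev x hx), (hev x hx).self_of_nhds]
    exact hM x ⟨subset_closure ((mem_cone_sph hx1).1 hx), hx⟩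
end

open MeasureTheory Metric Set Filter Topology
open scoped RealInnerProductSpace
noncomputable section

def AS {n : ℕ} (S : Set (EE n)) : Set (Sph n) := {p | (p : EE n) ∈ coneOf S}

lemma AS_open {n : ℕ} {S : Set (EE n)} (hS : IsSphDomain S) : IsOpen (AS S) :=
  (cone_open hS).preimage continuous_subtype_val

lemma AS_meas {n : ℕ} {S : Set (EE n)} (hS : IsSphDomain S) : MeasurableSet (AS S) :=
  (AS_open hS).measurableSet

lemma aesm_cone {n : ℕ} {S : Set (EE n)} (hS : IsSphDomain S) {F : EE n → ℝ}
    (hF : ∀ x ∈ coneOf S, ContinuousAt F x) :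
    AEStronglyMeasurable (fun p : Sph n => F p) ((sg n).restrict (AS S)) := by
  have : ContinuousOn (fun p : Sph n => F p) (AS S) := fun p hp =>
    ((hF p hp).comp continuous_subtype_val.continuousAt).continuousWithinAt
  exact this.aestronglyMeasurable (AS_meas hS)

lemma int_cone {n : ℕ} {S : Set (EE n)} (hS : IsSphDomain S) {F : EE n → ℝ}
    (hF : ∀ x ∈ coneOf S, ContinuousAt F x) (M : ℝ) (hM : ∀ x ∈ coneOf S, ‖x‖ = 1 → |F x| ≤ M) :
    IntegrableOn (fun p : Sph n => F p) (AS S) (sg n) := by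
  refine Integrable.mono' (g := fun _ => M) (integrable_const M) (aesm_cone hS hF) ?_
  · rw [ae_restrict_iff' (AS_meas hS)]
    exact ae_of_all _ fun p hp => hM p hp (by simp)

lemma NN.cut {n : ℕ} {S : Set (EE n)} {Ψ : EE n → ℝ} (h : NN S Ψ) {η : ℝ} (hη : 0 < η) :
    TT S (fun x => ocut η (Ψ x)) := by
  have hz : ∀ x ≠ 0, x ∉ coneOf S → (fun x => ocut η (Ψ x)) =ᶠ[𝓝 x] 0 := fun x hx hx' => by
    have h0 := h.zero x hx'
    have := (h.cont x hx).abs.eventually_lt_const (u := η) (by simpa [h0] using hη)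
    filter_upwards [this] with y hy
    exact ocut_zero hη hy.le
  refine ⟨fun t ht x => by simp only [h.hom t ht x], fun x hx => ?_, hz⟩
  by_cases hx' : x ∈ coneOf S
  · exact (ocut_contDiff η).contDiffAt.comp x (h.cd x hx')
  · exact contDiffAt_const.congr_of_eventuallyEq (hz x hx hx')

lemma NN.da {n : ℕ} {S : Set (EE n)} {Ψ : EE n → ℝ} (h : NN S Ψ) {x : EE n} (hx : x ∈ coneOf S) :
    DifferentiableAt ℝ Ψ x := (h.cd x hx).differentiableAt (by norm_num)

lemma NN.cd1 {n : ℕ} {S : Set (EE n)} {Ψ : EE n → ℝ} (h : NN S Ψ) {x : EE n} (hx : x ∈ coneOf S) :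
    ContDiffAt ℝ 1 Ψ x := (h.cd x hx).of_le (by norm_num)

lemma sI_restrict {n : ℕ} {S : Set (EE n)} {F : EE n → ℝ}
    (h : ∀ x ≠ 0, x ∉ coneOf S → F x = 0) : sI F = ∫ p in AS S, F p ∂(sg n) := by
  unfold sI
  refine (setIntegral_eq_integral_of_forall_compl_eq_zero (s := AS S) (f := fun p : Sph n => F p) ?_).symm
  intro p hp
  exact h (p : EE n) (sph_ne p) hp

lemma NN.grad_ae {n : ℕ} (hn : 1 ≤ n) {S : Set (EE n)} (hS : IsSphDomain S) {Ψ : EE n → ℝ} (h : NN S Ψ) :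
    ∀ᵐ p : Sph n ∂(sg n), (p : EE n) ∈ coneOf S → Ψ p = 0 → fderiv ℝ Ψ p = 0 := by
  refine ae_sphere_of_ae hn (fun x => x ∈ coneOf S → Ψ x = 0 → fderiv ℝ Ψ x = 0)
    (ae_grad_zero hn (cone_open hS) fun x hx => h.da hx) ?_
  intro t ht x hx hxc hx0
  have := hx ((cone_smul ht).2 hxc) (by rw [h.hom t ht, hx0])
  rw [h.hom.fderiv ht] at this
  simpa [ht.ne'] using this

def et (k : ℕ) : ℝ := 1 / ((k : ℝ) + 1)
lemma et_pos (k : ℕ) : 0 < et k := by unfold et; positivity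
lemma et_tendsto : Tendsto et atTop (𝓝 0) := tendsto_one_div_add_atTop_nhds_zero_nat

lemma ocut_tendsto (s : ℝ) : Tendsto (fun k => ocut (et k) s) atTop (𝓝 s) := by
  rw [tendsto_iff_dist_tendsto_zero]
  refine squeeze_zero (fun k => dist_nonneg) (fun k => ?_) (g := fun k => 2 * et k)
    (by simpa using et_tendsto.const_mul 2)
  rw [Real.dist_eq]; exact ocut_close (et_pos k) s

lemma ocut_deriv_tendsto {s : ℝ} (hs : s ≠ 0) :
    Tendsto (fun k => deriv (ocut (et k)) s) atTop (𝓝 1) := by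
  have : ∀ᶠ k in atTop, 2 * et k < |s| :=
    (et_tendsto.const_mul 2).eventually_lt_const (by simpa using hs)
  refine tendsto_const_nhds.congr' ?_
  filter_upwards [this] with k hk
  exact (ocut_deriv_one (et_pos k) hk.le).symm

lemma NN.green {n : ℕ} (hn : 1 ≤ n) {S : Set (EE n)} (hS : IsSphDomain S) {Φ Ψ : EE n → ℝ}
    (h : NN S Φ) (h' : NN S Ψ) :
    ∫ p in AS S, Φ p * lap Ψ p ∂(sg n) = - ∫ p in AS S, gip Φ Ψ p ∂(sg n) := by
  obtain ⟨M, hM0, hM⟩ := h.bdd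
  obtain ⟨M', hM0', hM'⟩ := h'.bdd
  have hk : ∀ k, ∫ p in AS S, ocut (et k) (Φ p) * lap Ψ p ∂(sg n)
      = - ∫ p in AS S, deriv (ocut (et k)) (Φ p) * gip Φ Ψ p ∂(sg n) := by
    intro k
    have hc := h.cut (et_pos k)
    have := _root_.green hn hc.hom h'.hom hc.cd1 (fun x hx => by
      by_cases hxc : x ∈ coneOf S
      · exact Or.inr (h'.cd x hxc)
      · exact Or.inl (hc.sup x hx hxc))
    have e1 := sI_restrict (S := S) (F := fun x => ocut (et k) (Φ x) * lap Ψ x) (fun x hx hx' => by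
      have := (hc.sup x hx hx').self_of_nhds
      simp only [Pi.zero_apply] at this
      simp [this])
    have e2 := sI_restrict (S := S) (F := gip (fun x => ocut (et k) (Φ x)) Ψ) (fun x hx hx' => by
      have := (hc.sup x hx hx').fderiv_eq (𝕜 := ℝ)
      unfold gip; rw [this]; simp)
    unfold sI at e1 e2
    rw [← e1, this, e2]
    congr 1
    refine setIntegral_congr_fun (AS_meas hS) fun p hp => ?_
    exact gip_comp ((ocut_contDiff _).differentiable (by norm_num) _) (h.da hp) _
  have hcl : ∀ x ∈ coneOf S, ContinuousAt (lap Ψ) x := fun x hx => lap_cont (h'.cd x hx)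
  have hcg : ∀ x ∈ coneOf S, ContinuousAt (gip Φ Ψ) x := fun x hx => gip_cont (h.cd1 hx) (h'.cd1 hx)
  have t1 : Tendsto (fun k => ∫ p in AS S, ocut (et k) (Φ p) * lap Ψ p ∂(sg n)) atTop
      (𝓝 (∫ p in AS S, Φ p * lap Ψ p ∂(sg n))) := by
    refine tendsto_integral_of_dominated_convergence (fun _ => M * (n * M')) ?_ (integrable_const _) ?_ ?_
    · intro k
      exact aesm_cone hS (F := fun x => ocut (et k) (Φ x) * lap Ψ x) fun x hx =>
        ((ocut_contDiff _).continuous.continuousAt.comp (h.da hx).continuousAt).mul (hcl x hx)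
    · intro k
      rw [ae_restrict_iff' (AS_meas hS)]
      refine ae_of_all _ fun p hp => ?_
      have h1 := hM p hp (by simp)
      have h2 := hM' p hp (by simp)
      rw [norm_mul]
      refine mul_le_mul ((ocut_abs_le (et_pos k) _).trans h1.1) ?_ (norm_nonneg _) hM0
      exact (lap_abs_le _ _).trans (by gcongr; exact h2.2.2)
    · exact ae_of_all _ fun p => (ocut_tendsto _).mul_const _
  have t2 : Tendsto (fun k => ∫ p in AS S, deriv (ocut (et k)) (Φ p) * gip Φ Ψ p ∂(sg n)) atTop
      (𝓝 (∫ p in AS S, gip Φ Ψ p ∂(sg n))) := by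
    refine tendsto_integral_of_dominated_convergence (fun _ => 1 * (n * (M * M'))) ?_
      (integrable_const _) ?_ ?_
    · intro k
      exact aesm_cone hS (F := fun x => deriv (ocut (et k)) (Φ x) * gip Φ Ψ x) fun x hx =>
        (((ocut_contDiff _).continuous_deriv (by norm_num)).continuousAt.comp
          (h.da hx).continuousAt).mul (hcg x hx)
    · intro k
      rw [ae_restrict_iff' (AS_meas hS)]
      refine ae_of_all _ fun p hp => ?_
      have h1 := hM p hp (by simp)
      have h2 := hM' p hp (by simp)
      have h3 := ocut_deriv_mem (et_pos k) (Φ p)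
      rw [norm_mul]
      refine mul_le_mul ?_ ?_ (norm_nonneg _) zero_le_one
      · rw [Real.norm_eq_abs, abs_of_nonneg h3.1]; exact h3.2
      · refine (gip_abs_le _ _ _).trans ?_
        have := mul_le_mul h1.2.1 h2.2.1 (norm_nonneg _) hM0
        gcongr
    · rw [ae_restrict_iff' (AS_meas hS)]
      filter_upwards [h.grad_ae hn hS] with p hp hpc
      by_cases h0 : Φ p = 0
      · have : gip Φ Ψ p = 0 := by unfold gip; rw [hp hpc h0]; simp
        simp [this]
      · simpa using (ocut_deriv_tendsto h0).mul_const (gip Φ Ψ p)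
  have t3 := t2.neg
  simp only [← hk] at t3
  exact tendsto_nhds_unique t1 t3

lemma NN.symm {n : ℕ} (hn : 1 ≤ n) {S : Set (EE n)} (hS : IsSphDomain S) {Φ Ψ : EE n → ℝ}
    (h : NN S Φ) (h' : NN S Ψ) :
    ∫ p in AS S, Φ p * lap Ψ p ∂(sg n) = ∫ p in AS S, Ψ p * lap Φ p ∂(sg n) := by
  rw [h.green hn hS h', h'.green hn hS h]
  simp only [gip_comm]

lemma NN.poincare {n : ℕ} (hn : 1 ≤ n) {S : Set (EE n)} (hS : IsSphDomain S) {Φ : EE n → ℝ}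
    (h : NN S Φ) :
    lam1 S * ∫ p in AS S, Φ p ^ 2 ∂(sg n) ≤ - ∫ p in AS S, Φ p * lap Φ p ∂(sg n) := by
  rw [h.green hn hS h, neg_neg]
  obtain ⟨M, hM0, hM⟩ := h.bdd
  have hcg : ∀ x ∈ coneOf S, ContinuousAt (gip Φ Φ) x := fun x hx => gip_cont (h.cd1 hx) (h.cd1 hx)
  have hk : ∀ k, lam1 S * ∫ p in AS S, ocut (et k) (Φ p) ^ 2 ∂(sg n)
      ≤ ∫ p in AS S, gip Φ Φ p ∂(sg n) := by
    intro k
    have hc := h.cut (et_pos k)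
    have := lam1_le hc
    have e1 := sI_restrict (S := S) (F := fun x => ocut (et k) (Φ x) ^ 2) (fun x hx hx' => by
      have := (hc.sup x hx hx').self_of_nhds
      simp only [Pi.zero_apply] at this
      simp [this])
    have e2 := sI_restrict (S := S) (F := gip (fun x => ocut (et k) (Φ x)) (fun x => ocut (et k) (Φ x)))
      (fun x hx hx' => by
      have := (hc.sup x hx hx').fderiv_eq (𝕜 := ℝ)
      unfold gip; rw [this]; simp)
    unfold DD at this
    rw [e1, e2] at this
    refine this.trans ?_
    have hg : IntegrableOn (fun p : Sph n => gip Φ Φ p) (AS S) (sg n) :=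
      int_cone hS hcg (n * (M * M)) fun x hx hx1 => by
        have h1 := hM x hx hx1
        refine (gip_abs_le _ _ _).trans ?_
        have := mul_le_mul h1.2.1 h1.2.1 (norm_nonneg _) hM0
        gcongr
    have hcc : ∀ x ∈ coneOf S, ContinuousAt (gip (fun x => ocut (et k) (Φ x))
      (fun x => ocut (et k) (Φ x))) x := fun x hx => hc.contgip hc x hx.1
    refine setIntegral_mono_on ((intSph fun x hx => hc.contgip hc x hx).integrableOn) hg
      (AS_meas hS) fun p hp => ?_
    rw [gip_comp2 ((ocut_contDiff _).differentiable (by norm_num) _) (h.da hp)]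
    have h3 := ocut_deriv_mem (et_pos k) (Φ p)
    have h4 : deriv (ocut (et k)) (Φ p) ^ 2 ≤ 1 := by nlinarith [h3.1, h3.2]
    nlinarith [gip_self_nonneg Φ p]
  have t1 : Tendsto (fun k => ∫ p in AS S, ocut (et k) (Φ p) ^ 2 ∂(sg n)) atTop
      (𝓝 (∫ p in AS S, Φ p ^ 2 ∂(sg n))) := by
    refine tendsto_integral_of_dominated_convergence (fun _ => M ^ 2) ?_ (integrable_const _) ?_ ?_
    · intro k
      exact aesm_cone hS (F := fun x => ocut (et k) (Φ x) ^ 2) fun x hx =>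
        ((ocut_contDiff _).continuous.continuousAt.comp (h.da hx).continuousAt).pow 2
    · intro k
      rw [ae_restrict_iff' (AS_meas hS)]
      refine ae_of_all _ fun p hp => ?_
      have h1 := hM p hp (by simp)
      rw [norm_pow]
      exact pow_le_pow_left₀ (norm_nonneg _) ((ocut_abs_le (et_pos k) _).trans h1.1) 2
    · exact ae_of_all _ fun p => (ocut_tendsto _).pow 2
  exact le_of_tendsto (t1.const_mul _) (Eventually.of_forall hk)
end

open MeasureTheory Metric Set Filter Topology
open scoped RealInnerProductSpace
noncomputable section

def bt (n : ℕ) (α : ℝ) : ℝ := (4 - n - α) / 2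

def W0 {n : ℕ} (α ε : ℝ) (f : EE n → ℝ) (σ : EE n) (t : ℝ) : ℝ :=
  Real.exp (-(bt n α * (ε * t))) * f (Real.exp (ε * t) • σ)

def W1 {n : ℕ} (α ε : ℝ) (f : EE n → ℝ) (σ : EE n) (t : ℝ) : ℝ :=
  Real.exp (-(bt n α * (ε * t))) * (ε * Real.exp (ε * t) * fderiv ℝ f (Real.exp (ε * t) • σ) σ
    - bt n α * ε * f (Real.exp (ε * t) • σ))

def W2 {n : ℕ} (α ε : ℝ) (f : EE n → ℝ) (σ : EE n) (t : ℝ) : ℝ :=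
  Real.exp (-(bt n α * (ε * t))) * (Real.exp (ε * t) ^ 2 * dd f (Real.exp (ε * t) • σ) σ σ
    + (1 - 2 * bt n α) * Real.exp (ε * t) * fderiv ℝ f (Real.exp (ε * t) • σ) σ
    + bt n α ^ 2 * f (Real.exp (ε * t) • σ))

lemma exp_der (a t : ℝ) : HasDerivAt (fun t => Real.exp (a * t)) (a * Real.exp (a * t)) t := by
  have := ((hasDerivAt_id t).const_mul a).exp
  exact this.congr_deriv (by simp; ring)

lemma W_deriv {n : ℕ} {α ε : ℝ} (hε : ε ^ 2 = 1) {f : EE n → ℝ} {σ : EE n} {t : ℝ}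
    (hf : ContDiffAt ℝ 2 f (Real.exp (ε * t) • σ)) :
    (∀ᶠ s in 𝓝 t, HasDerivAt (W0 α ε f σ) (W1 α ε f σ s) s) ∧
    HasDerivAt (W1 α ε f σ) (W2 α ε f σ t) t := by
  have hc : ∀ s, HasDerivAt (fun s => Real.exp (ε * s) • σ) ((ε * Real.exp (ε * s)) • σ) s := fun s =>
    (exp_der ε s).smul_const σ
  have hc1 : HasDerivAt (fun s => (ε * Real.exp (ε * s)) • σ) ((ε * (ε * Real.exp (ε * t))) • σ) t :=
    ((exp_der ε t).const_mul ε).smul_const σ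
  obtain ⟨h1, h2⟩ := curve_deriv hf (Eventually.of_forall hc) hc1
  have he : ∀ s, HasDerivAt (fun s => Real.exp (-(bt n α * (ε * s))))
      (-(bt n α * ε) * Real.exp (-(bt n α * (ε * s)))) s := fun s => by
    have := exp_der (-(bt n α * ε)) s
    have e : ∀ s, -(bt n α * ε) * s = -(bt n α * (ε * s)) := fun s => by ring
    simpa only [e] using this
  constructor
  · filter_upwards [h1] with s hs
    refine ((he s).mul hs).congr_deriv ?_
    simp only [W1, map_smul, smul_eq_mul]
    ring
  · have h3 := (he t).mul (h2.sub (h1.self_of_nhds.const_mul (bt n α * ε)))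
    have e : W1 α ε f σ = fun s => Real.exp (-(bt n α * (ε * s))) *
        (fderiv ℝ f (Real.exp (ε * s) • σ) ((ε * Real.exp (ε * s)) • σ) -
          bt n α * ε * f (Real.exp (ε * s) • σ)) := by
      funext s; simp only [W1, map_smul, smul_eq_mul]
    rw [e]
    refine h3.congr_deriv ?_
    simp only [W2, map_smul, smul_eq_mul, smul_apply, Pi.sub_apply]
    have hε' : ε * ε = 1 := by nlinarith
    linear_combination (Real.exp (-(bt n α * (ε * t)))*(Real.exp (ε * t) ^ 2 * dd f (Real.exp (ε * t) • σ) σ σ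
    + (1 - 2 * bt n α) * Real.exp (ε * t) * fderiv ℝ f (Real.exp (ε * t) • σ) σ
    + bt n α ^ 2 * f (Real.exp (ε * t) • σ)))* hε

lemma W_lap {n : ℕ} {α ε : ℝ} (hε : ε ^ 2 = 1) {f : EE n → ℝ} {σ : EE n} (hσ : ‖σ‖ = 1) {t : ℝ}
    (hf : ContDiffAt ℝ 2 f (Real.exp (ε * t) • σ)) :
    Real.exp ((2 - bt n α) * (ε * t)) * lap f (Real.exp (ε * t) • σ) =
      W2 α ε f σ t + ε * (2 - α) * W1 α ε f σ t - gam n α * W0 α ε f σ t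
      + Real.exp (-(bt n α * (ε * t))) * lap (fun y => f (Real.exp (ε * t) • ‖y‖⁻¹ • y)) σ := by
  rw [polar_lap (Real.exp_pos _) hσ hf]
  have e : Real.exp ((2 - bt n α) * (ε * t)) = Real.exp (-(bt n α * (ε * t))) * Real.exp (ε * t) ^ 2 := by
    rw [← Real.exp_nat_mul, ← Real.exp_add]; congr 1; push_cast; ring
  rw [e]
  have := Real.exp_pos (ε * t)
  unfold W2 W1 W0 gam bt
  field_simp
  ring_nf
  rw [hε]
  ring
end

open MeasureTheory Metric Set Filter Topology
open scoped RealInnerProductSpace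
noncomputable section

def etb : ContDiffBump (0:ℝ) := ⟨1, 2, one_pos, one_lt_two⟩

def Fk (β : ℝ) (k : ℕ) (t : ℝ) : ℝ := Real.exp (β * t) * etb (t / (k+1))

lemma Fk_contDiff (β : ℝ) (k : ℕ) : ContDiff ℝ 2 (Fk β k) := by
  unfold Fk
  have : ContDiff ℝ 2 (etb : ℝ → ℝ) := etb.contDiff
  exact (Real.contDiff_exp.comp (contDiff_const.mul contDiff_id)).mul (this.comp (contDiff_id.div_const _))

lemma Fk_zero (β : ℝ) (k : ℕ) (t : ℝ) (ht : 2 * (k + 1) ≤ |t|) : Fk β k t = 0 := by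
  unfold Fk
  rw [etb.zero_of_le_dist, mul_zero]
  rw [Real.dist_eq, sub_zero, abs_div, abs_of_pos (show (0:ℝ) < k + 1 by positivity)]
  rw [le_div_iff₀ (by positivity)]; exact ht

def uk {n : ℕ} (β : ℝ) (k : ℕ) (φ : EE n → ℝ) (x : EE n) : ℝ :=
  if x = 0 then 0 else Fk β k (Real.log ‖x‖) * hext φ x

lemma uk_eq {n : ℕ} {β : ℝ} {k : ℕ} {φ : EE n → ℝ} {x : EE n} (hx : x ≠ 0) :
  uk β k φ x = Fk β k (Real.log ‖x‖) * hext φ x := by simp [uk, hx]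

lemma uk_small {n : ℕ} {β : ℝ} {k : ℕ} {φ : EE n → ℝ} {x : EE n} (hx : ‖x‖ < Real.exp (-(2 * (k+1)))) :
    uk β k φ x = 0 := by
  by_cases h : x = 0
  · simp [uk, h]
  rw [uk_eq h, Fk_zero, zero_mul]
  have := Real.log_lt_log (norm_pos_iff.2 h) hx
  rw [Real.log_exp] at this
  rw [abs_of_neg (by linarith [show (0:ℝ) ≤ k by positivity])]; linarith

lemma uk_adm {n : ℕ} {S : Set (EE n)} (hS : IsSphDomain S) {φ : EE n → ℝ} (h : NavAdmS S φ) (β : ℝ) (k : ℕ) :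
    NavierAdm (coneOf S) (uk β k φ) := by
  refine ⟨?_, ?_, ⟨Real.exp (-(2 * (k+1))), Real.exp_pos _, fun x hx => uk_small hx⟩,
    ⟨Real.exp (2 * (k+1)), fun x hx => ?_⟩⟩
  · intro x hx
    by_cases h0 : x = 0
    · have : uk β k φ =ᶠ[𝓝 x] fun _ => 0 := by
        have : ball (0:EE n) (Real.exp (-(2 * (k+1)))) ∈ 𝓝 x := by
          rw [h0]; exact ball_mem_nhds _ (Real.exp_pos _)
        filter_upwards [this] with y hy
        exact uk_small (by simpa using hy)
      exact (contDiffAt_const.congr_of_eventuallyEq this).contDiffWithinAt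
    · have hx' := cone_closure h0 hx
      have hne : {y : EE n | y ≠ 0} ∈ 𝓝 x := isOpen_ne.mem_nhds h0
      have h1 : ContDiffWithinAt ℝ 2 (fun x => Fk β k (Real.log ‖x‖) * hext φ x) (closure (coneOf S)) x := by
        refine ContDiffWithinAt.mul ?_ ?_
        · exact ((Fk_contDiff β k).contDiffAt.comp x
            ((contDiffAt_norm ℝ h0).log (norm_ne_zero_iff.2 h0))).contDiffWithinAt
        · refine (h.1 x hx').mono_of_mem_nhdsWithin ?_
          filter_upwards [self_mem_nhdsWithin, mem_nhdsWithin_of_mem_nhds hne] with y hy hy0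
          exact cone_closure hy0 hy
      refine h1.congr_of_eventuallyEq ?_ (uk_eq h0)
      filter_upwards [mem_nhdsWithin_of_mem_nhds hne] with y hy0
      exact uk_eq hy0
  · intro x hx
    by_cases h0 : x = 0
    · simp [uk, h0]
    rw [(cone_open hS).frontier_eq] at hx
    have hx' := cone_closure h0 hx.1
    rw [uk_eq h0]
    have : hext φ x = 0 := h.2 _ ⟨hx'.2, fun hc => hx.2 ⟨h0, hc⟩⟩
    rw [this, mul_zero]
  · have h0 : x ≠ 0 := by
      rintro rfl; simp at hx; linarith [Real.exp_pos (2 * ((k:ℝ)+1))]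
    rw [uk_eq h0, Fk_zero, zero_mul]
    have := Real.log_lt_log (Real.exp_pos _) hx
    rw [Real.log_exp] at this
    exact this.le.trans (le_abs_self _)

lemma uk_W0 {n : ℕ} (α : ℝ) (k : ℕ) (φ : EE n → ℝ) {σ : EE n} (hσ : ‖σ‖ = 1) (t : ℝ) :
    W0 α 1 (uk (bt n α) k φ) σ t = etb (t / (k+1)) * φ σ := by
  have h0 : σ ≠ 0 := by rintro rfl; simp at hσ
  have hp := Real.exp_pos t
  unfold W0
  rw [one_mul, uk_eq (smul_ne_zero hp.ne' h0), (hext_hom0 φ) _ hp]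
  simp only [hext, norm_smul, hσ, Real.norm_eq_abs, abs_of_pos hp, mul_one, Real.log_exp, Fk, inv_one, one_smul]
  rw [← mul_assoc, ← mul_assoc, ← Real.exp_add]; simp

/-- pointwise formula -/
lemma uk_lap {n : ℕ} {S : Set (EE n)} (hS : IsSphDomain S) {φ : EE n → ℝ} (h : NavAdmS S φ) (α : ℝ) (k : ℕ)
    {σ : EE n} (hσ : ‖σ‖ = 1) (hσS : σ ∈ coneOf S) (t : ℝ) :
    Real.exp ((2 - bt n α) * t) * lap (uk (bt n α) k φ) (Real.exp t • σ) =
      (deriv (deriv etb) (t/(k+1)) / (k+1)^2 + (2 - α) * (deriv etb (t/(k+1)) / (k+1))) * φ σ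
      - etb (t/(k+1)) * (gam n α * φ σ - lap (hext φ) σ) := by
  have h0 : σ ≠ 0 := by rintro rfl; simp at hσ
  have hp := Real.exp_pos t
  have hcd : ContDiffAt ℝ 2 (uk (bt n α) k φ) (Real.exp (1 * t) • σ) := by
    have hm : Real.exp (1 * t) • σ ∈ coneOf S := (cone_smul (Real.exp_pos _)).2 hσS
    exact ((uk_adm hS h _ k).1 _ (subset_closure hm)).contDiffAt
      (mem_of_superset ((cone_open hS).mem_nhds hm) subset_closure)
  have hl := W_lap (α := α) (ε := 1) (by norm_num) hσ hcd
  obtain ⟨d1, d2⟩ := W_deriv (α := α) (ε := 1) (by norm_num) hcd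
  have he : ∀ s, HasDerivAt (fun s : ℝ => s / (k+1)) (1 / (k+1:ℝ)) s := fun s =>
    (hasDerivAt_id s).div_const _
  have hbc : ContDiff ℝ 2 (etb : ℝ → ℝ) := etb.contDiff
  have hb1 : ∀ s, HasDerivAt (etb : ℝ → ℝ) (deriv etb s) s := fun s =>
    (hbc.differentiable (by norm_num) s).hasDerivAt
  have hb2 : ∀ s, HasDerivAt (deriv (etb : ℝ → ℝ)) (deriv (deriv etb) s) s := fun s =>
    (((hbc.iterate_deriv' 1 1).differentiable (by norm_num)) s).hasDerivAt
  have e1 : ∀ s, HasDerivAt (W0 α 1 (uk (bt n α) k φ) σ) (deriv etb (s/(k+1)) * (1 / (k+1)) * φ σ) s := by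
    intro s
    have := ((hb1 (s/(k+1))).comp s (he s)).mul_const (φ σ)
    refine this.congr_of_eventuallyEq (Eventually.of_forall fun s => ?_)
    exact uk_W0 α k φ hσ s
  have e1' : W1 α 1 (uk (bt n α) k φ) σ =ᶠ[𝓝 t] fun s => deriv etb (s/(k+1)) * (1 / (k+1)) * φ σ := by
    filter_upwards [d1] with s hs
    exact hs.unique (e1 s)
  have e2 : HasDerivAt (W1 α 1 (uk (bt n α) k φ) σ) (deriv (deriv etb) (t/(k+1)) * (1/(k+1)) * (1 / (k+1)) * φ σ) t := by
    have := (((hb2 (t/(k+1))).comp t (he t)).mul_const (1 / (k+1:ℝ))).mul_const (φ σ)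
    exact this.congr_of_eventuallyEq e1'
  have e3 := d2.unique e2
  have e4 : (fun y => uk (bt n α) k φ (Real.exp (1 * t) • ‖y‖⁻¹ • y)) =ᶠ[𝓝 σ]
      (Real.exp (bt n α * t) * etb (t/(k+1))) • hext φ := by
    filter_upwards [isOpen_ne.mem_nhds h0] with y hy
    have h1 : Real.exp (1 * t) • ‖y‖⁻¹ • y ≠ 0 :=
      smul_ne_zero (Real.exp_pos _).ne' (smul_ne_zero (inv_ne_zero (norm_ne_zero_iff.2 hy)) hy)
    rw [uk_eq h1, (hext_hom0 φ) _ (Real.exp_pos _), (hext_hom0 φ) _ (inv_pos.2 (norm_pos_iff.2 hy))]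
    have : ‖y‖⁻¹ * ‖y‖ = 1 := inv_mul_cancel₀ (norm_ne_zero_iff.2 hy)
    simp [norm_smul, abs_of_pos hp, Fk, this]
  have e5 : lap (fun y => uk (bt n α) k φ (Real.exp (1 * t) • ‖y‖⁻¹ • y)) σ =
      (Real.exp (bt n α * t) * etb (t/(k+1))) * lap (hext φ) σ := by
    rw [lap_congr e4]
    have hc2 : ContDiffAt ℝ 2 (hext φ) σ := (h.1 σ (cone_mono subset_closure hσS)).contDiffAt
      (mem_of_superset ((cone_open hS).mem_nhds hσS) (cone_mono subset_closure))
    unfold lap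
    rw [iteratedFDeriv_const_smul_apply hc2, Finset.mul_sum]
    rfl
  rw [e3, e1'.self_of_nhds, uk_W0 α k φ hσ, e5] at hl
  simp only [one_mul] at hl
  have e6 : Real.exp (-(bt n α * t)) * Real.exp (bt n α * t) = 1 := by rw [← Real.exp_add]; simp
  rw [hl, div_eq_mul_one_div _ (((k:ℝ)+1)^2), (one_div_pow ((k:ℝ)+1) 2).symm]
  linear_combination (etb (t / (k+1)) * lap (hext φ) σ) * e6

lemma cone_polar {n : ℕ} (hn : 1 ≤ n) {S : Set (EE n)} (hS : IsSphDomain S) (F : EE n → ℝ) :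
    ∫ x in coneOf S, F x = ∫ q : Sph n × ℝ, (AS S).indicator
      (fun p : Sph n => Real.exp (n * q.2) * F (Real.exp q.2 • (p : EE n))) q.1 ∂((sg n).prod volume) := by
  rw [← integral_indicator (cone_open hS).measurableSet, polar_integral hn (Or.inl rfl)]
  refine integral_congr_ae (ae_of_all _ fun q => ?_)
  have hm : Real.exp q.2 • (q.1 : EE n) ∈ coneOf S ↔ q.1 ∈ AS S := cone_smul (Real.exp_pos _)
  simp only [one_mul]
  by_cases hq : q.1 ∈ AS S
  · rw [indicator_of_mem (hm.2 hq), indicator_of_mem hq]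
  · rw [indicator_of_notMem (fun h => hq (hm.1 h)), indicator_of_notMem hq, mul_zero]

lemma rp_exp (a t : ℝ) : Real.exp t ^ a = Real.exp (a * t) := by
  rw [← Real.exp_mul, mul_comm]

lemma young_sq {K : ℝ} (hK : 0 < K) (p q : ℝ) : (p - q)^2 ≤ (1 + 1/K) * q^2 + (1 + K) * p^2 := by
  have : 0 ≤ (1/K) * (K * p + q)^2 := by positivity
  have e : (1/K) * (K * p + q)^2 = K * p^2 + 2 * p * q + (1/K) * q^2 := by field_simp; ring
  nlinarith

lemma muN_le {n : ℕ} (hn : 1 ≤ n) {S : Set (EE n)} (hS : IsSphDomain S) {φ : EE n → ℝ} (h : NavAdmS S φ)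
    (α : ℝ) : muN (coneOf S) α * ∫ p in AS S, φ p ^ 2 ∂(sg n) ≤
      ∫ p in AS S, (gam n α * φ p - lap (hext φ) p) ^ 2 ∂(sg n) := by
  set I := ∫ p in AS S, φ p ^ 2 ∂(sg n) with hI
  set J := ∫ p in AS S, (gam n α * φ p - lap (hext φ) p) ^ 2 ∂(sg n) with hJ
  have hJ0 : 0 ≤ J := integral_nonneg fun p => sq_nonneg _
  have hI0 : 0 ≤ I := integral_nonneg fun p => sq_nonneg _
  rcases hI0.eq_or_lt with hI0 | hI0
  · rw [← hI0, mul_zero]; exact hJ0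
  obtain ⟨p0, hp0, hp0'⟩ : ∃ p ∈ AS S, φ p ≠ 0 := by
    by_contra! hc
    have : I = 0 := by
      rw [hI, setIntegral_congr_fun (AS_meas hS) (g := fun _ => 0) (fun p hp => by simp [hc p hp])]
      simp
    linarith
  -- integrability on the sphere
  have hNN := NN_of_nav hS h
  have hcd : ∀ x ∈ coneOf S, ContDiffAt ℝ 2 (hext φ) x := fun x hx =>
    (h.1 x (cone_mono subset_closure hx)).contDiffAt
      (mem_of_superset ((cone_open hS).mem_nhds hx) (cone_mono subset_closure))
  have hev : ∀ x ∈ coneOf S, (coneOf S).indicator (hext φ) =ᶠ[𝓝 x] hext φ := fun x hx => by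
    filter_upwards [(cone_open hS).mem_nhds hx] with y hy using indicator_of_mem hy _
  obtain ⟨M, hM0, hM⟩ := hNN.bdd
  have hb : ∀ x ∈ coneOf S, ‖x‖ = 1 → |hext φ x| ≤ M ∧ |lap (hext φ) x| ≤ n * M := by
    intro x hx hx1
    obtain ⟨a, b, c⟩ := hM x hx hx1
    rw [(hev x hx).self_of_nhds] at a
    refine ⟨a, ?_⟩
    rw [← lap_congr (hev x hx)]
    exact (lap_abs_le _ _).trans (by gcongr)
  have hxt : ∀ p : Sph n, hext φ p = φ p := fun p => by simp [hext]
  have i1 : IntegrableOn (fun p : Sph n => φ p ^ 2) (AS S) (sg n) := by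
    have := int_cone hS (F := fun x => hext φ x ^ 2) (fun x hx => (hcd x hx).continuousAt.pow 2) (M^2)
      (fun x hx hx1 => by
        rw [abs_pow]; exact pow_le_pow_left₀ (abs_nonneg _) (hb x hx hx1).1 2)
    simpa only [hxt] using this
  have i2 : IntegrableOn (fun p : Sph n => (gam n α * φ p - lap (hext φ) p) ^ 2) (AS S) (sg n) := by
    have := int_cone hS (F := fun x => (gam n α * hext φ x - lap (hext φ) x) ^ 2)
      (fun x hx => (((hcd x hx).continuousAt.const_mul _).sub (lap_cont (hcd x hx))).pow 2)
      ((|gam n α| * M + n * M)^2)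
      (fun x hx hx1 => by
        rw [abs_pow]; refine pow_le_pow_left₀ (abs_nonneg _) ?_ 2
        refine (abs_sub _ _).trans ?_
        rw [abs_mul]
        have := hb x hx hx1
        gcongr; exact this.1; exact this.2)
    simpa only [hxt] using this
  -- the bump
  have hbc : ContDiff ℝ 2 (etb : ℝ → ℝ) := etb.contDiff
  have hbs : HasCompactSupport (etb : ℝ → ℝ) := etb.hasCompactSupport
  have hd1 : Continuous (deriv (etb : ℝ → ℝ)) := hbc.continuous_deriv (by norm_num)
  have hd2 : Continuous (deriv (deriv (etb : ℝ → ℝ))) :=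
    (hbc.iterate_deriv' 1 1).continuous_deriv (by norm_num)
  set G : ℝ → ℝ := fun t => (|deriv (deriv etb) t| + |2-α| * |deriv etb t|)^2 with hG
  have hGi : Integrable G := by
    refine Continuous.integrable_of_hasCompactSupport (by fun_prop) ?_
    refine HasCompactSupport.of_support_subset_isCompact (K := tsupport (etb : ℝ → ℝ)) hbs ?_
    intro t ht
    by_contra hc
    apply ht
    have h1 : deriv (etb : ℝ → ℝ) t = 0 := by
      by_contra h; exact hc (support_deriv_subset h)
    have h2 : deriv (deriv (etb : ℝ → ℝ)) t = 0 := by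
      by_contra h; exact hc ((closure_minimal support_deriv_subset (isClosed_tsupport _)) (support_deriv_subset h))
    simp [hG, h1, h2]
  have hei : Integrable (fun t => etb t ^ 2) := by
    refine Continuous.integrable_of_hasCompactSupport (hbc.continuous.pow 2) ?_
    exact hbs.comp_left (g := fun x : ℝ => x^2) (by simp)
  set c := ∫ t, etb t ^ 2 with hc
  set C := ∫ t, G t with hC
  have hcpos : 0 < c := by
    refine Continuous.integral_pos_of_hasCompactSupport_nonneg_nonzero (x := 0) (hbc.continuous.pow 2)
      (hbs.comp_left (g := fun x : ℝ => x^2) (by simp)) (fun t => sq_nonneg _) ?_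
    have : etb (0:ℝ) = 1 := etb.one_of_mem_closedBall (by simp [etb])
    simp [this]
  have key : ∀ k : ℕ, muN (coneOf S) α * I ≤ (1 + 1/((k:ℝ)+1)) * J + (1 + ((k:ℝ)+1)) * (1/((k:ℝ)+1))^2 * (C / c * I) := by
    intro k
    set K : ℝ := (k:ℝ)+1 with hK
    have hK0 : 0 < K := by positivity
    have hK1 : 1 ≤ K := by simp [hK]
    set u := uk (bt n α) k φ with hu
    have hD : ∫ x in coneOf S, ‖x‖ ^ (α - 4) * (u x) ^ 2 = (K * c) * I := by
      rw [cone_polar hn hS]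
      have : ∀ q : Sph n × ℝ, (AS S).indicator (fun p : Sph n => Real.exp (n * q.2) *
          (‖Real.exp q.2 • (p : EE n)‖ ^ (α - 4) * u (Real.exp q.2 • (p : EE n)) ^ 2)) q.1
          = (AS S).indicator (fun p : Sph n => φ p ^ 2) q.1 * (etb (q.2 / K) ^ 2) := by
        intro q
        by_cases hq : q.1 ∈ AS S
        · rw [indicator_of_mem hq, indicator_of_mem hq]
          have e := uk_W0 α k φ (σ := q.1) (by simp) q.2
          unfold W0 at e
          rw [one_mul] at e
          rw [norm_smul, Real.norm_eq_abs, abs_of_pos (Real.exp_pos _)]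
          simp only [mem_sphere_zero_iff_norm.1 q.1.2, mul_one]
          rw [rp_exp, ← mul_assoc, ← Real.exp_add]
          have e2 : n * q.2 + (α - 4) * q.2 = -(bt n α * q.2) + -(bt n α * q.2) := by unfold bt; ring
          rw [e2, Real.exp_add, mul_comm (φ _ ^ 2), ← mul_pow, ← e]; ring
        · rw [indicator_of_notMem hq, indicator_of_notMem hq, zero_mul]
      simp only [this]
      rw [integral_prod_mul (fun p => (AS S).indicator (fun p : Sph n => φ p ^ 2) p) (fun t => etb (t / K) ^ 2),
        integral_indicator (AS_meas hS), Measure.integral_comp_div (fun t => etb t ^ 2) K, abs_of_pos hK0]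
      simp only [smul_eq_mul]; ring
    have hN : ∫ x in coneOf S, ‖x‖ ^ α * (lap u x) ^ 2 ≤ (1 + 1/K) * (J * (K * c)) + (1 + K) * (I * ((1/K)^2 * (K * C))) := by
      rw [cone_polar hn hS]
      have e1 : J * (K * c) = ∫ q : Sph n × ℝ, (AS S).indicator (fun p : Sph n =>
          (gam n α * φ p - lap (hext φ) p) ^ 2) q.1 * etb (q.2 / K) ^ 2 ∂((sg n).prod volume) := by
        rw [integral_prod_mul (fun p => (AS S).indicator (fun p : Sph n => (gam n α * φ p - lap (hext φ) p) ^ 2) p)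
          (fun t => etb (t / K) ^ 2), integral_indicator (AS_meas hS),
          Measure.integral_comp_div (fun t => etb t ^ 2) K, abs_of_pos hK0]
        simp only [smul_eq_mul]; rfl
      have e2 : I * ((1/K)^2 * (K * C)) = ∫ q : Sph n × ℝ, (AS S).indicator (fun p : Sph n => φ p ^ 2) q.1 *
          ((1/K)^2 * G (q.2 / K)) ∂((sg n).prod volume) := by
        rw [integral_prod_mul (fun p => (AS S).indicator (fun p : Sph n => φ p ^ 2) p)
          (fun t => (1/K)^2 * G (t / K)), integral_indicator (AS_meas hS), integral_const_mul,
          Measure.integral_comp_div G K, abs_of_pos hK0]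
        simp only [smul_eq_mul]; rfl
      have j1 : Integrable (fun q : Sph n × ℝ => (AS S).indicator (fun p : Sph n =>
          (gam n α * φ p - lap (hext φ) p) ^ 2) q.1 * etb (q.2 / K) ^ 2) ((sg n).prod volume) :=
        (i2.integrable_indicator (AS_meas hS)).mul_prod (hei.comp_div hK0.ne')
      have j2 : Integrable (fun q : Sph n × ℝ => (AS S).indicator (fun p : Sph n => φ p ^ 2) q.1 *
          ((1/K)^2 * G (q.2 / K))) ((sg n).prod volume) :=
        (i1.integrable_indicator (AS_meas hS)).mul_prod ((hGi.comp_div hK0.ne').const_mul _)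
      rw [e1, e2, ← integral_const_mul, ← integral_const_mul, ← integral_add (j1.const_mul _) (j2.const_mul _)]
      refine integral_mono_of_nonneg (ae_of_all _ fun q => ?_) ((j1.const_mul _).add (j2.const_mul _))
        (ae_of_all _ fun q => ?_)
      · refine indicator_nonneg (fun p _ => ?_) _
        positivity
      · by_cases hq : q.1 ∈ AS S
        · simp only [Pi.add_apply, indicator_of_mem hq]
          have e := uk_lap hS h α k (σ := q.1) (by simp) hq q.2
          rw [norm_smul, Real.norm_eq_abs, abs_of_pos (Real.exp_pos _)]
          simp only [mem_sphere_zero_iff_norm.1 q.1.2, mul_one]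
          have e3 : Real.exp (n * q.2) * (Real.exp q.2 ^ α * lap u (Real.exp q.2 • (q.1 : EE n)) ^ 2) =
            (Real.exp ((2 - bt n α) * q.2) * lap u (Real.exp q.2 • (q.1 : EE n)))^2 := by
            rw [rp_exp, ← mul_assoc, ← Real.exp_add, mul_pow, ← Real.exp_nat_mul]
            congr 2; unfold bt; push_cast; ring
          rw [e3, hu, e]
          refine (young_sq hK0 _ _).trans ?_
          have e4 : (deriv (deriv etb) (q.2/K) / K^2 + (2 - α) * (deriv etb (q.2/K) / K))^2 ≤ (1/K)^2 * G (q.2/K) := by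
            rw [hG]; simp only
            rw [← mul_pow, sq_le_sq, abs_of_nonneg (a := 1/K * _) (by positivity), mul_add]
            refine (abs_add_le _ _).trans (add_le_add ?_ ?_)
            · rw [abs_div, abs_of_pos (a := K^2) (by positivity), mul_comm, mul_one_div]
              gcongr; nlinarith
            · rw [abs_mul, abs_div, abs_of_pos hK0]; apply le_of_eq; field_simp
          have e5 : 0 ≤ (1 + K) * φ q.1 ^ 2 := by positivity
          have := mul_le_mul_of_nonneg_left e4 e5
          simp only [mul_pow]
          nlinarith [this]
        · simp [indicator_of_notMem hq]
    have hq : muN (coneOf S) α ≤ (∫ x in coneOf S, ‖x‖ ^ α * (lap u x) ^ 2) / (∫ x in coneOf S, ‖x‖ ^ (α - 4) * (u x) ^ 2) := by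
      refine csInf_le ⟨0, ?_⟩ ⟨u, uk_adm hS h _ k, ⟨p0, hp0, ?_⟩, rfl⟩
      · rintro q ⟨v, -, -, rfl⟩
        refine div_nonneg (integral_nonneg fun x => by positivity) (integral_nonneg fun x => by positivity)
      · rw [hu, uk_eq (sph_ne p0)]
        have : etb (0:ℝ) = 1 := etb.one_of_mem_closedBall (by simp [etb])
        have h1 : ‖(p0 : EE n)‖ = 1 := by simp
        rw [hxt, h1, Real.log_one, Fk, zero_div, this]
        simpa using hp0'
    rw [hD, le_div_iff₀ (by positivity)] at hq
    have := hq.trans hN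
    have e : (1 + 1/K) * (J * (K * c)) + (1 + K) * (I * ((1/K)^2 * (K * C))) =
      ((1 + 1/K) * J + (1 + K) * (1/K)^2 * (C / c * I)) * (K * c) := by field_simp
    rw [e] at this
    have hKc : 0 < K * c := by positivity
    refine le_of_mul_le_mul_right ?_ hKc
    linarith
  have t0 := tendsto_one_div_add_atTop_nhds_zero_nat (𝕜 := ℝ)
  have t1 : Tendsto (fun k : ℕ => (1 + 1/((k:ℝ)+1)) * J + (1/((k:ℝ)+1) * (1 + 1/((k:ℝ)+1))) * (C / c * I)) atTop
    (𝓝 ((1 + 0) * J + (0 * (1 + 0)) * (C / c * I))) :=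
    ((t0.const_add 1).mul_const J).add ((t0.mul (t0.const_add 1)).mul_const _)
  simp only [add_zero, one_mul, zero_mul] at t1
  refine ge_of_tendsto t1 (Eventually.of_forall fun k => (key k).trans (le_of_eq ?_))
  have : (0:ℝ) < (k:ℝ)+1 := by positivity
  field_simp
  ring
end

open MeasureTheory Metric Set Filter Topology
open scoped RealInnerProductSpace
noncomputable section

lemma mv_bound {g g1 : ℝ → ℝ} {C h : ℝ} (hg : ∀ x, HasDerivAt g (g1 x) x)
    (hC : ∀ x, |x| ≤ |h| → |g1 x| ≤ C) : |g h - g 0| ≤ C * |h| := by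
  have := (convex_Icc (-|h|) |h|).norm_image_sub_le_of_norm_hasDerivWithin_le (f := g) (f' := g1) (C := C)
    (x := 0) (y := h) (fun x _ => (hg x).hasDerivWithinAt) (fun x hx => hC x (abs_le.2 hx))
    (mem_Icc.2 ⟨by linarith [abs_nonneg h], abs_nonneg h⟩) (mem_Icc.2 (abs_le.1 le_rfl))
  simpa using this

lemma lip_of_off {g g1 : ℝ → ℝ} {M : ℝ} (hc : Continuous g) (hd : ∀ x ≠ 0, HasDerivAt g (g1 x) x)
    (hm : Measurable g1) (hb : ∀ x, |g1 x| ≤ M) (s t : ℝ) : |g t - g s| ≤ M * |t - s| := by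
  have hi : IntervalIntegrable g1 volume s t := by
    refine (intervalIntegrable_const (c := M)).mono_fun hm.aestronglyMeasurable ?_
    refine ae_of_all _ fun x => ?_
    simp only [Real.norm_eq_abs]
    exact (hb x).trans (le_abs_self _)
  have := MeasureTheory.integral_eq_of_hasDerivAt_off_countable g g1 (a := s) (b := t) (s := {0})
    (countable_singleton 0) hc.continuousOn (fun x hx => hd x hx.2) hi
  rw [← this]
  exact intervalIntegral.norm_integral_le_of_norm_le_const (f := g1) (C := M) fun x _ => hb x

/-- Hardy's inequality with weight -/
lemma hardy1 {g g1 : ℝ → ℝ} {C R : ℝ} (j : ℕ) (hR : 0 ≤ R) (hc : Continuous g)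
    (hd : ∀ s, 0 < s → HasDerivAt g (g1 s) s) (hm : Measurable g1)
    (hb : ∀ s, 0 ≤ s → |g s| ≤ C * s ^ (j+1)) (hb1 : ∀ s, 0 ≤ s → |g1 s| ≤ C * s ^ j) (hgR : g R = 0) :
    ((2 * j + 1) / 2) ^ 2 * ∫ s in (0)..R, g s ^ 2 * (s ^ (2*j+2))⁻¹ ≤ ∫ s in (0)..R, g1 s ^ 2 * (s ^ (2*j))⁻¹ := by
  set a : ℝ := (2 * j + 1) / 2 with ha
  set F : ℝ → ℝ := fun s => g s ^ 2 * (s ^ (2*j+1))⁻¹ with hF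
  set F1 : ℝ → ℝ := fun s => 2 * g s * g1 s * (s ^ (2*j+1))⁻¹ - 2 * a * (g s ^ 2 * (s ^ (2*j+2))⁻¹) with hF1
  have B : ∀ f : ℝ → ℝ, ∀ K : ℝ, Measurable f → (∀ s, 0 < s → |f s| ≤ K) → IntervalIntegrable f volume 0 R := by
    intro f K hf hK
    rw [intervalIntegrable_iff_integrableOn_Ioc_of_le hR]
    refine Integrable.mono' (g := fun _ => K) (integrable_const _) hf.aestronglyMeasurable ?_
    rw [ae_restrict_iff' measurableSet_Ioc]
    exact ae_of_all _ fun s hs => hK s hs.1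
  have b1 : ∀ s, 0 < s → |g s ^ 2 * (s ^ (2*j+2))⁻¹| ≤ C^2 := by
    intro s hs
    rw [abs_mul, abs_pow, abs_of_pos (a := (s ^ (2*j+2))⁻¹) (by positivity), ← div_eq_mul_inv, div_le_iff₀ (by positivity)]
    have := pow_le_pow_left₀ (abs_nonneg _) (hb s hs.le) 2
    refine this.trans (le_of_eq ?_); ring
  have b2 : ∀ s, 0 < s → |g1 s ^ 2 * (s ^ (2*j))⁻¹| ≤ C^2 := by
    intro s hs
    rw [abs_mul, abs_pow, abs_of_pos (a := (s ^ (2*j))⁻¹) (by positivity), ← div_eq_mul_inv, div_le_iff₀ (by positivity)]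
    have := pow_le_pow_left₀ (abs_nonneg _) (hb1 s hs.le) 2
    refine this.trans (le_of_eq ?_); ring
  have b3 : ∀ s, 0 < s → |F1 s| ≤ 2 * C^2 + 2 * |a| * C^2 := by
    intro s hs
    rw [hF1]
    refine (abs_sub _ _).trans (add_le_add ?_ ?_)
    · rw [abs_mul, abs_of_pos (a := (s ^ (2*j+1))⁻¹) (by positivity), ← div_eq_mul_inv, div_le_iff₀ (by positivity),
        abs_mul, abs_mul, abs_two]
      have := mul_le_mul (hb s hs.le) (hb1 s hs.le) (abs_nonneg _) ((abs_nonneg _).trans (hb s hs.le))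
      calc 2 * |g s| * |g1 s| = 2 * (|g s| * |g1 s|) := by ring
        _ ≤ 2 * (C * s ^ (j+1) * (C * s ^ j)) := by gcongr
        _ = _ := by ring
    · rw [abs_mul, abs_mul, abs_two]; gcongr; exact b1 s hs
  have hgm : Measurable g := hc.measurable
  have i1 := B (fun s => g s ^ 2 * (s ^ (2*j+2))⁻¹) _ (by fun_prop) b1
  have i2 := B (fun s => g1 s ^ 2 * (s ^ (2*j))⁻¹) _ (by fun_prop) b2
  have i3 := B F1 _ (by fun_prop) b3
  have hFc : ContinuousOn F (Icc 0 R) := by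
    intro s hs
    rcases hs.1.eq_or_lt with h0 | h0
    · have hF0 : F 0 = 0 := by simp [hF]
      rw [← h0, ContinuousWithinAt, hF0]
      refine squeeze_zero_norm' (a := fun s => C^2 * s) ?_ ?_
      · filter_upwards [self_mem_nhdsWithin] with s hs
        rcases hs.1.eq_or_lt with h0 | h0
        · rw [← h0, hF0]; simp
        rw [Real.norm_eq_abs, hF, abs_mul, abs_pow, abs_of_pos (a := (s ^ (2*j+1))⁻¹) (by positivity), ← div_eq_mul_inv, div_le_iff₀ (by positivity)]
        have := pow_le_pow_left₀ (abs_nonneg _) (hb s h0.le) 2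
        refine this.trans (le_of_eq ?_); ring
      · have : Tendsto (fun s : ℝ => C^2 * s) (𝓝 0) (𝓝 (C^2 * 0)) := (continuous_const.mul continuous_id).tendsto 0
        rw [mul_zero] at this
        exact this.mono_left nhdsWithin_le_nhds
    · have : ContinuousAt F s := (hc.continuousAt.pow 2).mul ((continuousAt_id.pow _).inv₀ (pow_ne_zero _ h0.ne'))
      exact this.continuousWithinAt
  have hFd : ∀ s ∈ Ioo 0 R, HasDerivAt F (F1 s) s := by
    intro s hs
    have h1 := (hd s hs.1).pow 2
    have h2 := (hasDerivAt_pow (2*j+1) s).inv (pow_ne_zero _ hs.1.ne')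
    refine (h1.mul h2).congr_deriv ?_
    have := hs.1
    simp only [hF1, ha, Pi.pow_apply, Pi.inv_apply]
    push_cast
    simp only [pow_succ, pow_mul]
    field_simp
    ring
  have hint := intervalIntegral.integral_eq_sub_of_hasDerivAt_of_le hR hFc hFd i3
  have e0 : ∫ s in (0)..R, F1 s = 0 := by rw [hint]; simp [hF, hgR]
  have e1 : a^2 * ∫ s in (0)..R, g s ^ 2 * (s ^ (2*j+2))⁻¹ =
      ∫ s in (0)..R, (a^2 * (g s ^ 2 * (s ^ (2*j+2))⁻¹) + a * F1 s) := by
    rw [intervalIntegral.integral_add (i1.const_mul _) (i3.const_mul _), intervalIntegral.integral_const_mul,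
      intervalIntegral.integral_const_mul, e0]; simp
  rw [e1]
  refine intervalIntegral.integral_mono_on_of_le_Ioo hR ((i1.const_mul _).add (i3.const_mul _)) i2 fun s hs => ?_
  have hs0 := hs.1
  have : g1 s ^ 2 * (s ^ (2*j))⁻¹ - (a^2 * (g s ^ 2 * (s ^ (2*j+2))⁻¹) + a * F1 s) =
      (s ^ (2*j))⁻¹ * (g1 s - a * g s / s)^2 := by
    simp only [hF1, pow_succ, pow_mul]
    field_simp
    ring
  have h2 : 0 ≤ (s ^ (2*j))⁻¹ * (g1 s - a * g s / s)^2 := by positivity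
  linarith

lemma peano2 {g g1 : ℝ → ℝ} {g2 s : ℝ} (hg : ∀ x, HasDerivAt g (g1 x) x) (h2 : HasDerivAt g1 g2 s)
    {h : ℕ → ℝ} (hh : Tendsto h atTop (𝓝 0)) (hne : ∀ k, h k ≠ 0) :
    Tendsto (fun k => (g (s + h k) + g (s - h k) - 2 * g s) / h k ^ 2) atTop (𝓝 g2) := by
  rw [Metric.tendsto_atTop]
  intro ε hε
  have ho := (hasDerivAt_iff_isLittleO.1 h2).def (show 0 < ε/4 by positivity)
  obtain ⟨δ, hδ, hδ'⟩ := Metric.eventually_nhds_iff.1 ho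
  obtain ⟨N, hN⟩ := Metric.tendsto_atTop.1 hh δ hδ
  refine ⟨N, fun k hk => ?_⟩
  have hkδ := hN k hk
  rw [Real.dist_eq, sub_zero] at hkδ
  have key : ∀ t, |t| < δ → |g (s + t) - g s - g1 s * t - g2 * t^2/2| ≤ ε / 4 * t^2 := by
    intro t ht
    have := mv_bound (g := fun x => g (s + x) - g s - g1 s * x - g2 * x^2/2)
      (g1 := fun x => g1 (s + x) - g1 s - g2 * x) (C := ε/4 * |t|) (h := t) (fun x => by
        have a1 := (hg (s + x)).comp_const_add s x
        have a2 := (hasDerivAt_id x).const_mul (g1 s)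
        have a3 := ((hasDerivAt_pow 2 x).const_mul g2).div_const 2
        refine (((a1.sub_const (g s)).sub a2).sub a3).congr_deriv ?_
        simp; ring) (fun x hx => by
        have := hδ' (y := s + x) (by rw [Real.dist_eq]; simpa using hx.trans_lt ht)
        simp only [add_sub_cancel_left, smul_eq_mul, Real.norm_eq_abs] at this
        rw [mul_comm g2 x]
        exact this.trans (by gcongr))
    simp only [add_zero, sub_self, mul_zero, ne_eq, OfNat.ofNat_ne_zero, not_false_eq_true, zero_pow, zero_div, sub_zero] at this
    rw [mul_assoc, ← abs_mul, ← sq, abs_of_nonneg (sq_nonneg t)] at this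
    exact this
  have k1 := key (h k) hkδ
  have k2 := key (-h k) (by rwa [abs_neg])
  have hp : 0 < h k ^ 2 := by have := hne k; positivity
  rw [Real.dist_eq, div_sub' hp.ne', abs_div, abs_of_pos hp, div_lt_iff₀ hp]
  rw [abs_le] at k1 k2
  rw [abs_lt]
  rw [← sub_eq_add_neg] at k2
  constructor <;> nlinarith
end

open MeasureTheory Metric Set Filter Topology
open scoped RealInnerProductSpace
noncomputable section

set_option linter.unusedSectionVars false
section abs1d
variable {Y : Type*} [MeasurableSpace Y] {ν : Measure Y} [IsFiniteMeasure ν]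

def strip (Y : Type*) (R : ℝ) : Set (Y × ℝ) := univ ×ˢ Icc (-1) (R+1)

lemma strip_meas (R : ℝ) : MeasurableSet (strip Y R) := MeasurableSet.univ.prod measurableSet_Icc

lemma strip_int (R C : ℝ) : Integrable ((strip Y R).indicator fun _ => C) (ν.prod volume) := by
  refine (integrable_indicator_iff (strip_meas R)).2 (integrableOn_const (C := C) ?_)
  rw [strip, Measure.prod_prod, Real.volume_Icc]
  exact ENNReal.mul_ne_top (measure_ne_top _ _) ENNReal.ofReal_ne_top

lemma strip_bound {f : Y × ℝ → ℝ} {R C : ℝ} (hC : ∀ q, |f q| ≤ C)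
    (h0 : ∀ q, q.2 < -1 ∨ R + 1 < q.2 → f q = 0) (q : Y × ℝ) :
    ‖f q‖ ≤ (strip Y R).indicator (fun _ => C) q := by
  by_cases hq : q ∈ strip Y R
  · rw [indicator_of_mem hq]; exact hC q
  · rw [indicator_of_notMem hq, h0, norm_zero]
    by_contra! hc
    exact hq ⟨mem_univ _, hc.1, hc.2⟩

lemma strip_integrable {f : Y × ℝ → ℝ} {R C : ℝ} (hm : Measurable f) (hC : ∀ q, |f q| ≤ C)
    (h0 : ∀ q, q.2 < -1 ∨ R + 1 < q.2 → f q = 0) : Integrable f (ν.prod volume) :=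
  (strip_int R C).mono' hm.aestronglyMeasurable (ae_of_all _ (strip_bound hC h0))

lemma strip_tendsto {f : ℕ → Y × ℝ → ℝ} {g : Y × ℝ → ℝ} {R C : ℝ} (hm : ∀ k, Measurable (f k))
    (hC : ∀ k q, |f k q| ≤ C) (h0 : ∀ k q, q.2 < -1 ∨ R + 1 < q.2 → f k q = 0)
    (hl : ∀ y s, s ≠ 0 → Tendsto (fun k => f k (y,s)) atTop (𝓝 (g (y,s)))) :
    Tendsto (fun k => ∫ q, f k q ∂(ν.prod volume)) atTop (𝓝 (∫ q, g q ∂(ν.prod volume))) := by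
  refine tendsto_integral_of_dominated_convergence _ (fun k => (hm k).aestronglyMeasurable)
    (strip_int R C) (fun k => ae_of_all _ (strip_bound (hC k) (h0 k))) ?_
  have : ∀ᵐ q ∂(ν.prod (volume : Measure ℝ)), q.2 ≠ 0 := by
    have h1 : ∀ᵐ s : ℝ, s ≠ 0 := by simp [ae_iff]
    exact Measure.quasiMeasurePreserving_snd.ae h1
  filter_upwards [this] with q hq using hl q.1 q.2 hq

lemma shift_int {f : Y × ℝ → ℝ} (h : ℝ) (hf : Integrable f (ν.prod volume)) 
    (hf' : Integrable (fun q : Y × ℝ => f (q.1, q.2 + h)) (ν.prod volume)) :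
    ∫ q, f (q.1, q.2 + h) ∂(ν.prod volume) = ∫ q, f q ∂(ν.prod volume) := by
  rw [integral_prod _ hf, integral_prod _ hf']
  refine integral_congr_ae (ae_of_all _ fun y => ?_)
  exact integral_add_right_eq_self (fun s => f (y, s)) h

structure Dat (ν : Measure Y) (w w1 w2 l : Y → ℝ → ℝ) (M R : ℝ) : Prop where
  hR : 0 ≤ R
  hM : 0 ≤ M
  mw : Measurable fun q : Y × ℝ => w q.1 q.2
  mw1 : Measurable fun q : Y × ℝ => w1 q.1 q.2
  mw2 : Measurable fun q : Y × ℝ => w2 q.1 q.2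
  ml : Measurable fun q : Y × ℝ => l q.1 q.2
  bw : ∀ y s, |w y s| ≤ M
  bw1 : ∀ y s, |w1 y s| ≤ M
  bw2 : ∀ y s, |w2 y s| ≤ M
  bl : ∀ y s, |l y s| ≤ M
  zw : ∀ y s, s ≤ 0 ∨ R ≤ s → w y s = 0
  zw1 : ∀ y s, s ≤ 0 ∨ R ≤ s → w1 y s = 0
  zw2 : ∀ y s, s ≤ 0 ∨ R ≤ s → w2 y s = 0
  zl : ∀ y s, s ≤ 0 ∨ R ≤ s → l y s = 0
  dw : ∀ y s, HasDerivAt (w y) (w1 y s) s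
  dw1 : ∀ y s, s ≠ 0 → HasDerivAt (w1 y) (w2 y s) s
  cw1 : ∀ y, Continuous (w1 y)
  sym : ∀ s t, ∫ y, w y s * l y t ∂ν = ∫ y, w y t * l y s ∂ν

variable {w w1 w2 l : Y → ℝ → ℝ} {M R : ℝ}

lemma Dat.mwh (D : Dat ν w w1 w2 l M R) (h : ℝ) : Measurable fun q : Y × ℝ => w q.1 (q.2 + h) :=
  D.mw.comp (measurable_fst.prodMk (measurable_snd.add_const h))
lemma Dat.mlh (D : Dat ν w w1 w2 l M R) (h : ℝ) : Measurable fun q : Y × ℝ => l q.1 (q.2 + h) :=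
  D.ml.comp (measurable_fst.prodMk (measurable_snd.add_const h))

lemma mulb {a b M N : ℝ} (ha : |a| ≤ M) (hb : |b| ≤ N) : |a * b| ≤ M * N := by
  rw [abs_mul]; exact mul_le_mul ha hb (abs_nonneg _) ((abs_nonneg _).trans ha)

lemma Dat.iwl (D : Dat ν w w1 w2 l M R) (h : ℝ) :
    Integrable (fun q : Y × ℝ => w q.1 (q.2 + h) * l q.1 q.2) (ν.prod volume) := by
  refine strip_integrable (R := R) (C := M * M) ((D.mwh h).mul D.ml) (fun q => mulb (D.bw _ _) (D.bl _ _)) ?_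
  intro q hq
  rw [D.zl, mul_zero]; rcases hq with h | h <;> [left; right] <;> linarith

lemma Dat.ilw (D : Dat ν w w1 w2 l M R) (h : ℝ) :
    Integrable (fun q : Y × ℝ => w q.1 q.2 * l q.1 (q.2 + h)) (ν.prod volume) := by
  refine strip_integrable (R := R) (C := M * M) (D.mw.mul (D.mlh h)) (fun q => mulb (D.bw _ _) (D.bl _ _)) ?_
  intro q hq
  rw [D.zw, zero_mul]; rcases hq with h | h <;> [left; right] <;> linarith

lemma Dat.shift (D : Dat ν w w1 w2 l M R) (h : ℝ) :
    ∫ q : Y × ℝ, w q.1 q.2 * l q.1 (q.2 + h) ∂(ν.prod volume) =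
    ∫ q : Y × ℝ, w q.1 (q.2 - h) * l q.1 q.2 ∂(ν.prod volume) := by
  have h1 := D.iwl (-h)
  simp only [← sub_eq_add_neg] at h1
  have h2 := D.ilw h
  have := shift_int (f := fun q : Y × ℝ => w q.1 (q.2 - h) * l q.1 q.2) h h1 (by simpa using h2)
  simpa using this

lemma Dat.symh (D : Dat ν w w1 w2 l M R) (h : ℝ) :
    ∫ q : Y × ℝ, w q.1 (q.2 + h) * l q.1 q.2 ∂(ν.prod volume) =
    ∫ q : Y × ℝ, w q.1 q.2 * l q.1 (q.2 + h) ∂(ν.prod volume) := by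
  rw [integral_prod_symm _ (D.iwl h), integral_prod_symm _ (D.ilw h)]
  exact integral_congr_ae (ae_of_all _ fun s => D.sym (s + h) s)

lemma Dat.lip (D : Dat ν w w1 w2 l M R) (y : Y) (s t : ℝ) : |w y t - w y s| ≤ M * |t - s| := by
  have := mv_bound (g := fun x => w y (s + x)) (g1 := fun x => w1 y (s + x)) (h := t - s)
    (fun x => (D.dw y (s + x)).comp_const_add s x) (fun x _ => D.bw1 y _)
  simpa using this

lemma Dat.lip1 (D : Dat ν w w1 w2 l M R) (y : Y) (s t : ℝ) : |w1 y t - w1 y s| ≤ M * |t - s| :=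
  lip_of_off (D.cw1 y) (D.dw1 y) (D.mw2.comp measurable_prodMk_left) (D.bw2 y) s t

lemma Dat.lip2 (D : Dat ν w w1 w2 l M R) (y : Y) (s h : ℝ) :
    |w y (s + h) - w y s - w1 y s * h| ≤ M * h ^ 2 := by
  have := mv_bound (g := fun x => w y (s + x) - w y s - w1 y s * x) (g1 := fun x => w1 y (s + x) - w1 y s) (h := h)
    (C := M * |h|)
    (fun x => by
      have a1 := (D.dw y (s + x)).comp_const_add s x
      have a2 := (hasDerivAt_id x).const_mul (w1 y s)
      refine ((a1.sub_const (w y s)).sub a2).congr_deriv ?_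
      simp) (fun x hx => by
      have := D.lip1 y s (s + x)
      simp only [add_sub_cancel_left] at this
      exact this.trans (by have := D.hM; gcongr))
  simp only [add_zero, sub_self, mul_zero, sub_zero] at this
  rw [mul_assoc, ← abs_mul, ← sq, abs_of_nonneg (sq_nonneg h)] at this
  exact this

lemma Dat.lip3 (D : Dat ν w w1 w2 l M R) (y : Y) (s h : ℝ) :
    |w y (s + h) + w y (s - h) - 2 * w y s| ≤ 2 * M * h ^ 2 := by
  have h1 := D.lip2 y s h
  have h2 := D.lip2 y s (-h)
  rw [← sub_eq_add_neg] at h2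
  rw [abs_le] at *
  constructor <;> nlinarith

lemma Dat.diff_tendsto (D : Dat ν w w1 w2 l M R) {h : ℕ → ℝ} (hh : Tendsto h atTop (𝓝 0)) (hne : ∀ k, h k ≠ 0)
    (y : Y) (s : ℝ) : Tendsto (fun k => (w y (s + h k) - w y s) / h k) atTop (𝓝 (w1 y s)) := by
  have := (D.dw y s).tendsto_slope_zero
  have h1 : Tendsto h atTop (𝓝[≠] 0) := tendsto_nhdsWithin_iff.2 ⟨hh, Eventually.of_forall hne⟩
  refine (this.comp h1).congr fun k => ?_
  simp [div_eq_inv_mul]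

lemma Dat.w1l (D : Dat ν w w1 w2 l M R) : ∫ q : Y × ℝ, w1 q.1 q.2 * l q.1 q.2 ∂(ν.prod volume) = 0 := by
  have key : ∀ h : ℕ → ℝ, Tendsto h atTop (𝓝 0) → (∀ k, h k ≠ 0) →
      Tendsto (fun k => ∫ q : Y × ℝ, (w q.1 (q.2 + h k) - w q.1 q.2) / h k * l q.1 q.2 ∂(ν.prod volume)) atTop
        (𝓝 (∫ q : Y × ℝ, w1 q.1 q.2 * l q.1 q.2 ∂(ν.prod volume))) := by
    intro h hh hne
    refine strip_tendsto (R := R) (C := M * M) (fun k => (((D.mwh _).sub D.mw).div_const _).mul D.ml) ?_ ?_ ?_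
    · intro k q
      refine mulb ?_ (D.bl _ _)
      rw [abs_div, div_le_iff₀ (abs_pos.2 (hne k))]
      simpa using D.lip q.1 q.2 (q.2 + h k)
    · intro k q hq
      rw [D.zl, mul_zero]; rcases hq with h | h <;> [left; right] <;> linarith
    · intro y s _
      exact (D.diff_tendsto hh hne y s).mul_const _
  have e : ∀ h : ℝ, h ≠ 0 → ∫ q : Y × ℝ, (w q.1 (q.2 + h) - w q.1 q.2) / h * l q.1 q.2 ∂(ν.prod volume) =
     (∫ q : Y × ℝ, w q.1 (q.2 + h) * l q.1 q.2 ∂(ν.prod volume) - ∫ q : Y × ℝ, w q.1 q.2 * l q.1 q.2 ∂(ν.prod volume)) / h := by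
    intro h hne
    have i0 := D.iwl 0
    simp only [add_zero] at i0
    rw [← integral_sub (D.iwl h) i0, ← integral_div]
    congr 1; funext q; ring
  have t1 := key et et_tendsto (fun k => (et_pos k).ne')
  have t2 := key (fun k => - et k) (by simpa using et_tendsto.neg) (fun k => (neg_neg_of_pos (et_pos k)).ne)
  have t3 := t1.add t2
  have : ∀ k, (∫ q : Y × ℝ, (w q.1 (q.2 + et k) - w q.1 q.2) / et k * l q.1 q.2 ∂(ν.prod volume)) +
    (∫ q : Y × ℝ, (w q.1 (q.2 + -et k) - w q.1 q.2) / (-et k) * l q.1 q.2 ∂(ν.prod volume)) = 0 := by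
    intro k
    have hp := et_pos k
    rw [e _ hp.ne', e _ (neg_neg_of_pos hp).ne, D.symh (et k), D.shift (et k)]
    simp only [← sub_eq_add_neg]
    field_simp
    ring
  simp only [this] at t3
  have := tendsto_nhds_unique t3 tendsto_const_nhds
  linarith

lemma Dat.iD (D : Dat ν w w1 w2 l M R) {h : ℝ} (hh : |h| ≤ 1) :
    Integrable (fun q : Y × ℝ => (w q.1 (q.2 + h) - w q.1 q.2) ^ 2) (ν.prod volume) := by
  refine strip_integrable (R := R) (C := (M + M)^2) (((D.mwh h).sub D.mw).pow_const 2) (fun q => ?_) ?_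
  · rw [abs_pow]; gcongr
    exact (abs_sub _ _).trans (add_le_add (D.bw _ _) (D.bw _ _))
  · intro q hq
    rw [abs_le] at hh
    rw [D.zw, D.zw]; · simp
    · rcases hq with h | h <;> [left; right] <;> linarith
    · rcases hq with h | h <;> [left; right] <;> linarith [hh.1, hh.2]

lemma Dat.w2l (D : Dat ν w w1 w2 l M R) {L : ℝ}
    (pos : ∀ s t, L * ∫ y, (w y s - w y t) ^ 2 ∂ν ≤ ∫ y, (w y s - w y t) * (l y s - l y t) ∂ν) :
    L * ∫ q : Y × ℝ, w1 q.1 q.2 ^ 2 ∂(ν.prod volume) ≤ - ∫ q : Y × ℝ, w2 q.1 q.2 * l q.1 q.2 ∂(ν.prod volume) := by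
  have hle : ∀ k, |et k| ≤ 1 := fun k => by
    rw [abs_of_pos (et_pos k)]; unfold et; rw [div_le_one (by positivity)]; simp
  have t1 : Tendsto (fun k => ∫ q : Y × ℝ, ((w q.1 (q.2 + et k) - w q.1 q.2) / et k)^2 ∂(ν.prod volume)) atTop
        (𝓝 (∫ q : Y × ℝ, w1 q.1 q.2 ^ 2 ∂(ν.prod volume))) := by
    refine strip_tendsto (R := R) (C := M^2) (fun k => (((D.mwh _).sub D.mw).div_const _).pow_const 2) ?_ ?_ ?_
    · intro k q
      rw [abs_pow]; gcongr
      rw [abs_div, div_le_iff₀ (abs_pos.2 (et_pos k).ne')]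
      simpa using D.lip q.1 q.2 (q.2 + et k)
    · intro k q hq
      have hh := abs_le.1 (hle k)
      rw [D.zw, D.zw]; · simp
      · rcases hq with h | h <;> [left; right] <;> linarith
      · rcases hq with h | h <;> [left; right] <;> linarith [hh.1, hh.2]
    · intro y s _
      exact (D.diff_tendsto et_tendsto (fun k => (et_pos k).ne') y s).pow 2
  have t2 : Tendsto (fun k => ∫ q : Y × ℝ, (w q.1 (q.2 + et k) + w q.1 (q.2 - et k) - 2 * w q.1 q.2) / et k ^ 2 * l q.1 q.2
        ∂(ν.prod volume)) atTop (𝓝 (∫ q : Y × ℝ, w2 q.1 q.2 * l q.1 q.2 ∂(ν.prod volume))) := by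
    refine strip_tendsto (R := R) (C := 2 * M * M) (fun k => ((((D.mwh _).add (by simpa only [← sub_eq_add_neg] using D.mwh (-et k))).sub
      (D.mw.const_mul 2)).div_const _).mul D.ml) ?_ ?_ ?_
    · intro k q
      refine mulb ?_ (D.bl _ _)
      have := et_pos k
      rw [abs_div, abs_of_pos (a := et k ^ 2) (by positivity), div_le_iff₀ (by positivity)]
      exact D.lip3 q.1 q.2 (et k)
    · intro k q hq
      rw [D.zl, mul_zero]; rcases hq with h | h <;> [left; right] <;> linarith
    · intro y s hs
      exact (peano2 (D.dw y) (D.dw1 y s hs) et_tendsto (fun k => (et_pos k).ne')).mul_const _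
  refine le_of_tendsto_of_tendsto' (t1.const_mul L) t2.neg fun k => ?_
  set h := et k with hh
  have hp : 0 < h := et_pos k
  have i0 := D.iwl 0
  simp only [add_zero] at i0
  have im := D.iwl (-h)
  simp only [← sub_eq_add_neg] at im
  have ihh : Integrable (fun q : Y × ℝ => w q.1 (q.2 + h) * l q.1 (q.2 + h)) (ν.prod volume) := by
    refine strip_integrable (R := R) (C := M * M) ((D.mwh h).mul (D.mlh h)) (fun q => mulb (D.bw _ _) (D.bl _ _)) ?_
    intro q hq
    have hh := abs_le.1 (hle k)
    rw [D.zw, zero_mul]; rcases hq with h | h <;> [left; right] <;> linarith [hh.1, hh.2]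
  have ehh := shift_int (f := fun q : Y × ℝ => w q.1 q.2 * l q.1 q.2) h i0 ihh
  have e1 : ∀ q : Y × ℝ, (w q.1 (q.2 + h) - w q.1 q.2) * (l q.1 (q.2 + h) - l q.1 q.2) =
    (w q.1 (q.2 + h) * l q.1 (q.2 + h) + w q.1 q.2 * l q.1 q.2) - (w q.1 (q.2 + h) * l q.1 q.2 + w q.1 q.2 * l q.1 (q.2 + h)) :=
    fun q => by ring
  have iP : Integrable (fun q : Y × ℝ => (w q.1 (q.2 + h) - w q.1 q.2) * (l q.1 (q.2 + h) - l q.1 q.2)) (ν.prod volume) := by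
    simp only [e1]
    exact (ihh.add i0).sub ((D.iwl h).add (D.ilw h))
  have hpos : L * ∫ q : Y × ℝ, (w q.1 (q.2 + h) - w q.1 q.2) ^ 2 ∂(ν.prod volume) ≤
      ∫ q : Y × ℝ, (w q.1 (q.2 + h) - w q.1 q.2) * (l q.1 (q.2 + h) - l q.1 q.2) ∂(ν.prod volume) := by
    rw [integral_prod_symm _ (D.iD (hle k)), integral_prod_symm _ iP, ← integral_const_mul]
    exact integral_mono ((D.iD (hle k)).integral_prod_right.const_mul L) iP.integral_prod_right fun s => pos (s + h) s
  have e2 : ∫ q : Y × ℝ, (w q.1 (q.2 + h) - w q.1 q.2) * (l q.1 (q.2 + h) - l q.1 q.2) ∂(ν.prod volume) =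
      - ∫ q : Y × ℝ, (w q.1 (q.2 + h) + w q.1 (q.2 - h) - 2 * w q.1 q.2) * l q.1 q.2 ∂(ν.prod volume) := by
    simp only [e1]
    have iA : Integrable (fun q : Y × ℝ => w q.1 (q.2 + h) * l q.1 (q.2 + h) + w q.1 q.2 * l q.1 q.2) (ν.prod volume) := ihh.add i0
    have iB : Integrable (fun q : Y × ℝ => w q.1 (q.2 + h) * l q.1 q.2 + w q.1 q.2 * l q.1 (q.2 + h)) (ν.prod volume) :=
      (D.iwl h).add (D.ilw h)
    have iC : Integrable (fun q : Y × ℝ => w q.1 (q.2 + h) * l q.1 q.2 + w q.1 (q.2 - h) * l q.1 q.2) (ν.prod volume) :=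
      (D.iwl h).add im
    rw [integral_sub iA iB, integral_add ihh i0, integral_add (D.iwl h) (D.ilw h), ehh, D.shift h]
    have e3 : ∀ q : Y × ℝ, (w q.1 (q.2 + h) + w q.1 (q.2 - h) - 2 * w q.1 q.2) * l q.1 q.2 =
      (w q.1 (q.2 + h) * l q.1 q.2 + w q.1 (q.2 - h) * l q.1 q.2) - 2 * (w q.1 q.2 * l q.1 q.2) := fun q => by ring
    simp only [e3]
    rw [integral_sub iC (i0.const_mul 2), integral_add (D.iwl h) im, integral_const_mul]
    ring
  rw [e2] at hpos
  simp only [div_pow, div_mul_eq_mul_div, integral_div]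
  rw [← mul_div_assoc, ← neg_div]
  gcongr

lemma Dat.i1 (D : Dat ν w w1 w2 l M R) {f : Y × ℝ → ℝ} (hm : Measurable f) {C : ℝ} (hC : ∀ q, |f q| ≤ C)
    (h0 : ∀ q, q.2 ≤ 0 ∨ R ≤ q.2 → f q = 0) : Integrable f (ν.prod volume) :=
  strip_integrable (R := R) hm hC fun q hq => h0 q (by rcases hq with h | h <;> [left; right] <;> linarith)

lemma toInterval {f : ℝ → ℝ} {R : ℝ} (hR : 0 ≤ R) (h0 : ∀ s, s ≤ 0 ∨ R ≤ s → f s = 0) :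
    ∫ s in (0)..R, f s = ∫ s, f s := by
  rw [intervalIntegral.integral_of_le hR]
  refine setIntegral_eq_integral_of_forall_compl_eq_zero fun s hs => h0 s ?_
  by_contra! hc
  exact hs ⟨hc.1, hc.2.le⟩

lemma Dat.w1_le (D : Dat ν w w1 w2 l M R) (y : Y) {s : ℝ} (hs : 0 ≤ s) : |w1 y s| ≤ M * s := by
  have := D.lip1 y 0 s
  rwa [D.zw1 y 0 (Or.inl le_rfl), sub_zero, sub_zero, abs_of_nonneg hs] at this

lemma Dat.w_le (D : Dat ν w w1 w2 l M R) (y : Y) {s : ℝ} (hs : 0 ≤ s) : |w y s| ≤ M * s := by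
  have := D.lip y 0 s
  rwa [D.zw y 0 (Or.inl le_rfl), sub_zero, sub_zero, abs_of_nonneg hs] at this

lemma Dat.w_le2 (D : Dat ν w w1 w2 l M R) (y : Y) (s : ℝ) : |w y s| ≤ M * s ^ 2 := by
  have := D.lip2 y 0 s
  rwa [D.zw y 0 (Or.inl le_rfl), D.zw1 y 0 (Or.inl le_rfl), sub_zero, zero_mul, sub_zero, zero_add] at this

lemma Dat.wc (D : Dat ν w w1 w2 l M R) (y : Y) : Continuous (w y) :=
  continuous_iff_continuousAt.2 fun s => (D.dw y s).continuousAt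

lemma Dat.h1 (D : Dat ν w w1 w2 l M R) (y : Y) :
    (1/4) * ∫ s, w y s ^ 2 * (s ^ 2)⁻¹ ≤ ∫ s, w1 y s ^ 2 := by
  have := hardy1 (g := w y) (g1 := w1 y) (C := M) 0 D.hR (D.wc y) (fun s _ => D.dw y s)
    (D.mw1.comp measurable_prodMk_left) (fun s hs => by simpa using D.w_le y hs)
    (fun s hs => by simpa using D.bw1 y s) (D.zw y R (Or.inr le_rfl))
  rw [toInterval D.hR, toInterval D.hR] at this
  · norm_num at this
    norm_num
    linarith
  · intro s hs; simp [D.zw1 y s hs]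
  · intro s hs; simp [D.zw y s hs]

lemma Dat.h2 (D : Dat ν w w1 w2 l M R) (y : Y) :
    (9/16) * ∫ s, w y s ^ 2 * (s ^ 4)⁻¹ ≤ ∫ s, w2 y s ^ 2 := by
  have a1 := hardy1 (g := w1 y) (g1 := w2 y) (C := M) 0 D.hR (D.cw1 y) (fun s hs => D.dw1 y s hs.ne')
    (D.mw2.comp measurable_prodMk_left) (fun s hs => by simpa using D.w1_le y hs)
    (fun s hs => by simpa using D.bw2 y s) (D.zw1 y R (Or.inr le_rfl))
  have a2 := hardy1 (g := w y) (g1 := w1 y) (C := M) 1 D.hR (D.wc y) (fun s _ => D.dw y s)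
    (D.mw1.comp measurable_prodMk_left) (fun s hs => by simpa using D.w_le2 y s)
    (fun s hs => by simpa using D.w1_le y hs) (D.zw y R (Or.inr le_rfl))
  rw [toInterval D.hR, toInterval D.hR] at a1 a2
  · norm_num at a1 a2
    norm_num
    linarith
  · intro s hs; simp [D.zw1 y s hs]
  · intro s hs; simp [D.zw2 y s hs]
  · intro s hs; simp [D.zw y s hs]
  · intro s hs; simp [D.zw1 y s hs]

lemma Dat.w12 (D : Dat ν w w1 w2 l M R) (y : Y) : ∫ s, w2 y s * w1 y s = 0 := by
  rw [← toInterval D.hR (fun s hs => by simp [D.zw1 y s hs])]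
  have hm : Measurable (fun s => w2 y s * w1 y s) :=
    (D.mw2.comp measurable_prodMk_left).mul (D.mw1.comp measurable_prodMk_left)
  have hi : IntervalIntegrable (fun s => w2 y s * w1 y s) volume 0 R := by
    refine (intervalIntegrable_const (c := M * M)).mono_fun hm.aestronglyMeasurable ?_
    refine ae_of_all _ fun x => ?_
    simp only [Real.norm_eq_abs]
    exact (mulb (D.bw2 _ _) (D.bw1 _ _)).trans (le_abs_self _)
  have := intervalIntegral.integral_eq_sub_of_hasDerivAt_of_le (f := fun s => w1 y s ^ 2 / 2) D.hR
    (((D.cw1 y).pow 2).div_const 2).continuousOn (fun s hs => by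
      have := ((D.dw1 y s hs.1.ne').pow 2).div_const 2
      exact this.congr_deriv (by simp; ring)) hi
  rw [this, D.zw1 y R (Or.inr le_rfl), D.zw1 y 0 (Or.inl le_rfl)]; simp

lemma Dat.main (D : Dat ν w w1 w2 l M R) {L μ b : ℝ}
    (pos : ∀ s t, L * ∫ y, (w y s - w y t) ^ 2 ∂ν ≤ ∫ y, (w y s - w y t) * (l y s - l y t) ∂ν)
    (hmu : ∀ s, μ * ∫ y, w y s ^ 2 ∂ν ≤ ∫ y, l y s ^ 2 ∂ν) (hL : 0 ≤ 2 * L + b ^ 2) :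
    μ * ∫ q : Y × ℝ, w q.1 q.2 ^ 2 ∂(ν.prod volume)
      + (2 * L + b^2) / 4 * ∫ q : Y × ℝ, w q.1 q.2 ^ 2 * (q.2 ^ 2)⁻¹ ∂(ν.prod volume)
      + (9/16) * ∫ q : Y × ℝ, w q.1 q.2 ^ 2 * (q.2 ^ 4)⁻¹ ∂(ν.prod volume)
    ≤ ∫ q : Y × ℝ, (w2 q.1 q.2 + b * w1 q.1 q.2 - l q.1 q.2) ^ 2 ∂(ν.prod volume) := by
  have pw : ∀ {a C : ℝ}, |a| ≤ C → |a ^ 2| ≤ C ^ 2 := fun {a C} h => by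
    rw [abs_pow]; exact pow_le_pow_left₀ (abs_nonneg _) h 2
  have iw : Integrable (fun q : Y × ℝ => w q.1 q.2 ^ 2) (ν.prod volume) :=
    D.i1 (D.mw.pow_const 2) (fun q => pw (D.bw _ _)) fun q hq => by simp [D.zw _ _ hq]
  have iw1 : Integrable (fun q : Y × ℝ => w1 q.1 q.2 ^ 2) (ν.prod volume) :=
    D.i1 (D.mw1.pow_const 2) (fun q => pw (D.bw1 _ _)) fun q hq => by simp [D.zw1 _ _ hq]
  have iw2 : Integrable (fun q : Y × ℝ => w2 q.1 q.2 ^ 2) (ν.prod volume) :=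
    D.i1 (D.mw2.pow_const 2) (fun q => pw (D.bw2 _ _)) fun q hq => by simp [D.zw2 _ _ hq]
  have il : Integrable (fun q : Y × ℝ => l q.1 q.2 ^ 2) (ν.prod volume) :=
    D.i1 (D.ml.pow_const 2) (fun q => pw (D.bl _ _)) fun q hq => by simp [D.zl _ _ hq]
  have i21 : Integrable (fun q : Y × ℝ => w2 q.1 q.2 * w1 q.1 q.2) (ν.prod volume) :=
    D.i1 (D.mw2.mul D.mw1) (fun q => mulb (D.bw2 _ _) (D.bw1 _ _)) fun q hq => by simp [D.zw2 _ _ hq]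
  have i2l : Integrable (fun q : Y × ℝ => w2 q.1 q.2 * l q.1 q.2) (ν.prod volume) :=
    D.i1 (D.mw2.mul D.ml) (fun q => mulb (D.bw2 _ _) (D.bl _ _)) fun q hq => by simp [D.zw2 _ _ hq]
  have i1l : Integrable (fun q : Y × ℝ => w1 q.1 q.2 * l q.1 q.2) (ν.prod volume) :=
    D.i1 (D.mw1.mul D.ml) (fun q => mulb (D.bw1 _ _) (D.bl _ _)) fun q hq => by simp [D.zw1 _ _ hq]
  have iq2 : Integrable (fun q : Y × ℝ => w q.1 q.2 ^ 2 * (q.2 ^ 2)⁻¹) (ν.prod volume) := by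
    refine D.i1 (C := M^2) ((D.mw.pow_const 2).mul (measurable_snd.pow_const 2).inv) (fun q => ?_) fun q hq => by simp [D.zw _ _ hq]
    rcases le_or_gt q.2 0 with h | h
    · rw [D.zw _ _ (Or.inl h)]; simpa using sq_nonneg M
    · rw [abs_mul, abs_of_pos (a := (q.2 ^ 2)⁻¹) (by positivity), ← div_eq_mul_inv, div_le_iff₀ (by positivity), ← mul_pow]
      exact pw (D.w_le _ h.le)
  have iq4 : Integrable (fun q : Y × ℝ => w q.1 q.2 ^ 2 * (q.2 ^ 4)⁻¹) (ν.prod volume) := by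
    refine D.i1 (C := M^2) ((D.mw.pow_const 2).mul (measurable_snd.pow_const 4).inv) (fun q => ?_) fun q hq => by simp [D.zw _ _ hq]
    rcases le_or_gt q.2 0 with h | h
    · rw [D.zw _ _ (Or.inl h)]; simpa using sq_nonneg M
    · rw [abs_mul, abs_of_pos (a := (q.2 ^ 4)⁻¹) (by positivity), ← div_eq_mul_inv, div_le_iff₀ (by positivity),
        show q.2 ^ 4 = (q.2 ^ 2)^2 by ring, ← mul_pow]
      exact pw (D.w_le2 _ _)
  have b1 : (1/4) * ∫ q : Y × ℝ, w q.1 q.2 ^ 2 * (q.2 ^ 2)⁻¹ ∂(ν.prod volume) ≤ ∫ q : Y × ℝ, w1 q.1 q.2 ^ 2 ∂(ν.prod volume) := by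
    rw [integral_prod _ iq2, integral_prod _ iw1, ← integral_const_mul]
    exact integral_mono (iq2.integral_prod_left.const_mul _) iw1.integral_prod_left fun y => D.h1 y
  have b2 : (9/16) * ∫ q : Y × ℝ, w q.1 q.2 ^ 2 * (q.2 ^ 4)⁻¹ ∂(ν.prod volume) ≤ ∫ q : Y × ℝ, w2 q.1 q.2 ^ 2 ∂(ν.prod volume) := by
    rw [integral_prod _ iq4, integral_prod _ iw2, ← integral_const_mul]
    exact integral_mono (iq4.integral_prod_left.const_mul _) iw2.integral_prod_left fun y => D.h2 y
  have b3 : μ * ∫ q : Y × ℝ, w q.1 q.2 ^ 2 ∂(ν.prod volume) ≤ ∫ q : Y × ℝ, l q.1 q.2 ^ 2 ∂(ν.prod volume) := by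
    rw [integral_prod_symm _ iw, integral_prod_symm _ il, ← integral_const_mul]
    exact integral_mono (iw.integral_prod_right.const_mul _) il.integral_prod_right fun s => hmu s
  have b4 : ∫ q : Y × ℝ, w2 q.1 q.2 * w1 q.1 q.2 ∂(ν.prod volume) = 0 := by
    rw [integral_prod _ i21, integral_congr_ae (g := fun _ => 0) (ae_of_all _ fun y => D.w12 y)]
    simp
  have b5 := D.w1l
  have b6 := D.w2l pos
  have e : ∫ q : Y × ℝ, (w2 q.1 q.2 + b * w1 q.1 q.2 - l q.1 q.2) ^ 2 ∂(ν.prod volume) =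
    ∫ q : Y × ℝ, w2 q.1 q.2 ^ 2 ∂(ν.prod volume) + b^2 * ∫ q : Y × ℝ, w1 q.1 q.2 ^ 2 ∂(ν.prod volume) +
    ∫ q : Y × ℝ, l q.1 q.2 ^ 2 ∂(ν.prod volume) + 2 * b * ∫ q : Y × ℝ, w2 q.1 q.2 * w1 q.1 q.2 ∂(ν.prod volume)
    + (-2) * ∫ q : Y × ℝ, w2 q.1 q.2 * l q.1 q.2 ∂(ν.prod volume)
    + (-(2 * b)) * ∫ q : Y × ℝ, w1 q.1 q.2 * l q.1 q.2 ∂(ν.prod volume) := by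
    simp only [← integral_const_mul]
    have j1 : Integrable (fun q : Y × ℝ => b^2 * w1 q.1 q.2 ^ 2) (ν.prod volume) := iw1.const_mul _
    have j2 : Integrable (fun q : Y × ℝ => 2 * b * (w2 q.1 q.2 * w1 q.1 q.2)) (ν.prod volume) := i21.const_mul _
    have j3 : Integrable (fun q : Y × ℝ => (-2) * (w2 q.1 q.2 * l q.1 q.2)) (ν.prod volume) := i2l.const_mul _
    have j4 : Integrable (fun q : Y × ℝ => (-(2*b)) * (w1 q.1 q.2 * l q.1 q.2)) (ν.prod volume) := i1l.const_mul _
    have k1 : Integrable (fun q : Y × ℝ => w2 q.1 q.2 ^ 2 + b^2 * w1 q.1 q.2 ^ 2) (ν.prod volume) := iw2.add j1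
    have k2 : Integrable (fun q : Y × ℝ => w2 q.1 q.2 ^ 2 + b^2 * w1 q.1 q.2 ^ 2 + l q.1 q.2 ^ 2) (ν.prod volume) := k1.add il
    have k3 : Integrable (fun q : Y × ℝ => w2 q.1 q.2 ^ 2 + b^2 * w1 q.1 q.2 ^ 2 + l q.1 q.2 ^ 2 + 2 * b * (w2 q.1 q.2 * w1 q.1 q.2)) (ν.prod volume) := k2.add j2
    have k4 : Integrable (fun q : Y × ℝ => w2 q.1 q.2 ^ 2 + b^2 * w1 q.1 q.2 ^ 2 + l q.1 q.2 ^ 2 + 2 * b * (w2 q.1 q.2 * w1 q.1 q.2) + (-2) * (w2 q.1 q.2 * l q.1 q.2)) (ν.prod volume) := k3.add j3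
    rw [← integral_add iw2 j1, ← integral_add k1 il, ← integral_add k2 j2, ← integral_add k3 j3, ← integral_add k4 j4]
    refine integral_congr_ae (ae_of_all _ fun q => ?_)
    ring
  rw [e, b4, b5]
  have := mul_le_mul_of_nonneg_left b1 hL
  linarith
end abs1d
end

open MeasureTheory Metric Set Filter Topology
open scoped RealInnerProductSpace
noncomputable section

lemma contSq {n : ℕ} {f g : EE n → ℝ} (h : ∀ x ≠ 0, ContinuousAt f x) (h' : ∀ x ≠ 0, ContinuousAt g x) :
    ∀ x ≠ 0, ContinuousAt (fun y => f y * g y) x := fun x hx => (h x hx).mul (h' x hx)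

lemma sI_lin {n : ℕ} {f g h : EE n → ℝ} (hf : ∀ x ≠ 0, ContinuousAt f x) (hg : ∀ x ≠ 0, ContinuousAt g x)
    (hh : ∀ x ≠ 0, ContinuousAt h x) (a b : ℝ) :
    sI (fun x => f x + a * g x + b * h x) = sI f + a * sI g + b * sI h := by
  have e1 := sI_add (F := f) (G := fun x => a * g x) hf fun x hx => continuousAt_const.mul (hg x hx)
  have e2 := sI_add (F := fun x => f x + a * g x) (G := fun x => b * h x)
    (fun x hx => (hf x hx).add (continuousAt_const.mul (hg x hx))) fun x hx => continuousAt_const.mul (hh x hx)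
  rw [e2, e1, sI_mul, sI_mul]

lemma DD_expand {n : ℕ} {S S' : Set (EE n)} {ψ θ : EE n → ℝ} (h : TT S ψ) (h' : TT S' θ) (c : ℝ) :
    DD (fun x => ψ x + c * θ x) (fun x => ψ x + c * θ x) = DD ψ ψ + 2 * c * DD ψ θ + c ^ 2 * DD θ θ := by
  unfold DD
  rw [← sI_lin (h.contgip h) (h.contgip h') (h'.contgip h')]
  exact sI_congr fun x hx => gip_add_smul (h.da x hx) (h'.da x hx) c

lemma sq_expand {n : ℕ} {S S' : Set (EE n)} {ψ θ : EE n → ℝ} (h : TT S ψ) (h' : TT S' θ) (c : ℝ) :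
    sI (fun x => (ψ x + c * θ x) ^ 2) = sI (fun x => ψ x ^ 2) + 2 * c * sI (fun x => ψ x * θ x)
      + c ^ 2 * sI (fun x => θ x ^ 2) := by
  have := sI_lin (f := fun x => ψ x ^ 2) (g := fun x => ψ x * θ x) (h := fun x => θ x ^ 2)
    (fun x hx => (h.cont x hx).pow 2) (contSq h.cont h'.cont) (fun x hx => (h'.cont x hx).pow 2) (2 * c) (c ^ 2)
  rw [← this]
  exact sI_congr fun x hx => by ring

lemma pair_expand {n : ℕ} (hn : 1 ≤ n) {S S' : Set (EE n)} {ψ θ : EE n → ℝ} (h : TT S ψ) (h' : TT S' θ) (c : ℝ) :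
    sI (fun x => ψ x * (lap θ x + c * θ x)) = - DD ψ θ + c * sI (fun x => ψ x * θ x) := by
  have := sI_lin (f := fun x => ψ x * lap θ x) (g := fun x => ψ x * θ x) (h := fun x => 0)
    (contSq h.cont h'.contlap) (contSq h.cont h'.cont) (fun x hx => continuousAt_const) c 0
  rw [green' hn h h'] at this
  simp only [zero_mul, add_zero] at this
  rw [← this]
  exact sI_congr fun x hx => by ring

lemma var1 {n : ℕ} (hn : 1 ≤ n) {S : Set (EE n)} {ψ θ : EE n → ℝ} (h : TT S ψ) (h' : TT S θ) (t : ℝ) :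
    2 * t * sI (fun x => ψ x * (lap θ x + lam1 S * θ x)) ≤
      (DD ψ ψ - lam1 S * sI (fun x => ψ x ^ 2)) + t ^ 2 * DD θ θ := by
  have h1 := lam1_le (h.add (h'.smul t))
  rw [DD_expand h h', sq_expand h h'] at h1
  rw [pair_expand hn h h']
  have := mul_nonneg (mul_nonneg (sq_nonneg t) (lam1_nonneg S)) (sI_nonneg (F := fun x => θ x ^ 2) fun x => sq_nonneg _)
  linarith

lemma var2 {n : ℕ} (hn : 1 ≤ n) {S : Set (EE n)} {ψ θ : EE n → ℝ} (h : TT S ψ) (hp : ∀ x, 0 ≤ ψ x)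
    (h' : TT univ θ) (hθ : ∀ x, 0 ≤ θ x) {t : ℝ} (ht : 0 ≤ t) :
    -(2 * t * sI (fun x => ψ x * (lap θ x + lam1 S * θ x))) ≤
      (DD ψ ψ - lam1 S * sI (fun x => ψ x ^ 2)) + t ^ 2 * DD θ θ := by
  have hg : TT univ (fun x => ψ x + (-t) * θ x) := h.mono.add (h'.smul (-t))
  set g := fun x => ψ x + (-t) * θ x with hgd
  have hb : ∀ η > 0, TT S (fun x => bet η (g x)) := by
    intro η hη
    refine ⟨fun r hr x => by simp only [hg.hom r hr x],
      fun x hx => (bet_contDiff η).contDiffAt.comp x (hg.cd x hx), fun x hx hx' => ?_⟩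
    filter_upwards [h.sup x hx hx'] with y hy
    simp only [Pi.zero_apply] at hy ⊢
    apply bet_of_nonpos hη
    simp only [hgd, hy]
    have := mul_nonneg ht (hθ y)
    linarith
  have key : ∀ η > 0, lam1 S * (sI (fun x => g x ^ 2) - t ^ 2 * sI (fun x => θ x ^ 2)) ≤ DD g g +
      lam1 S * (η * sI (fun x => 2 * |g x|) + η ^ 2 * sI (fun _ : EE n => 1)) := by
    intro η hη
    have h1 := lam1_le (hb η hη)
    have h2 : DD (fun x => bet η (g x)) (fun x => bet η (g x)) ≤ DD g g := by
      refine sI_mono ((hb η hη).contgip (hb η hη)) (hg.contgip hg) fun x hx => ?_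
      rw [gip_comp2 ((bet_contDiff η).differentiable (by norm_num) _) (hg.da x hx), bet_deriv_eq]
      have a1 := Real.smoothTransition.nonneg (g x / η)
      have a2 := Real.smoothTransition.le_one (g x / η)
      have := gip_self_nonneg g x
      exact mul_le_of_le_one_left this (by nlinarith)
    have cg : ∀ x ≠ 0, ContinuousAt (fun x => 2 * |g x|) x := fun x hx => continuousAt_const.mul (hg.cont x hx).abs
    have h3 : sI (fun x => g x ^ 2) ≤ sI (fun x => (t ^ 2 * θ x ^ 2 + bet η (g x) ^ 2) + (η * (2 * |g x|) + η ^ 2 * 1)) := by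
      refine sI_mono (fun x hx => (hg.cont x hx).pow 2) (fun x hx => ?_) fun x hx => ?_
      · exact ((continuousAt_const.mul ((h'.cont x hx).pow 2)).add (((hb η hη).cont x hx).pow 2)).add
          ((continuousAt_const.mul (cg x hx)).add continuousAt_const)
      · have b0 := bet_nonneg hη (g x)
        rcases le_total (g x) 0 with h0 | h0
        · have : -(t * θ x) ≤ g x := by simp only [hgd]; linarith [hp x]
          have : g x ^ 2 ≤ (t * θ x) ^ 2 := by
            apply sq_le_sq'
            · linarith
            · linarith [mul_nonneg ht (hθ x)]
          have := abs_nonneg (g x)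
          nlinarith [sq_nonneg (bet η (g x)), mul_nonneg hη.le this, sq_nonneg η]
        · have b1 := bet_ge hη (g x)
          have b2 := bet_le hη h0
          rw [abs_of_nonneg h0]
          have : g x ^ 2 ≤ (bet η (g x) + η) ^ 2 := by
            apply sq_le_sq' <;> linarith
          have := mul_le_mul_of_nonneg_left b2 hη.le
          nlinarith [sq_nonneg (t * θ x)]
    have e1 := sI_lin (f := fun x => t ^ 2 * θ x ^ 2 + bet η (g x) ^ 2) (g := fun x => 2 * |g x|) (h := fun x => 1)
      (fun x hx => (continuousAt_const.mul ((h'.cont x hx).pow 2)).add (((hb η hη).cont x hx).pow 2))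
      cg (fun x hx => continuousAt_const) η (η ^ 2)
    have e2 := sI_add (F := fun x => t ^ 2 * θ x ^ 2) (G := fun x => bet η (g x) ^ 2)
      (fun x hx => (continuousAt_const.mul ((h'.cont x hx).pow 2))) (fun x hx => (((hb η hη).cont x hx).pow 2))
    simp only [← add_assoc] at h3
    rw [e1, e2, sI_mul] at h3
    have h4 := mul_le_mul_of_nonneg_left h3 (lam1_nonneg S)
    linarith
  have lim : lam1 S * (sI (fun x => g x ^ 2) - t ^ 2 * sI (fun x => θ x ^ 2)) ≤ DD g g := by
    have T : Tendsto (fun η : ℝ => DD g g +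
      lam1 S * (η * sI (fun x => 2 * |g x|) + η ^ 2 * sI (fun _ : EE n => 1))) (𝓝[>] 0) (𝓝 (DD g g +
      lam1 S * (0 * sI (fun x => 2 * |g x|) + 0 ^ 2 * sI (fun _ : EE n => 1)))) := by
      refine Tendsto.mono_left (Continuous.tendsto (by fun_prop) 0) nhdsWithin_le_nhds
    have := ge_of_tendsto T (eventually_mem_nhdsWithin.mono fun η hη => key η hη)
    simpa using this
  rw [hgd, DD_expand h h', sq_expand h h'] at lim
  rw [pair_expand hn h h']
  linarith

lemma min_seq {n : ℕ} {S : Set (EE n)} (hS : IsSphDomain S) {ε : ℝ} (hε : 0 < ε) :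
    ∃ ψ, TT S ψ ∧ (∀ x, 0 ≤ ψ x) ∧ sI (fun x => ψ x ^ 2) ≤ 1 ∧ 1 - ε ≤ sI (fun x => ψ x ^ 2) ∧
      DD ψ ψ ≤ lam1 S + ε := by
  obtain ⟨ψ', hψ', hψ1⟩ := TT_exists hS
  have hne : {q | ∃ ψ, TT S ψ ∧ sI (fun x => ψ x ^ 2) = 1 ∧ q = DD ψ ψ}.Nonempty := ⟨_, ψ', hψ', hψ1, rfl⟩
  obtain ⟨q, ⟨ψ, h, h1, rfl⟩, hq⟩ := exists_lt_of_csInf_lt hne (show lam1 S < lam1 S + ε by linarith)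
  set C := sI (fun x => 2 * |ψ x|) + sI (fun _ : EE n => 1) with hC
  have c1 : 0 ≤ sI (fun x => 2 * |ψ x|) := sI_nonneg fun x => by positivity
  have c2 : 0 ≤ sI (fun _ : EE n => 1) := sI_nonneg fun x => zero_le_one
  have hC0 : 0 ≤ C := add_nonneg c1 c2
  obtain ⟨η, hη, hη1, hηC⟩ : ∃ η > 0, η ≤ 1 ∧ η * C ≤ ε := by
    refine ⟨min 1 (ε / (C + 1)), by positivity, min_le_left _ _, ?_⟩
    have : min 1 (ε / (C + 1)) * C ≤ ε / (C + 1) * C := mul_le_mul_of_nonneg_right (min_le_right _ _) hC0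
    refine this.trans ?_
    rw [div_mul_eq_mul_div, div_le_iff₀ (by positivity)]
    nlinarith
  have hs : TT S (fun x => sabs η (ψ x)) := h.comp (sabs_contDiff η) (sabs_zero hη)
  have cg : ∀ x ≠ 0, ContinuousAt (fun x => 2 * |ψ x|) x := fun x hx => continuousAt_const.mul (h.cont x hx).abs
  refine ⟨_, hs, fun x => sabs_nonneg hη _, ?_, ?_, ?_⟩
  · rw [← h1]
    refine sI_mono (fun x hx => (hs.cont x hx).pow 2) (fun x hx => (h.cont x hx).pow 2) fun x hx => ?_
    rw [← sq_abs (ψ x)]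
    exact pow_le_pow_left₀ (sabs_nonneg hη _) (sabs_le hη _) 2
  · have : sI (fun x => ψ x ^ 2) ≤ sI (fun x => sabs η (ψ x) ^ 2 + (η * (2 * |ψ x|) + η * 1)) := by
      refine sI_mono (fun x hx => (h.cont x hx).pow 2) (fun x hx => ((hs.cont x hx).pow 2).add
        ((continuousAt_const.mul (cg x hx)).add continuousAt_const)) fun x hx => ?_
      have a1 := sabs_ge hη (ψ x)
      have a2 := sabs_le hη (ψ x)
      have a3 := sabs_nonneg hη (ψ x)
      rw [← sq_abs (ψ x)]
      have : |ψ x| ^ 2 ≤ (sabs η (ψ x) + η) ^ 2 := pow_le_pow_left₀ (abs_nonneg _) (by linarith) 2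
      have := mul_le_mul_of_nonneg_left a2 hη.le
      nlinarith
    have e1 := sI_lin (f := fun x => sabs η (ψ x) ^ 2) (g := fun x => 2 * |ψ x|) (h := fun x => 1)
      (fun x hx => (hs.cont x hx).pow 2) cg (fun x hx => continuousAt_const) η η
    simp only [← add_assoc] at this
    rw [h1, e1] at this
    rw [hC] at hηC
    linarith
  · refine le_trans ?_ hq.le
    refine sI_mono (hs.contgip hs) (h.contgip h) fun x hx => ?_
    rw [gip_comp2 ((sabs_contDiff η).differentiable (by norm_num) _) (h.da x hx)]
    refine mul_le_of_le_one_left (gip_self_nonneg _ _) ?_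
    rw [← sq_abs]
    exact pow_le_one₀ (abs_nonneg _) (sabs_deriv_le _)
end

open MeasureTheory Metric Set Filter Topology
open scoped RealInnerProductSpace
noncomputable section

def ann (n : ℕ) (a b : ℝ) : Set (EE n) := {x | ‖x‖ ∈ Icc a b}

lemma ann_meas (n : ℕ) (a b : ℝ) : MeasurableSet (ann n a b) :=
  measurableSet_Icc.preimage measurable_norm

lemma ann_compact (n : ℕ) (a b : ℝ) : IsCompact (ann n a b) := by
  refine (isCompact_closedBall (0 : EE n) b).of_isClosed_subset (isClosed_Icc.preimage continuous_norm) ?_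
  intro x hx; simpa using hx.2

lemma ann_int {n : ℕ} {a b : ℝ} (ha : 0 < a) {F : EE n → ℝ} (hF : ∀ x ≠ 0, ContinuousAt F x) :
    IntegrableOn F (ann n a b) := by
  refine ContinuousOn.integrableOn_compact (ann_compact n a b) fun x hx => (hF x ?_).continuousWithinAt
  rintro rfl
  have := hx.1
  simp at this; linarith

def cann (n : ℕ) (a b d : ℝ) : ℝ :=
  ∫ s : ℝ, Real.exp (n * s) * ((Icc a b).indicator 1 (Real.exp s) * (Real.exp s) ^ d)

lemma ann_hom {n : ℕ} (hn : 1 ≤ n) (a b d : ℝ) (F : EE n → ℝ)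
    (hF : ∀ t : ℝ, 0 < t → ∀ x : EE n, ‖x‖ = 1 → F (t • x) = t ^ d * F x) :
    ∫ x in ann n a b, F x = cann n a b d * sI F := by
  have := polar_hom hn ((Icc a b).indicator 1) F d hF
  rw [← integral_indicator (ann_meas n a b)]
  refine Eq.trans ?_ this
  congr 1; funext x
  by_cases h : ‖x‖ ∈ Icc a b
  · rw [indicator_of_mem (show x ∈ ann n a b from h), indicator_of_mem h]; simp
  · rw [indicator_of_notMem (show x ∉ ann n a b from h), indicator_of_notMem h]; simp

lemma cann_nonneg (n : ℕ) (a b d : ℝ) : 0 ≤ cann n a b d := by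
  refine integral_nonneg fun s => ?_
  have : 0 ≤ (Icc a b).indicator (1 : ℝ → ℝ) (Real.exp s) := indicator_nonneg (fun _ _ => zero_le_one) _
  positivity

lemma cann_pos {n : ℕ} (hn : 1 ≤ n) : 0 < cann n 1 2 0 := by
  refine lt_of_le_of_ne (cann_nonneg _ _ _ _) fun h => ?_
  have h1 := ann_hom hn 1 2 0 (fun _ => 1) (by intros; simp)
  rw [← h, zero_mul] at h1
  simp only [integral_const, smul_eq_mul, mul_one] at h1
  have h2 : volume (ann n 1 2) ≠ 0 := by
    have : Nonempty (Fin n) := ⟨⟨0, hn⟩⟩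
    obtain ⟨x, hx⟩ : ∃ x : EE n, ‖x‖ = 3/2 := exists_norm_eq _ (by norm_num)
    have ho : IsOpen {x : EE n | ‖x‖ ∈ Ioo (1:ℝ) 2} := isOpen_Ioo.preimage continuous_norm
    have hxm : x ∈ {x : EE n | ‖x‖ ∈ Ioo (1:ℝ) 2} := by simp [hx]; norm_num
    have := ho.measure_pos volume ⟨x, hxm⟩
    have hsub : {x : EE n | ‖x‖ ∈ Ioo (1:ℝ) 2} ⊆ ann n 1 2 := fun y hy => Ioo_subset_Icc_self hy
    exact (this.trans_le (measure_mono hsub)).ne'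
  simp only [measureReal_def, Measure.restrict_apply MeasurableSet.univ, univ_inter] at h1
  rw [ENNReal.toReal_eq_zero_iff] at h1
  rcases h1 with h1 | h1
  · exact h2 h1
  · exact (ann_compact n 1 2).measure_lt_top.ne h1

lemma gip_measurable {n : ℕ} (ψ : EE n → ℝ) : Measurable (gip ψ ψ) := by
  unfold gip
  refine Finset.measurable_sum _ fun i _ => ?_
  exact (measurable_fderiv_apply_const ℝ ψ _).mul (measurable_fderiv_apply_const ℝ ψ _)

lemma seg_ne {n : ℕ} {x z : EE n} (hx : 1 ≤ ‖x‖) (hz : ‖z‖ ≤ 1/2) {t : ℝ} (ht : t ∈ Icc (0:ℝ) 1) :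
    1/2 ≤ ‖x + t • z‖ ∧ ‖x + t • z‖ ≤ ‖x‖ + 1/2 := by
  have h1 : ‖t • z‖ ≤ 1/2 := by
    rw [norm_smul, Real.norm_eq_abs, abs_of_nonneg ht.1]
    nlinarith [ht.1, ht.2, norm_nonneg z]
  have h2 := norm_add_le x (t • z)
  have h3 := norm_sub_norm_le x (-(t • z))
  rw [norm_neg, sub_neg_eq_add] at h3
  constructor <;> linarith

lemma seg_bound {n : ℕ} {S : Set (EE n)} {ψ : EE n → ℝ} (h : TT S ψ) {x z : EE n} (hx : 1 ≤ ‖x‖)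
    (hz : ‖z‖ ≤ 1/2) :
    ENNReal.ofReal ((ψ (x + z) - ψ x) ^ 2) ≤
      ∫⁻ t in Ioc (0:ℝ) 1, ENNReal.ofReal (‖z‖ ^ 2 * gip ψ ψ (x + t • z)) := by
  have hne : ∀ t ∈ Icc (0:ℝ) 1, x + t • z ≠ 0 := fun t ht h0 => by
    have := (seg_ne hx hz ht).1; rw [h0] at this; norm_num at this
  have hc : ∀ t : ℝ, HasDerivAt (fun t : ℝ => x + t • z) z t := fun t => by
    simpa using ((hasDerivAt_id t).smul_const z).const_add x
  have hd : ∀ t ∈ Icc (0:ℝ) 1, HasDerivAt (fun t : ℝ => ψ (x + t • z)) (fderiv ℝ ψ (x + t • z) z) t := fun t ht =>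
    (h.da _ (hne t ht)).hasFDerivAt.comp_hasDerivAt t (hc t)
  have hcf : ContinuousOn (fun t : ℝ => fderiv ℝ ψ (x + t • z) z) (Icc 0 1) := fun t ht => by
    have h1 := ((h.cd1 _ (hne t ht)).fderiv_right (m := 0) (by norm_num)).continuousAt
    have h2 : ContinuousAt (fun t : ℝ => fderiv ℝ ψ (x + t • z)) t :=
      ContinuousAt.comp (f := fun t : ℝ => x + t • z) h1 (hc t).continuousAt
    exact (h2.clm_apply continuousAt_const).continuousWithinAt
  have hcg : ContinuousOn (fun t : ℝ => ‖z‖ ^ 2 * gip ψ ψ (x + t • z)) (Icc 0 1) := fun t ht => by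
    have h2 : ContinuousAt (fun t : ℝ => gip ψ ψ (x + t • z)) t :=
      ContinuousAt.comp (f := fun t : ℝ => x + t • z) (h.contgip h _ (hne t ht)) (hc t).continuousAt
    exact (continuousAt_const.mul h2).continuousWithinAt
  have hu : uIcc (0:ℝ) 1 = Icc 0 1 := uIcc_of_le zero_le_one
  have hif : IntervalIntegrable (fun t : ℝ => fderiv ℝ ψ (x + t • z) z) volume 0 1 :=
    ContinuousOn.intervalIntegrable (by rwa [hu])
  have hif2 : IntervalIntegrable (fun t : ℝ => (fderiv ℝ ψ (x + t • z) z) ^ 2) volume 0 1 :=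
    ContinuousOn.intervalIntegrable (by rw [hu]; exact hcf.pow 2)
  have hig : IntervalIntegrable (fun t : ℝ => ‖z‖ ^ 2 * gip ψ ψ (x + t • z)) volume 0 1 :=
    ContinuousOn.intervalIntegrable (by rwa [hu])
  have e1 : ∫ t in (0:ℝ)..1, fderiv ℝ ψ (x + t • z) z = ψ (x + z) - ψ x := by
    rw [intervalIntegral.integral_eq_sub_of_hasDerivAt (f := fun t : ℝ => ψ (x + t • z)) (by rwa [hu]) hif]
    simp
  set m := ψ (x + z) - ψ x with hm
  have e2 : m ^ 2 ≤ ∫ t in (0:ℝ)..1, (fderiv ℝ ψ (x + t • z) z) ^ 2 := by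
    have : 0 ≤ ∫ t in (0:ℝ)..1, (fderiv ℝ ψ (x + t • z) z - m) ^ 2 :=
      intervalIntegral.integral_nonneg zero_le_one fun t _ => sq_nonneg _
    have e3 : ∫ t in (0:ℝ)..1, (fderiv ℝ ψ (x + t • z) z - m) ^ 2 =
        (∫ t in (0:ℝ)..1, (fderiv ℝ ψ (x + t • z) z) ^ 2) - 2 * m * (∫ t in (0:ℝ)..1, fderiv ℝ ψ (x + t • z) z)
          + m ^ 2 := by
      rw [← intervalIntegral.integral_const_mul, ← intervalIntegral.integral_sub hif2 (hif.const_mul _)]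
      have : m ^ 2 = ∫ t in (0:ℝ)..1, m ^ 2 := by simp
      rw [this, ← intervalIntegral.integral_add (hif2.sub (hif.const_mul _)) (by simp)]
      refine intervalIntegral.integral_congr fun t _ => ?_
      ring
    rw [e3, e1] at this
    nlinarith
  have e4 : m ^ 2 ≤ ∫ t in (0:ℝ)..1, ‖z‖ ^ 2 * gip ψ ψ (x + t • z) :=
    e2.trans (intervalIntegral.integral_mono_on zero_le_one hif2 hig fun t _ => clm_sq_le ψ _ z)
  rw [intervalIntegral.integral_of_le zero_le_one] at e4
  refine (ENNReal.ofReal_le_ofReal e4).trans ?_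
  rw [ofReal_integral_eq_lintegral_ofReal hig.1]
  exact ae_of_all _ fun t => mul_nonneg (sq_nonneg _) (gip_self_nonneg _ _)

lemma trans_bound {n : ℕ} {S : Set (EE n)} {ψ : EE n → ℝ} (h : TT S ψ) {z : EE n}
    (hz : ‖z‖ ≤ 1/2) :
    ∫⁻ x in ann n 1 2, ENNReal.ofReal ((ψ (x + z) - ψ x) ^ 2) ≤
      ENNReal.ofReal (‖z‖ ^ 2) * ∫⁻ x in ann n (1/2) 3, ENNReal.ofReal (gip ψ ψ x) := by
  have mg := gip_measurable ψ
  calc _ ≤ ∫⁻ x in ann n 1 2, ∫⁻ t in Ioc (0:ℝ) 1, ENNReal.ofReal (‖z‖ ^ 2 * gip ψ ψ (x + t • z)) :=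
        setLIntegral_mono' (ann_meas n 1 2) fun x hx => seg_bound h hx.1 hz
    _ = ∫⁻ t in Ioc (0:ℝ) 1, ∫⁻ x in ann n 1 2, ENNReal.ofReal (‖z‖ ^ 2 * gip ψ ψ (x + t • z)) := by
        rw [lintegral_lintegral_swap]
        have : Measurable (fun q : EE n × ℝ => q.1 + q.2 • z) := by fun_prop
        exact (measurable_const.mul (mg.comp this)).ennreal_ofReal.aemeasurable
    _ ≤ ∫⁻ t in Ioc (0:ℝ) 1, ENNReal.ofReal (‖z‖ ^ 2) * ∫⁻ x in ann n (1/2) 3, ENNReal.ofReal (gip ψ ψ x) := by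
        refine setLIntegral_mono' measurableSet_Ioc fun t ht => ?_
        simp only [ENNReal.ofReal_mul (sq_nonneg _)]
        rw [lintegral_const_mul' _ _ ENNReal.ofReal_ne_top]
        refine mul_le_mul' le_rfl ?_
        rw [← lintegral_indicator (ann_meas _ _ _), ← lintegral_indicator (ann_meas _ _ _),
          ← lintegral_add_right_eq_self ((ann n (1/2) 3).indicator _) (t • z)]
        refine lintegral_mono fun x => ?_
        by_cases hx : x ∈ ann n 1 2
        · have := seg_ne hx.1 hz (Ioc_subset_Icc_self ht)
          have h2 : x + t • z ∈ ann n (1/2) 3 := ⟨this.1, this.2.trans (by linarith [hx.2])⟩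
          rw [indicator_of_mem hx, indicator_of_mem h2]
        · rw [indicator_of_notMem hx]; exact zero_le
    _ = _ := by simp

lemma nash_len {n : ℕ} {S : Set (EE n)} {ψ : EE n → ℝ} (h : TT S ψ) (hp : ∀ x, 0 ≤ ψ x) {δ : ℝ}
    (hδ : 0 < δ) (hδ1 : δ ≤ 1/2) :
    volume (ball (0 : EE n) δ) * ∫⁻ x in ann n 1 2, ENNReal.ofReal (ψ x ^ 2) ≤
      volume (ball (0 : EE n) δ) * (ENNReal.ofReal (δ ^ 2) * ∫⁻ x in ann n (1/2) 3, ENNReal.ofReal (gip ψ ψ x))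
      + 2 * (∫⁻ x in ann n (1/2) 3, ENNReal.ofReal (ψ x)) ^ 2 := by
  have mψ : Measurable ψ := measurable_of_continuousOn_compl_singleton 0
    fun x hx => (h.cont x hx).continuousWithinAt
  have hm : Measurable (fun q : EE n × EE n => ENNReal.ofReal (ψ q.1) * ENNReal.ofReal (ψ (q.1 + q.2))) :=
    (mψ.comp measurable_fst).ennreal_ofReal.mul
      (mψ.comp (measurable_fst.add measurable_snd)).ennreal_ofReal
  have hz : ∀ z ∈ ball (0 : EE n) δ, ∫⁻ x in ann n 1 2, ENNReal.ofReal (ψ x ^ 2) ≤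
      ENNReal.ofReal (δ ^ 2) * (∫⁻ x in ann n (1/2) 3, ENNReal.ofReal (gip ψ ψ x))
      + 2 * ∫⁻ x in ann n 1 2, ENNReal.ofReal (ψ x) * ENNReal.ofReal (ψ (x + z)) := by
    intro z hz
    have hz' : ‖z‖ ≤ δ := by simpa using (mem_ball.1 hz).le
    calc _ ≤ ∫⁻ x in ann n 1 2, (ENNReal.ofReal ((ψ (x + z) - ψ x) ^ 2)
          + 2 * (ENNReal.ofReal (ψ x) * ENNReal.ofReal (ψ (x + z)))) := by
          refine lintegral_mono fun x => ?_
          have h2 : ∀ a : ℝ, (2 : ENNReal) * ENNReal.ofReal a = ENNReal.ofReal (2 * a) := fun a => by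
            rw [ENNReal.ofReal_mul zero_le_two]; simp
          rw [← ENNReal.ofReal_mul (hp x), h2,
            ← ENNReal.ofReal_add (sq_nonneg _) (by have := mul_nonneg (hp x) (hp (x+z)); linarith)]
          refine ENNReal.ofReal_le_ofReal ?_
          nlinarith [sq_nonneg (ψ (x + z))]
      _ = (∫⁻ x in ann n 1 2, ENNReal.ofReal ((ψ (x + z) - ψ x) ^ 2)) +
          2 * ∫⁻ x in ann n 1 2, ENNReal.ofReal (ψ x) * ENNReal.ofReal (ψ (x + z)) := by
          rw [lintegral_add_left, lintegral_const_mul' _ _ (by norm_num)]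
          exact (((mψ.comp (measurable_id.add_const z)).sub mψ).pow_const 2).ennreal_ofReal
      _ ≤ _ := by
          gcongr
          refine (trans_bound h (hz'.trans hδ1)).trans ?_
          gcongr
  calc _ = ∫⁻ z in ball (0 : EE n) δ, ∫⁻ x in ann n 1 2, ENNReal.ofReal (ψ x ^ 2) := by
        simp [mul_comm]
    _ ≤ ∫⁻ z in ball (0 : EE n) δ, (ENNReal.ofReal (δ ^ 2) * (∫⁻ x in ann n (1/2) 3, ENNReal.ofReal (gip ψ ψ x))
      + 2 * ∫⁻ x in ann n 1 2, ENNReal.ofReal (ψ x) * ENNReal.ofReal (ψ (x + z))) :=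
        setLIntegral_mono' measurableSet_ball hz
    _ = volume (ball (0 : EE n) δ) * (ENNReal.ofReal (δ ^ 2) * ∫⁻ x in ann n (1/2) 3, ENNReal.ofReal (gip ψ ψ x))
      + 2 * ∫⁻ z in ball (0 : EE n) δ, ∫⁻ x in ann n 1 2, ENNReal.ofReal (ψ x) * ENNReal.ofReal (ψ (x + z)) := by
        rw [lintegral_add_left measurable_const, lintegral_const_mul' 2 _ (by norm_num), setLIntegral_const,
          mul_comm (volume _)]
    _ ≤ _ := by
        refine add_le_add le_rfl (mul_le_mul' le_rfl ?_)
        rw [lintegral_lintegral_swap (f := fun z x => ENNReal.ofReal (ψ x) * ENNReal.ofReal (ψ (x + z)))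
          (hm.comp measurable_swap).aemeasurable, pow_two]
        calc _ ≤ ∫⁻ x in ann n 1 2, ENNReal.ofReal (ψ x) * ∫⁻ x in ann n (1/2) 3, ENNReal.ofReal (ψ x) := by
              refine setLIntegral_mono' (ann_meas _ _ _) fun x hx => ?_
              rw [lintegral_const_mul' _ _ ENNReal.ofReal_ne_top]
              refine mul_le_mul' le_rfl ?_
              rw [← lintegral_indicator (ann_meas _ _ _), ← lintegral_indicator measurableSet_ball,
                ← lintegral_add_left_eq_self ((ann n (1/2) 3).indicator _) x]
              refine lintegral_mono fun z => ?_
              by_cases hzb : z ∈ ball (0 : EE n) δ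
              · have hz' : ‖z‖ ≤ δ := by simpa using (mem_ball.1 hzb).le
                have := seg_ne hx.1 (hz'.trans hδ1) (t := 1) (by simp)
                rw [one_smul] at this
                have h2 : x + z ∈ ann n (1/2) 3 := ⟨this.1, this.2.trans (by linarith [hx.2])⟩
                rw [indicator_of_mem hzb, indicator_of_mem h2]
              · rw [indicator_of_notMem hzb]; exact zero_le
          _ ≤ ∫⁻ x in ann n (1/2) 3, ENNReal.ofReal (ψ x) * ∫⁻ x in ann n (1/2) 3, ENNReal.ofReal (ψ x) := by
              refine lintegral_mono_set fun x hx => ⟨?_, ?_⟩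
              · linarith [hx.1]
              · linarith [hx.2]
          _ = _ := by
              rw [lintegral_mul_const _ mψ.ennreal_ofReal]

lemma nash {n : ℕ} (hn : 1 ≤ n) (Λ : ℝ) : ∃ c > 0, ∀ (S : Set (EE n)) (ψ : EE n → ℝ), TT S ψ → (∀ x, 0 ≤ ψ x) →
    DD ψ ψ ≤ Λ → 1/2 ≤ sI (fun x => ψ x ^ 2) → c ≤ sI ψ := by
  set cA := cann n 1 2 0
  set cG := cann n (1/2) 3 (-2)
  set cP := cann n (1/2) 3 0
  have hA : 0 < cA := cann_pos hn
  have hG : 0 ≤ cG := cann_nonneg _ _ _ _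
  have hP : 0 ≤ cP := cann_nonneg _ _ _ _
  obtain ⟨δ, hδ, hδ1, hδ2⟩ : ∃ δ > 0, δ ≤ 1/2 ∧ δ ^ 2 * (cG * |Λ|) ≤ cA / 4 := by
    have : Tendsto (fun δ : ℝ => δ ^ 2 * (cG * |Λ|)) (𝓝[>] 0) (𝓝 (0 ^ 2 * (cG * |Λ|))) :=
      (Continuous.tendsto (by fun_prop) 0).mono_left nhdsWithin_le_nhds
    have h1 := this.eventually (eventually_le_nhds (b := cA / 4) (by simp; positivity))
    have h2 : ∀ᶠ δ : ℝ in 𝓝[>] 0, δ ≤ 1/2 := nhdsWithin_le_nhds (Iic_mem_nhds (by norm_num))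
    obtain ⟨δ, h⟩ := (h1.and (h2.and eventually_mem_nhdsWithin)).exists
    exact ⟨δ, h.2.2, h.2.1, h.1⟩
  set V := volume.real (ball (0 : EE n) δ) with hV
  have hVt : volume (ball (0 : EE n) δ) ≠ ⊤ := measure_ball_lt_top.ne
  have hV0 : 0 < V := ENNReal.toReal_pos (measure_ball_pos volume _ hδ).ne' hVt
  refine ⟨√(V * cA / 8) / (cP + 1), by positivity, fun S ψ h hp hD h1 => ?_⟩
  have hs0 : 0 ≤ sI ψ := sI_nonneg hp
  have key := nash_len h hp hδ hδ1
  have e1 : ∫⁻ x in ann n 1 2, ENNReal.ofReal (ψ x ^ 2) = ENNReal.ofReal (cA * sI (fun x => ψ x ^ 2)) := by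
    rw [← ann_hom hn 1 2 0 (fun x => ψ x ^ 2) (fun t ht x _ => by rw [h.hom t ht]; simp),
      ofReal_integral_eq_lintegral_ofReal (f := fun x => ψ x ^ 2) (ann_int one_pos fun x hx => (h.cont x hx).pow 2)
        (ae_of_all _ fun x => sq_nonneg _)]
  have e2 : ∫⁻ x in ann n (1/2) 3, ENNReal.ofReal (gip ψ ψ x) = ENNReal.ofReal (cG * DD ψ ψ) := by
    unfold DD
    rw [← ann_hom hn (1/2) 3 (-2) (gip ψ ψ) (fun t ht x _ => by
        rw [h.hom.gip h.hom ht, Real.rpow_neg ht.le]; norm_num),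
      ofReal_integral_eq_lintegral_ofReal (ann_int (by norm_num) (h.contgip h))
        (ae_of_all _ fun x => gip_self_nonneg _ _)]
  have e3 : ∫⁻ x in ann n (1/2) 3, ENNReal.ofReal (ψ x) = ENNReal.ofReal (cP * sI ψ) := by
    rw [← ann_hom hn (1/2) 3 0 ψ (fun t ht x _ => by rw [h.hom t ht]; simp),
      ofReal_integral_eq_lintegral_ofReal (ann_int (by norm_num) h.cont) (ae_of_all _ hp)]
  have hDn := DD_nonneg ψ
  have h2 : ∀ a : ℝ, (2 : ENNReal) * ENNReal.ofReal a = ENNReal.ofReal (2 * a) := fun a => by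
    rw [ENNReal.ofReal_mul zero_le_two]; simp
  rw [e1, e2, e3, ← ENNReal.ofReal_toReal hVt, ← ENNReal.ofReal_pow (by positivity),
    ← ENNReal.ofReal_mul (by positivity), ← ENNReal.ofReal_mul (by positivity), ← ENNReal.ofReal_mul (by positivity),
    h2, ← ENNReal.ofReal_add (by positivity) (by positivity),
    ENNReal.ofReal_le_ofReal_iff (by positivity)] at key
  change V * _ ≤ V * _ + _ at key
  have k1 : δ ^ 2 * (cG * DD ψ ψ) ≤ cA / 4 := by
    refine le_trans ?_ hδ2
    gcongr
    exact hD.trans (le_abs_self _)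
  have k2 : V * (cA * (1/2)) ≤ V * (cA / 4) + 2 * (cP * sI ψ) ^ 2 := by
    calc _ ≤ _ := by gcongr
      _ ≤ _ := key
      _ ≤ _ := by gcongr
  have k3 : V * cA / 8 ≤ ((cP + 1) * sI ψ) ^ 2 := by
    have : (cP * sI ψ) ^ 2 ≤ ((cP + 1) * sI ψ) ^ 2 := by gcongr; linarith
    linarith
  rw [div_le_iff₀ (by positivity)]
  refine (Real.sqrt_le_sqrt k3).trans ?_
  rw [Real.sqrt_sq (by positivity), mul_comm]
end

open MeasureTheory Metric Set Filter Topology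
open scoped RealInnerProductSpace
noncomputable section

lemma weak_seq {H : Type*} [NormedAddCommGroup H] [InnerProductSpace ℝ H] [CompleteSpace H]
    (f : ℕ → H) (hf : ∀ k, ‖f k‖ ≤ 1) : ∃ (a : H) (F : Ultrafilter ℕ), (F : Filter ℕ) ≤ atTop ∧
      ∀ g, Tendsto (fun k => inner ℝ (f k) g) F (𝓝 (inner ℝ a g)) := by
  let F : Ultrafilter ℕ := hyperfilter ℕ
  have hF : (F : Filter ℕ) ≤ atTop := Nat.hyperfilter_le_atTop
  let d : ℕ → WeakDual ℝ H := fun k => StrongDual.toWeakDual (InnerProductSpace.toDual ℝ H (f k))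
  have hK := WeakDual.isCompact_closedBall (𝕜 := ℝ) (E := H) 0 1
  obtain ⟨L, hL, hLt⟩ := hK.ultrafilter_le_nhds (F.map d) (by
    rw [le_principal_iff]
    refine Filter.mem_map.2 (Filter.univ_mem' fun k => ?_)
    simp only [mem_preimage, mem_closedBall, d, dist_zero_right]
    simpa using hf k)
  refine ⟨(InnerProductSpace.toDual ℝ H).symm (WeakDual.toStrongDual L), F, hF, fun g => ?_⟩
  have h1 : Tendsto (fun k => d k g) F (𝓝 (L g)) :=
    ((WeakDual.eval_continuous g).tendsto L).comp hLt
  have h2 : inner ℝ ((InnerProductSpace.toDual ℝ H).symm (WeakDual.toStrongDual L)) g = L g := by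
    rw [InnerProductSpace.toDual_symm_apply]; rfl
  rw [h2]
  refine h1.congr fun k => ?_
  simp [d]

lemma weak_lim {n : ℕ} (hn : 1 ≤ n) {S : Set (EE n)} (hS : IsSphDomain S) :
    ∃ u : Sph n → ℝ, Measurable u ∧ Integrable u (sg n) ∧ (∀ p, 0 ≤ u p) ∧ (∀ p : Sph n, (p : EE n) ∉ S → u p = 0) ∧
      0 < ∫ p, u p ∂(sg n) ∧
      (∀ θ : EE n → ℝ, TT S θ → ∫ p, u p * (lap θ p + lam1 S * θ p) ∂(sg n) = 0) ∧
      (∀ θ : EE n → ℝ, TT univ θ → (∀ x, 0 ≤ θ x) → 0 ≤ ∫ p, u p * (lap θ p + lam1 S * θ p) ∂(sg n)) := by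
  have hε : ∀ k, 0 < et k / 2 := fun k => by have := et_pos k; linarith
  choose ψ hψ hp h1 h2 h3 using fun k => min_seq hS (hε k)
  have hc : ∀ {θ : EE n → ℝ}, (∀ x ≠ 0, ContinuousAt θ x) → MemLp (fun p : Sph n => θ p) 2 (sg n) := by
    intro θ hθ
    have := (contSph hθ)
    exact this.memLp_of_hasCompactSupport (HasCompactSupport.of_compactSpace _)
  have hm : ∀ k, MemLp (fun p : Sph n => ψ k p) 2 (sg n) := fun k => hc (hψ k).cont
  obtain ⟨a, F, hF, ha⟩ := weak_seq (fun k => (hm k).toLp) (fun k => by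
    rw [← sq_le_one_iff₀ (norm_nonneg _), ← real_inner_self_eq_norm_sq, L2.inner_def]
    refine le_trans (le_of_eq ?_) (h1 k)
    unfold sI
    refine integral_congr_ae ?_
    filter_upwards [(hm k).coeFn_toLp] with p hp
    simp [hp, sq])
  have hlim : ∀ g : Sph n → ℝ, MemLp g 2 (sg n) →
      Tendsto (fun k => ∫ p : Sph n, ψ k p * g p ∂(sg n)) F (𝓝 (∫ p, a p * g p ∂(sg n))) := by
    intro g hg
    have := ha hg.toLp
    simp only [L2.inner_def] at this
    refine (this.congr fun k => ?_).trans_eq ?_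
    · refine integral_congr_ae ?_
      filter_upwards [(hm k).coeFn_toLp, hg.coeFn_toLp] with p h h'
      simp [h, h', mul_comm]
    · congr 1
      refine integral_congr_ae ?_
      filter_upwards [hg.coeFn_toLp] with p h'
      simp [h', mul_comm]
  have hai : Integrable a (sg n) := (Lp.memLp a).integrable (by norm_num)
  have hind : ∀ s : Set (Sph n), MeasurableSet s →
      Tendsto (fun k => ∫ p in s, ψ k p ∂(sg n)) F (𝓝 (∫ p in s, a p ∂(sg n))) := by
    intro s hs
    have := hlim (s.indicator fun _ => 1) ((memLp_const (1:ℝ)).indicator hs)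
    have e : ∀ f : Sph n → ℝ, ∫ p, f p * s.indicator (fun _ => (1:ℝ)) p ∂(sg n) = ∫ p in s, f p ∂(sg n) := by
      intro f
      rw [← integral_indicator hs]
      congr 1; ext p
      by_cases h : p ∈ s <;> simp [h]
    simpa only [e] using this
  have a0 : 0 ≤ᵐ[sg n] a := by
    refine ae_nonneg_of_forall_setIntegral_nonneg hai fun s hs _ => ?_
    exact ge_of_tendsto' (hind s hs) fun k => setIntegral_nonneg hs fun p _ => hp k p
  have mA : MeasurableSet {p : Sph n | (p : EE n) ∈ S} := hS.2.1.measurableSet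
  have a1 : ∀ᵐ p : Sph n ∂(sg n), (p : EE n) ∉ S → a p = 0 := by
    have h0 : ∀ k (p : Sph n), (p : EE n) ∉ S → ψ k p = 0 := by
      intro k p hp'
      refine ((hψ k).sup p (sph_ne p) ?_).self_of_nhds
      rwa [mem_cone_sph (by simp)]
    have : 0 ≤ᵐ[sg n] {p : Sph n | (p : EE n) ∈ S}ᶜ.indicator (fun p => -a p) := by
      refine ae_nonneg_of_forall_setIntegral_nonneg (hai.neg.indicator mA.compl) fun s hs _ => ?_
      rw [setIntegral_indicator mA.compl, integral_neg]
      have := hind _ (hs.inter mA.compl)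
      have e : ∀ k, ∫ p in s ∩ {p : Sph n | (p : EE n) ∈ S}ᶜ, ψ k p ∂(sg n) = 0 := by
        intro k
        exact setIntegral_eq_zero_of_forall_eq_zero fun p hp => h0 k p hp.2
      simp only [e] at this
      rw [← tendsto_nhds_unique tendsto_const_nhds this]; simp
    filter_upwards [this, a0] with p h h' hpS
    rw [indicator_of_mem (by exact hpS)] at h
    simp only [Pi.zero_apply] at h h'
    linarith
  let u : Sph n → ℝ := {p : Sph n | (p : EE n) ∈ S ∧ 0 ≤ a p}.indicator a
  have mu' : MeasurableSet {p : Sph n | (p : EE n) ∈ S ∧ 0 ≤ a p} :=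
    mA.inter (measurableSet_le measurable_const (Lp.stronglyMeasurable a).measurable)
  have hu : u =ᵐ[sg n] a := by
    filter_upwards [a0, a1] with p h h'
    by_cases hpS : (p : EE n) ∈ S
    · exact indicator_of_mem (s := {p : Sph n | (p : EE n) ∈ S ∧ 0 ≤ a p}) ⟨hpS, h⟩ _
    · rw [h' hpS]
      exact indicator_of_notMem (s := {p : Sph n | (p : EE n) ∈ S ∧ 0 ≤ a p}) (fun h => hpS h.1) _
  have hug : ∀ g : Sph n → ℝ, ∫ p, u p * g p ∂(sg n) = ∫ p, a p * g p ∂(sg n) := fun g =>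
    integral_congr_ae (by filter_upwards [hu] with p h; rw [h])
  have hres : Tendsto (fun k => DD (ψ k) (ψ k) - lam1 S * sI (fun x => ψ k x ^ 2)) F (𝓝 0) := by
    have h0 : Tendsto (fun k => (1 + lam1 S) * (et k / 2)) F (𝓝 0) := by
      have := (((et_tendsto).div_const 2).const_mul (1 + lam1 S)).mono_left hF
      simpa using this
    refine squeeze_zero (fun k => ?_) (fun k => ?_) h0
    · linarith [lam1_le (hψ k)]
    · nlinarith [h3 k, h2 k, lam1_nonneg S]
  have hel : ∀ θ : EE n → ℝ, TT univ θ → MemLp (fun p : Sph n => lap θ p + lam1 S * θ p) 2 (sg n) := by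
    intro θ hθ
    refine hc (θ := fun x => lap θ x + lam1 S * θ x) fun x hx => ?_
    exact (hθ.contlap x hx).add ((hθ.cont x hx).const_mul _)
  refine ⟨u, (Lp.stronglyMeasurable a).measurable.indicator mu', hai.indicator mu', ?_, ?_, ?_, ?_, ?_⟩
  · intro p; exact indicator_nonneg (fun p hp => hp.2) p
  · intro p hp; exact indicator_of_notMem (s := {p : Sph n | (p : EE n) ∈ S ∧ 0 ≤ a p}) (fun h => hp h.1) _
  · obtain ⟨c, hc0, hcc⟩ := nash hn (lam1 S + 1)
    rw [integral_congr_ae hu]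
    have := hind univ MeasurableSet.univ
    simp only [Measure.restrict_univ] at this
    refine hc0.trans_le (ge_of_tendsto' this fun k => ?_)
    have e1 : et k ≤ 1 := by
      unfold et
      rw [div_le_one (by positivity)]
      have := Nat.cast_nonneg (α := ℝ) k
      linarith
    exact hcc S (ψ k) (hψ k) (hp k) (by linarith [h3 k]) (by linarith [h2 k])
  · intro θ hθ
    rw [hug]
    set I := ∫ p : Sph n, a p * (lap θ p + lam1 S * θ p) ∂(sg n) with hI
    have hl := hlim _ (hel θ hθ.mono)
    have key : ∀ t : ℝ, 2 * t * I ≤ t ^ 2 * DD θ θ := by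
      intro t
      have := le_of_tendsto_of_tendsto' (hl.const_mul (2 * t)) (hres.add_const (t ^ 2 * DD θ θ))
        fun k => var1 hn (hψ k) hθ t
      simpa using this
    have hD := DD_nonneg θ
    have k1 := key (I / (DD θ θ + 1))
    have hd : 0 < DD θ θ + 1 := by linarith
    have : 2 * (I / (DD θ θ + 1)) * I - (I / (DD θ θ + 1)) ^ 2 * DD θ θ =
      (I / (DD θ θ + 1)) ^ 2 * (DD θ θ + 2) := by field_simp; ring
    have h5 : (I / (DD θ θ + 1)) ^ 2 * (DD θ θ + 2) ≤ 0 := by linarith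
    have h6 : (I / (DD θ θ + 1)) ^ 2 ≤ 0 := by
      by_contra hh
      push Not at hh
      have := mul_pos hh (show 0 < DD θ θ + 2 by linarith)
      linarith
    have h7 : I / (DD θ θ + 1) = 0 := by
      have := le_antisymm h6 (sq_nonneg _)
      exact pow_eq_zero_iff (two_ne_zero) |>.1 this
    rcases div_eq_zero_iff.1 h7 with h | h
    · exact h
    · linarith
  · intro θ hθ hθp
    rw [hug]
    set I := ∫ p : Sph n, a p * (lap θ p + lam1 S * θ p) ∂(sg n) with hI
    have hl := hlim _ (hel θ hθ)
    have key : ∀ t : ℝ, 0 ≤ t → -(2 * t * I) ≤ t ^ 2 * DD θ θ := by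
      intro t ht
      have := le_of_tendsto_of_tendsto' (hl.const_mul (2 * t)).neg (hres.add_const (t ^ 2 * DD θ θ))
        fun k => var2 hn (hψ k) (hp k) hθ hθp ht
      simpa using this
    have hD := DD_nonneg θ
    by_contra hneg
    push Not at hneg
    have hd : 0 < DD θ θ + 1 := by linarith
    have k1 := key (-I / (DD θ θ + 1)) (div_nonneg (by linarith) hd.le)
    have : -(2 * (-I / (DD θ θ + 1)) * I) - (-I / (DD θ θ + 1)) ^ 2 * DD θ θ =
      (I / (DD θ θ + 1)) ^ 2 * (DD θ θ + 2) := by field_simp; ring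
    have h6 : 0 < (I / (DD θ θ + 1)) ^ 2 * (DD θ θ + 2) := by
      have : I / (DD θ θ + 1) ≠ 0 := div_ne_zero hneg.ne hd.ne'
      positivity
    linarith
end

open MeasureTheory Metric Set Filter Topology
open scoped RealInnerProductSpace
noncomputable section

/-- the homogeneous extension of degree `k` of a function on the sphere -/
def vv (n : ℕ) (k : ℝ) (u : Sph n → ℝ) : EE n → ℝ :=
  Function.extend (polPhi n 1) (fun q => Real.exp (k * q.2) * u q.1) 0

lemma vv_polar {n : ℕ} (k : ℝ) (u : Sph n → ℝ) (p : Sph n) (t : ℝ) :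
    vv n k u (Real.exp t • (p : EE n)) = Real.exp (k * t) * u p := by
  have := (polPhi_emb n 1 one_ne_zero).injective.extend_apply (fun q => Real.exp (k * q.2) * u q.1) 0 (p, t)
  simpa [vv, polPhi] using this

lemma vv_zero {n : ℕ} (k : ℝ) (u : Sph n → ℝ) : vv n k u 0 = 0 := by
  unfold vv
  rw [Function.extend_apply']
  · rfl
  · rintro ⟨q, hq⟩
    have := polPhi_norm 1 q
    rw [hq, norm_zero] at this
    exact (Real.exp_pos _).ne this

lemma polar_rep {n : ℕ} {x : EE n} (hx : x ≠ 0) : ∃ (p : Sph n) (t : ℝ), x = Real.exp t • (p : EE n) := by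
  have h : 0 < ‖x‖ := norm_pos_iff.2 hx
  refine ⟨⟨‖x‖⁻¹ • x, ?_⟩, Real.log ‖x‖, ?_⟩
  · simp [norm_smul, h.ne']
  · rw [Real.exp_log h, smul_smul, mul_inv_cancel₀ h.ne', one_smul]

lemma vv_hom {n : ℕ} (k : ℝ) (u : Sph n → ℝ) {t : ℝ} (ht : 0 < t) (x : EE n) :
    vv n k u (t • x) = t ^ k * vv n k u x := by
  by_cases hx : x = 0
  · simp [hx, vv_zero]
  · obtain ⟨p, s, rfl⟩ := polar_rep hx
    rw [vv_polar]
    have : t • Real.exp s • (p : EE n) = Real.exp (Real.log t + s) • (p : EE n) := by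
      rw [Real.exp_add, Real.exp_log ht, smul_smul]
    rw [this, vv_polar, Real.rpow_def_of_pos ht, ← mul_assoc, ← Real.exp_add]
    congr 2; ring

lemma vv_measurable {n : ℕ} (k : ℝ) {u : Sph n → ℝ} (hu : Measurable u) : Measurable (vv n k u) := by
  refine (polPhi_emb n 1 one_ne_zero).measurable_extend ?_ measurable_const
  exact (Real.measurable_exp.comp (measurable_snd.const_mul k)).mul (hu.comp measurable_fst)

lemma vv_nonneg {n : ℕ} (k : ℝ) {u : Sph n → ℝ} (hu : ∀ p, 0 ≤ u p) (x : EE n) : 0 ≤ vv n k u x := by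
  by_cases hx : x = 0
  · simp [hx, vv_zero]
  · obtain ⟨p, s, rfl⟩ := polar_rep hx
    rw [vv_polar]
    exact mul_nonneg (Real.exp_pos _).le (hu p)

lemma vv_off {n : ℕ} (k : ℝ) {u : Sph n → ℝ} {S : Set (EE n)} (hu : ∀ p : Sph n, (p : EE n) ∉ S → u p = 0)
    {x : EE n} (hx : x ∉ coneOf S) : vv n k u x = 0 := by
  by_cases hx0 : x = 0
  · simp [hx0, vv_zero]
  · obtain ⟨p, s, rfl⟩ := polar_rep hx0
    rw [vv_polar, hu p, mul_zero]
    rwa [cone_smul (Real.exp_pos _), mem_cone_sph (by simp)] at hx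

lemma vv_int_ball {n : ℕ} (hn : 1 ≤ n) {k : ℝ} (hk : 0 ≤ k) {u : Sph n → ℝ} (hu : Integrable u (sg n)) {R : ℝ} (hR : 0 < R) :
    IntegrableOn (vv n k u) (closedBall 0 R) := by
  rw [← integrable_indicator_iff measurableSet_closedBall, polar_integrable hn (Or.inl rfl)]
  have h1 : Integrable ((Iic (Real.log R)).indicator fun t => Real.exp ((n + k) * t)) := by
    rw [integrable_indicator_iff measurableSet_Iic]
    have hpos : (0:ℝ) < n + k := by
      have : (1:ℝ) ≤ n := by exact_mod_cast hn
      linarith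
    exact integrableOn_exp_mul_Iic hpos _
  refine (hu.mul_prod h1).congr (ae_of_all _ fun q => ?_)
  have hq : Real.exp (1 * q.2) • (q.1 : EE n) ∈ closedBall 0 R ↔ q.2 ∈ Iic (Real.log R) := by
    simp [norm_smul, Real.le_log_iff_exp_le hR]
  by_cases h : q.2 ∈ Iic (Real.log R)
  · simp only
    rw [indicator_of_mem h, indicator_of_mem (hq.2 h), one_mul, vv_polar, add_mul, Real.exp_add]; ring
  · simp only
    rw [indicator_of_notMem h, indicator_of_notMem (fun h' => h (hq.1 h'))]; simp

lemma vv_locInt {n : ℕ} (hn : 1 ≤ n) {k : ℝ} (hk : 0 ≤ k) {u : Sph n → ℝ} (hu : Integrable u (sg n)) :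
    LocallyIntegrable (vv n k u) := by
  intro x
  refine ⟨closedBall 0 (‖x‖ + 1), ?_, vv_int_ball hn hk hu (by positivity)⟩
  refine Filter.mem_of_superset (isOpen_ball.mem_nhds (show x ∈ ball 0 (‖x‖ + 1) by simp)) ball_subset_closedBall

lemma int_uG {n : ℕ} {u : Sph n → ℝ} (hu : Integrable u (sg n)) {G : Sph n × ℝ → ℝ} (hG : Continuous G) {A : ℝ}
    (hA : ∀ p t, A < |t| → G (p, t) = 0) : Integrable (fun q => u q.1 * G q) ((sg n).prod volume) := by
  have hK : IsCompact ((univ : Set (Sph n)) ×ˢ Icc (-A) A) := isCompact_univ.prod isCompact_Icc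
  obtain ⟨M, hM⟩ := hK.exists_bound_of_continuousOn hG.continuousOn
  have h1 : Integrable ((Icc (-A) A).indicator fun _ => M) :=
    (integrable_indicator_iff measurableSet_Icc).2 (by simp)
  refine (hu.mul_prod h1).mono ((hu.aestronglyMeasurable.comp_fst).mul hG.aestronglyMeasurable)
    (ae_of_all _ fun q => ?_)
  rw [norm_mul, norm_mul]
  refine mul_le_mul_of_nonneg_left ?_ (norm_nonneg _)
  by_cases h : q.2 ∈ Icc (-A) A
  · rw [indicator_of_mem h]
    exact (hM q ⟨mem_univ _, h⟩).trans (le_abs_self M)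
  · rw [hA q.1 q.2]
    · simp
    · by_contra hh
      push Not at hh
      exact h (abs_le.1 hh)

lemma sup_log {n : ℕ} {θ : EE n → ℝ} (hc : HasCompactSupport θ) (h0 : θ =ᶠ[𝓝 0] 0) :
    ∃ A : ℝ, ∀ (p : Sph n) (t : ℝ), A < |t| → θ =ᶠ[𝓝 (Real.exp t • (p : EE n))] 0 := by
  have h0' : (0 : EE n) ∉ tsupport θ := by rwa [notMem_tsupport_iff_eventuallyEq]
  obtain ⟨a, ha, hsub⟩ := Metric.isOpen_iff.1 (isClosed_tsupport θ).isOpen_compl 0 h0'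
  obtain ⟨b, hb⟩ := hc.isBounded.exists_norm_le
  refine ⟨max (-Real.log a) (Real.log (max b 1)), fun p t ht => ?_⟩
  rw [← notMem_tsupport_iff_eventuallyEq]
  intro hmem
  have hnorm : ‖Real.exp t • (p : EE n)‖ = Real.exp t := by simp [norm_smul]
  rcases lt_abs.1 ht with h | h
  · have := hb _ hmem
    rw [hnorm] at this
    have h2 : Real.log (max b 1) < t := (le_max_right _ _).trans_lt h
    rw [Real.log_lt_iff_lt_exp (by positivity)] at h2
    have := le_max_left b 1
    linarith
  · have h2 : -Real.log a < -t := (le_max_left _ _).trans_lt h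
    have h3 : t < Real.log a := by linarith
    rw [Real.lt_log_iff_exp_lt ha] at h3
    refine hsub (a := Real.exp t • (p : EE n)) ?_ hmem
    rw [mem_ball_zero_iff, hnorm]; exact h3

lemma flat {n : ℕ} (hn : 1 ≤ n) {k : ℝ} {u : Sph n → ℝ} (hu : Integrable u (sg n))
    {θ : EE n → ℝ} (hθ : ContDiff ℝ 2 θ) (hc : HasCompactSupport θ) (h0 : θ =ᶠ[𝓝 0] 0) :
    ∫ x, vv n k u x * lap θ x = ∫ t, Real.exp (-(bt n (n + 2 * k) * t)) *
      ∫ p : Sph n, u p * (lap (hext fun y => θ (Real.exp t • y)) p + (k * (k + n - 2)) * hext (fun y => θ (Real.exp t • y)) p) ∂(sg n) := by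
  obtain ⟨A, hA⟩ := sup_log hc h0
  set α : ℝ := n + 2 * k with hα
  have hbt : 2 - bt n α = n + k := by rw [bt, hα]; ring
  have hgam : gam n α = -(k * (k + n - 2)) := by rw [gam, hα]; ring
  rw [polar_integral hn (Or.inl rfl)]
  have cf : Continuous (fderiv ℝ θ) := hθ.continuous_fderiv (by norm_num)
  have cf1 : ContDiff ℝ 1 (fderiv ℝ θ) := hθ.fderiv_right (by norm_num)
  have cdd : Continuous (dd θ) := cf1.continuous_fderiv (by norm_num)
  have cl : Continuous (lap θ) := continuous_iff_continuousAt.2 fun x => lap_cont hθ.contDiffAt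
  have c0 := hθ.continuous
  have ce : Continuous (fun q : Sph n × ℝ => Real.exp (1 * q.2) • (q.1 : EE n)) := by fun_prop
  have cs : Continuous (fun q : Sph n × ℝ => (q.1 : EE n)) := by fun_prop
  have cfq : Continuous (fun q : Sph n × ℝ => fderiv ℝ θ (Real.exp (1 * q.2) • (q.1 : EE n)) (q.1 : EE n)) :=
    (cf.comp ce).clm_apply cs
  have cdq : Continuous (fun q : Sph n × ℝ => dd θ (Real.exp (1 * q.2) • (q.1 : EE n)) (q.1 : EE n) (q.1 : EE n)) :=
    ((cdd.comp ce).clm_apply cs).clm_apply cs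
  have c0q := c0.comp ce
  have cW1 : Continuous (fun q : Sph n × ℝ => W1 α 1 θ q.1 q.2) := by
    unfold W1
    refine Continuous.mul (by fun_prop) (((by fun_prop : Continuous (fun q : Sph n × ℝ => 1 * Real.exp (1 * q.2))).mul cfq).sub
      (c0q.const_mul _))
  have cW2 : Continuous (fun q : Sph n × ℝ => W2 α 1 θ q.1 q.2) := by
    unfold W2
    refine Continuous.mul (by fun_prop) ((((by fun_prop : Continuous (fun q : Sph n × ℝ => Real.exp (1 * q.2) ^ 2)).mul cdq).add
      ((by fun_prop : Continuous (fun q : Sph n × ℝ => (1 - 2 * bt n α) * Real.exp (1 * q.2))).mul cfq)).add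
      (c0q.const_mul _))
  have cW0 : Continuous (fun q : Sph n × ℝ => W0 α 1 θ q.1 q.2) := by
    unfold W0
    exact Continuous.mul (by fun_prop) c0q
  have zf : ∀ (p : Sph n) t, A < |t| → fderiv ℝ θ (Real.exp (1 * t) • (p : EE n)) = 0 := fun p t h => by
    rw [one_mul, (hA p t h).fderiv_eq]; simp
  have z0 : ∀ (p : Sph n) t, A < |t| → θ (Real.exp (1 * t) • (p : EE n)) = 0 := fun p t h => by
    rw [one_mul]; exact (hA p t h).self_of_nhds
  have zd : ∀ (p : Sph n) t, A < |t| → dd θ (Real.exp (1 * t) • (p : EE n)) = 0 := fun p t h => by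
    rw [one_mul, dd_congr (hA p t h)]; simp [dd, fderiv_zero]
  have zl : ∀ (p : Sph n) t, A < |t| → lap θ (Real.exp (1 * t) • (p : EE n)) = 0 := fun p t h => by
    rw [lap_eq, zd p t h]; simp
  have zW0 : ∀ (p : Sph n) t, A < |t| → W0 α 1 θ p t = 0 := fun p t h => by rw [W0, z0 p t h, mul_zero]
  have zW1 : ∀ (p : Sph n) t, A < |t| → W1 α 1 θ p t = 0 := fun p t h => by
    rw [W1, z0 p t h, zf p t h]; simp
  have zW2 : ∀ (p : Sph n) t, A < |t| → W2 α 1 θ p t = 0 := fun p t h => by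
    rw [W2, z0 p t h, zf p t h, zd p t h]; simp
  have i0 := int_uG hu (G := fun q : Sph n × ℝ => 1 * (2 - α) * W1 α 1 θ q.1 q.2 + W2 α 1 θ q.1 q.2)
    (cW1.const_mul (1 * (2 - α))|>.add cW2) (A := A) (fun p t h => by simp [zW1 p t h, zW2 p t h])
  have i1 := int_uG hu (G := fun q : Sph n × ℝ => Real.exp ((2 - bt n α) * (1 * q.2)) * lap θ (Real.exp (1 * q.2) • (q.1 : EE n)))
    (Continuous.mul (by fun_prop) (cl.comp ce)) (A := A) (fun p t h => by simp only [zl p t h, mul_zero])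
  have e1 : ∀ q : Sph n × ℝ, Real.exp (n * (1 * q.2)) * (vv n k u (Real.exp (1 * q.2) • (q.1 : EE n)) *
      lap θ (Real.exp (1 * q.2) • (q.1 : EE n))) =
      u q.1 * (Real.exp ((2 - bt n α) * (1 * q.2)) * lap θ (Real.exp (1 * q.2) • (q.1 : EE n))) := by
    intro q
    rw [hbt, one_mul, vv_polar, add_mul, Real.exp_add]; ring
  simp_rw [e1]
  have hW : ∀ (p : Sph n) (t : ℝ), (∀ᶠ s in 𝓝 t, HasDerivAt (W0 α 1 θ p) (W1 α 1 θ p s) s) ∧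
    HasDerivAt (W1 α 1 θ p) (W2 α 1 θ p t) t := fun p t => W_deriv (by norm_num) hθ.contDiffAt
  have icp : ∀ {g : ℝ → ℝ}, Continuous g → (∀ t, A < |t| → g t = 0) → Integrable g := by
    intro g hg hz
    refine hg.integrable_of_hasCompactSupport ?_
    refine HasCompactSupport.intro (isCompact_Icc (a := -A) (b := A)) fun t ht => hz t ?_
    by_contra hh
    push Not at hh
    exact ht (abs_le.1 hh)
  have cs1 : ∀ p : Sph n, Continuous fun t : ℝ => (p, t) := fun p => by fun_prop
  have j0 : ∀ p : Sph n, Integrable (fun t => W0 α 1 θ p t) := fun p => icp (cW0.comp (cs1 p)) (zW0 p)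
  have j1 : ∀ p : Sph n, Integrable (fun t => W1 α 1 θ p t) := fun p => icp (cW1.comp (cs1 p)) (zW1 p)
  have j2 : ∀ p : Sph n, Integrable (fun t => W2 α 1 θ p t) := fun p => icp (cW2.comp (cs1 p)) (zW2 p)
  have k1 : ∀ p : Sph n, ∫ t, W1 α 1 θ p t = 0 := fun p =>
    integral_eq_zero_of_hasDerivAt_of_integrable (fun t => (hW p t).1.self_of_nhds) (j1 p) (j0 p)
  have k2 : ∀ p : Sph n, ∫ t, W2 α 1 θ p t = 0 := fun p =>
    integral_eq_zero_of_hasDerivAt_of_integrable (fun t => (hW p t).2) (j2 p) (j1 p)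
  have hz : ∫ q : Sph n × ℝ, u q.1 * (1 * (2 - α) * W1 α 1 θ q.1 q.2 + W2 α 1 θ q.1 q.2) ∂((sg n).prod volume) = 0 := by
    rw [integral_prod _ i0]
    simp only
    rw [← integral_zero (Sph n) ℝ (μ := sg n)]
    refine integral_congr_ae (ae_of_all _ fun p => ?_)
    simp only
    rw [integral_const_mul, integral_add ((j1 p).const_mul _) (j2 p), integral_const_mul, k1, k2]
    simp
  have hR := i1.sub i0
  have hI : ∫ q : Sph n × ℝ, u q.1 * (Real.exp ((2 - bt n α) * (1 * q.2)) * lap θ (Real.exp (1 * q.2) • (q.1 : EE n))) ∂((sg n).prod volume)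
     = ∫ q : Sph n × ℝ, (u q.1 * (Real.exp ((2 - bt n α) * (1 * q.2)) * lap θ (Real.exp (1 * q.2) • (q.1 : EE n)))
       - u q.1 * (1 * (2 - α) * W1 α 1 θ q.1 q.2 + W2 α 1 θ q.1 q.2)) ∂((sg n).prod volume) := by
    rw [integral_sub i1 i0, hz, sub_zero]
  rw [hI]
  refine (integral_prod_symm _ hR).trans ?_
  refine integral_congr_ae (ae_of_all _ fun t => ?_)
  simp only [← integral_const_mul, Pi.sub_apply]
  refine integral_congr_ae (ae_of_all _ fun p => ?_)
  simp only
  have hp : ‖(p : EE n)‖ = 1 := by simp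
  rw [W_lap (by norm_num) hp hθ.contDiffAt, hgam]
  simp only [W0, one_mul, hext, hp, inv_one, one_smul]
  ring

lemma TT_slice {n : ℕ} {S : Set (EE n)} {θ : EE n → ℝ} (hθ : ContDiff ℝ 2 θ) (hs : tsupport θ ⊆ coneOf S ∨ S = univ) (t : ℝ) :
    TT S (hext fun y => θ (Real.exp t • y)) := by
  have hcd : ∀ x : EE n, x ≠ 0 → ContDiffAt ℝ 2 (fun x : EE n => Real.exp t • ‖x‖⁻¹ • x) x := by
    intro x hx
    exact (nrm_contDiffAt hx 2).const_smul _
  refine ⟨hext_hom0 _, fun x hx => ?_, fun x hx hxc => ?_⟩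
  · exact hθ.contDiffAt.comp x (hcd x hx)
  · rcases hs with hs | hs
    · have : Real.exp t • ‖x‖⁻¹ • x ∉ tsupport θ := fun h => by
        have := hs h
        rw [cone_smul (Real.exp_pos t), cone_smul (inv_pos.2 (norm_pos_iff.2 hx))] at this
        exact hxc this
      rw [notMem_tsupport_iff_eventuallyEq] at this
      exact (hcd x hx).continuousAt.eventually this
    · exact absurd ⟨hx, hs ▸ mem_univ _⟩ hxc

structure FF {n : ℕ} (S : Set (EE n)) (k : ℝ) (v : EE n → ℝ) : Prop where
  m : Measurable v
  li : LocallyIntegrable v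
  nn : ∀ x, 0 ≤ v x
  off : ∀ x ∉ coneOf S, v x = 0
  hom : ∀ t : ℝ, 0 < t → ∀ x, v (t • x) = t ^ k * v x
  pos : 0 < ∫ x in ball 0 1, v x
  eq : ∀ θ : EE n → ℝ, ContDiff ℝ 2 θ → HasCompactSupport θ → tsupport θ ⊆ coneOf S → ∫ x, v x * lap θ x = 0
  ge : ∀ θ : EE n → ℝ, ContDiff ℝ 2 θ → HasCompactSupport θ → (0 : EE n) ∉ tsupport θ → (∀ x, 0 ≤ θ x) →
    0 ≤ ∫ x, v x * lap θ x

lemma FF_exists {n : ℕ} (hn : 2 ≤ n) {S : Set (EE n)} (hS : IsSphDomain S) :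
    ∃ (k : ℝ) (v : EE n → ℝ), 0 ≤ k ∧ k * (k + n - 2) = lam1 S ∧ FF S k v := by
  have hn1 : 1 ≤ n := by omega
  have hn2 : (2:ℝ) ≤ n := by exact_mod_cast hn
  obtain ⟨u, um, ui, u0, uS, upos, ueq, uge⟩ := weak_lim hn1 hS
  have hl := lam1_nonneg S
  set r := √(((n:ℝ) - 2) ^ 2 + 4 * lam1 S) with hr
  have hr2 : r ^ 2 = ((n:ℝ) - 2) ^ 2 + 4 * lam1 S := Real.sq_sqrt (by positivity)
  have hr0 : (n:ℝ) - 2 ≤ r := Real.le_sqrt_of_sq_le (by linarith)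
  have hk : 0 ≤ (r - (n - 2)) / 2 := by linarith
  have hk2 : (r - (n - 2)) / 2 * ((r - (n - 2)) / 2 + n - 2) = lam1 S := by nlinarith
  refine ⟨(r - (n - 2)) / 2, vv n ((r - (n - 2)) / 2) u, hk, hk2, ?_⟩
  set k := (r - ((n:ℝ) - 2)) / 2
  refine ⟨vv_measurable k um, vv_locInt hn1 hk ui, vv_nonneg k u0, fun x hx => vv_off k uS hx, fun t ht x => vv_hom k u ht x, ?_, ?_, ?_⟩
  · have hi : IntegrableOn (vv n k u) (ball 0 1) := (vv_int_ball hn1 hk ui one_pos).mono_set ball_subset_closedBall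
    rw [← integral_indicator measurableSet_ball, polar_integral hn1 (Or.inl rfl)]
    have e : ∀ q : Sph n × ℝ, Real.exp (n * (1 * q.2)) * (ball (0:EE n) 1).indicator (vv n k u) (Real.exp (1 * q.2) • (q.1 : EE n))
      = u q.1 * (Iio (0:ℝ)).indicator (fun t => Real.exp ((n + k) * t)) q.2 := by
      intro q
      have hq : Real.exp (1 * q.2) • (q.1 : EE n) ∈ ball 0 1 ↔ q.2 ∈ Iio (0:ℝ) := by
        simp [norm_smul]
      by_cases h : q.2 ∈ Iio (0:ℝ)
      · rw [indicator_of_mem h, indicator_of_mem (hq.2 h), one_mul, vv_polar, add_mul, Real.exp_add]; ring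
      · rw [indicator_of_notMem h, indicator_of_notMem (fun h' => h (hq.1 h'))]; simp
    simp_rw [e]
    rw [integral_prod_mul (μ := sg n) (ν := volume) u]
    refine mul_pos upos ?_
    rw [integral_indicator measurableSet_Iio, ← integral_Iic_eq_integral_Iio, integral_exp_mul_Iic (by linarith)]
    have : (0:ℝ) < n + k := by linarith
    positivity
  · intro θ hθ hc hs
    have h0 : θ =ᶠ[𝓝 0] 0 := by
      rw [← notMem_tsupport_iff_eventuallyEq]
      exact fun h => (cone_ne (hs h)) rfl
    rw [flat hn1 ui hθ hc h0]
    rw [← integral_zero ℝ ℝ (μ := volume)]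
    refine integral_congr_ae (ae_of_all _ fun t => ?_)
    simp only [hk2]
    rw [ueq _ (TT_slice hθ (Or.inl hs) t), mul_zero]
  · intro θ hθ hc h0 hp
    rw [notMem_tsupport_iff_eventuallyEq] at h0
    rw [flat hn1 ui hθ hc h0]
    refine integral_nonneg fun t => ?_
    simp only [hk2]
    refine mul_nonneg (Real.exp_pos _).le (uge _ (TT_slice hθ (Or.inr rfl) t) fun x => hp _)
end

open MeasureTheory Metric Set Filter Topology
open scoped RealInnerProductSpace
noncomputable section

def pp (m : ℕ) (s : ℝ) : ℝ := max 0 s ^ m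

lemma pp_nonneg (m : ℕ) (s : ℝ) : 0 ≤ pp m s := pow_nonneg (le_max_left _ _) _

lemma pp_cont (m : ℕ) : Continuous (pp m) := by unfold pp; fun_prop

lemma pp_zero {m : ℕ} (hm : m ≠ 0) {s : ℝ} (hs : s ≤ 0) : pp m s = 0 := by
  simp [pp, max_eq_left hs, hm]

lemma pp_succ (m : ℕ) (hm : 1 ≤ m) (s : ℝ) : pp (m + 1) s = s * pp m s := by
  rcases le_total s 0 with h | h
  · rw [pp_zero (by omega) h, pp_zero (by omega) h, mul_zero]
  · simp only [pp, max_eq_right h]; ring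

lemma pp_deriv (m : ℕ) (hm : 1 ≤ m) (s : ℝ) : HasDerivAt (pp (m + 1)) ((m + 1) * pp m s) s := by
  rcases lt_trichotomy s 0 with h | h | h
  · rw [pp_zero (by omega) h.le, mul_zero]
    refine (hasDerivAt_const s (0:ℝ)).congr_of_eventuallyEq ?_
    filter_upwards [isOpen_Iio.mem_nhds h] with r hr
    exact pp_zero (by omega) (le_of_lt hr)
  · subst h
    rw [pp_zero (by omega) le_rfl, mul_zero, hasDerivAt_iff_isLittleO]
    simp only [pp_zero (show m + 1 ≠ 0 by omega) (le_refl (0:ℝ)), sub_zero, smul_zero]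
    have h1 : Tendsto (fun r : ℝ => pp m r) (𝓝 0) (𝓝 0) := by
      have := (pp_cont m).tendsto 0
      rwa [pp_zero (by omega) le_rfl] at this
    have h2 : (fun r : ℝ => pp (m + 1) r) = fun r => r * pp m r := funext fun r => pp_succ m hm r
    rw [h2]
    have := (Asymptotics.isBigO_refl (fun r : ℝ => r) (𝓝 0)).mul_isLittleO ((Asymptotics.isLittleO_one_iff ℝ).2 h1)
    simpa using this
  · have : HasDerivAt (fun r : ℝ => r ^ (m + 1)) ((m + 1) * pp m s) s := by
      have := hasDerivAt_pow (m + 1) s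
      simpa [pp, max_eq_right h.le] using this
    refine this.congr_of_eventuallyEq ?_
    filter_upwards [isOpen_Ioi.mem_nhds h] with r hr
    rw [mem_Ioi] at hr
    simp [pp, max_eq_right hr.le]

lemma pp_deriv_eq (m : ℕ) (hm : 1 ≤ m) : deriv (pp (m + 1)) = fun s => (m + 1) * pp m s :=
  funext fun s => (pp_deriv m hm s).deriv

lemma pp_contDiff1 (m : ℕ) (hm : 2 ≤ m) : ContDiff ℝ 1 (pp m) := by
  obtain ⟨m, rfl⟩ : ∃ k, m = k + 1 := ⟨m - 1, by omega⟩
  rw [contDiff_one_iff_deriv, pp_deriv_eq m (by omega)]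
  exact ⟨fun s => (pp_deriv m (by omega) s).differentiableAt, (pp_cont m).const_mul _⟩

lemma pp_contDiff2 (m : ℕ) (hm : 3 ≤ m) : ContDiff ℝ 2 (pp m) := by
  obtain ⟨m, rfl⟩ : ∃ k, m = k + 1 := ⟨m - 1, by omega⟩
  rw [show (2 : WithTop ℕ∞) = 1 + 1 by norm_num, contDiff_succ_iff_deriv, pp_deriv_eq m (by omega)]
  refine ⟨fun s => (pp_deriv m (by omega) s).differentiableAt, by simp, contDiff_const.mul (pp_contDiff1 m (by omega))⟩

/-- the kernel -/
def KK {n : ℕ} (m : ℕ) (τ : ℝ) (z : EE n) : ℝ := pp m (τ - ‖z‖ ^ 2)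

lemma KK_nonneg {n : ℕ} (m : ℕ) (τ : ℝ) (z : EE n) : 0 ≤ KK m τ z := pp_nonneg _ _

lemma KK_contDiff {n : ℕ} (m : ℕ) (hm : 3 ≤ m) (τ : ℝ) : ContDiff ℝ 2 (KK (n := n) m τ) :=
  (pp_contDiff2 m hm).comp (contDiff_const.sub (contDiff_norm_sq ℝ))

lemma KK_cont {n : ℕ} (m : ℕ) (τ : ℝ) : Continuous (KK (n := n) m τ) := by
  unfold KK; exact (pp_cont m).comp (by fun_prop)

lemma KK_zero {n : ℕ} {m : ℕ} (hm : m ≠ 0) {τ : ℝ} {z : EE n} (h : √τ ≤ ‖z‖) : KK m τ z = 0 := by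
  refine pp_zero hm ?_
  have := Real.sqrt_le_left (norm_nonneg z) |>.1 h
  linarith

lemma KK_tsupport {n : ℕ} {m : ℕ} (hm : m ≠ 0) (τ : ℝ) (x : EE n) :
    tsupport (fun y => KK m τ (y - x)) ⊆ closedBall x (√τ) := by
  refine closure_minimal ?_ isClosed_closedBall
  intro y hy
  by_contra h
  rw [mem_closedBall, not_le, dist_eq_norm] at h
  exact hy (KK_zero hm h.le)

lemma KK_hcs {n : ℕ} {m : ℕ} (hm : m ≠ 0) (τ : ℝ) (x : EE n) :
    HasCompactSupport (fun y => KK m τ (y - x)) :=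
  (isCompact_closedBall x (√τ)).of_isClosed_subset (isClosed_tsupport _) (KK_tsupport hm τ x)

lemma KK_lap {n : ℕ} (m : ℕ) (hm : 1 ≤ m) (τ : ℝ) (x y : EE n) :
    lap (fun y => KK (m + 2) τ (y - x)) y = 4 * (m + 2) * (m + 1) * KK m τ (y - x) * ‖y - x‖ ^ 2
      - 2 * n * (m + 2) * KK (m + 1) τ (y - x) := by
  have hcd : ContDiff ℝ 2 (fun y => KK (m + 2) τ (y - x)) :=
    (KK_contDiff (m + 2) (by omega) τ).comp (contDiff_id.sub contDiff_const)
  have key : ∀ i : Fin n, dd (fun y => KK (m + 2) τ (y - x)) y (EuclideanSpace.single i 1) (EuclideanSpace.single i 1) =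
      4 * (m + 2) * (m + 1) * KK m τ (y - x) * ((y - x) i) ^ 2 - 2 * (m + 2) * KK (m + 1) τ (y - x) := by
    intro i
    rw [dd_line hcd.contDiffAt]
    set z := y - x with hz
    have e : ∀ t : ℝ, τ - ‖y + t • EuclideanSpace.single i (1:ℝ) - x‖ ^ 2 = τ - (‖z‖ ^ 2 + 2 * t * z i + t ^ 2) := by
      intro t
      have : y + t • EuclideanSpace.single i (1:ℝ) - x = z + t • EuclideanSpace.single i (1:ℝ) := by rw [hz]; abel
      rw [this, norm_add_sq_real, inner_smul_right, norm_smul]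
      simp [EuclideanSpace.inner_single_right]
      ring
    have hr : ∀ t : ℝ, HasDerivAt (fun t : ℝ => τ - (‖z‖ ^ 2 + 2 * t * z i + t ^ 2)) (-(2 * z i + 2 * t)) t := by
      intro t
      have h1 : HasDerivAt (fun t : ℝ => 2 * t * z i) (2 * z i) t := by
        simpa using ((hasDerivAt_id t).const_mul 2).mul_const (z i)
      have h2 : HasDerivAt (fun t : ℝ => t ^ 2) (2 * t) t := by simpa using hasDerivAt_pow 2 t
      exact (((h1.const_add (‖z‖ ^ 2)).add h2).const_sub τ).congr_deriv (by ring)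
    have h1 : deriv (fun t : ℝ => KK (m + 2) τ (y + t • EuclideanSpace.single i (1:ℝ) - x)) =
        fun t => ((m + 2) * pp (m + 1) (τ - (‖z‖ ^ 2 + 2 * t * z i + t ^ 2))) * (-(2 * z i + 2 * t)) := by
      funext t
      simp only [KK, e]
      have := (pp_deriv (m + 1) (by omega) (τ - (‖z‖ ^ 2 + 2 * t * z i + t ^ 2))).comp t (hr t)
      have h3 := this.deriv
      simp only [Function.comp_def] at h3
      rw [h3]; push_cast; ring
    rw [h1]
    have h2 : HasDerivAt (fun t : ℝ => ((m + 2) * pp (m + 1) (τ - (‖z‖ ^ 2 + 2 * t * z i + t ^ 2))) * (-(2 * z i + 2 * t)))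
        (4 * (m + 2) * (m + 1) * KK m τ z * (z i) ^ 2 - 2 * (m + 2) * KK (m + 1) τ z) 0 := by
      have a1 := ((pp_deriv m hm (τ - (‖z‖ ^ 2 + 2 * 0 * z i + 0 ^ 2))).comp 0 (hr 0)).const_mul ((m:ℝ) + 2)
      have a2 : HasDerivAt (fun t : ℝ => -(2 * z i + 2 * t)) (-2) 0 := by
        have := (((hasDerivAt_id (0:ℝ)).const_mul 2).const_add (2 * z i)).neg
        exact this.congr_deriv (by simp)
      refine (a1.mul a2).congr_deriv ?_
      simp [KK]; ring
    exact h2.deriv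
  rw [lap_eq, Finset.sum_congr rfl fun i _ => key i, Finset.sum_sub_distrib, ← Finset.mul_sum, EuclideanSpace.norm_sq_eq]
  simp
  ring
end

open MeasureTheory Metric Set Filter Topology
open scoped RealInnerProductSpace
noncomputable section

def AA {n : ℕ} (m : ℕ) (v : EE n → ℝ) (x : EE n) (τ : ℝ) : ℝ := ∫ y, v y * KK m τ (y - x)

def ax (n : ℕ) : ℝ := 3 + n / 2
def Nv {n : ℕ} (v : EE n → ℝ) (x : EE n) (τ : ℝ) : ℝ := τ ^ (-ax n) * AA 3 v x τ

lemma AA_int {n : ℕ} {v : EE n → ℝ} (hv : LocallyIntegrable v) {m : ℕ} (hm : m ≠ 0) (x : EE n) (τ : ℝ) :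
    Integrable (fun y => v y * KK m τ (y - x)) := by
  have := hv.integrable_smul_left_of_hasCompactSupport (g := fun y => KK m τ (y - x))
    ((KK_cont m τ).comp (by fun_prop)) (KK_hcs hm τ x)
  simpa only [smul_eq_mul, mul_comm] using this

lemma AA_nonneg {n : ℕ} {v : EE n → ℝ} (hv : ∀ x, 0 ≤ v x) (m : ℕ) (x : EE n) (τ : ℝ) : 0 ≤ AA m v x τ :=
  integral_nonneg fun y => mul_nonneg (hv y) (KK_nonneg _ _ _)

lemma pp_mono (m : ℕ) {a b : ℝ} (h : a ≤ b) : pp m a ≤ pp m b := by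
  unfold pp
  exact pow_le_pow_left₀ (le_max_left _ _) (max_le_max le_rfl h) m

lemma AA_deriv {n : ℕ} {v : EE n → ℝ} (hv : LocallyIntegrable v) (x : EE n) (τ : ℝ) :
    HasDerivAt (fun τ => AA 3 v x τ) (3 * AA 2 v x τ) τ := by
  have h := hasDerivAt_integral_of_dominated_loc_of_deriv_le (μ := volume) (𝕜 := ℝ)
    (F := fun τ y => v y * KK 3 τ (y - x)) (F' := fun τ y => v y * (3 * KK 2 τ (y - x))) (x₀ := τ)
    (s := ball τ 1) (bound := fun y => |v y * (3 * KK 2 (τ + 1) (y - x))|) (ball_mem_nhds τ one_pos)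
    (Eventually.of_forall fun τ => (AA_int hv (by norm_num) x τ).aestronglyMeasurable)
    (AA_int hv (by norm_num) x τ) ?_ ?_ ?_ ?_
  · refine h.2.congr_deriv ?_
    unfold AA
    rw [← integral_const_mul]
    congr 1; ext y; ring
  · have := ((AA_int hv (m := 2) (by norm_num) x τ).const_mul 3).aestronglyMeasurable
    refine this.congr (ae_of_all _ fun y => ?_)
    simp only; ring
  · refine ae_of_all _ fun y t ht => ?_
    rw [Real.norm_eq_abs, abs_mul, abs_mul (v y) (3 * KK 2 (τ + 1) (y - x))]
    refine mul_le_mul_of_nonneg_left ?_ (abs_nonneg (v y))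
    have hk : ∀ r, |3 * KK 2 r (y - x)| = 3 * KK 2 r (y - x) := fun r => abs_of_nonneg (mul_nonneg (by norm_num) (KK_nonneg _ _ _))
    rw [hk, hk]
    refine mul_le_mul_of_nonneg_left (pp_mono 2 ?_) (by norm_num)
    rw [mem_ball, Real.dist_eq, abs_lt] at ht
    linarith [ht.2]
  · refine Integrable.abs ?_
    refine ((AA_int hv (m := 2) (by norm_num) x (τ + 1)).const_mul 3).congr (ae_of_all _ fun y => ?_)
    simp only; ring
  · refine ae_of_all _ fun y t ht => ?_
    refine HasDerivAt.const_mul _ ?_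
    have h1 : HasDerivAt (fun τ : ℝ => τ - ‖y - x‖ ^ 2) 1 t := (hasDerivAt_id t).sub_const _
    refine ((pp_deriv 2 (by norm_num) (t - ‖y - x‖ ^ 2)).comp t h1).congr_deriv ?_
    simp only [KK]; push_cast; ring

lemma lap_test {n : ℕ} {v : EE n → ℝ} (hv : LocallyIntegrable v) (x : EE n) (τ : ℝ) :
    ∫ y, v y * lap (fun y => KK 4 τ (y - x)) y = 16 * (τ * (3 * AA 2 v x τ) - ax n * AA 3 v x τ) := by
  have e : ∀ y, v y * lap (fun y => KK 4 τ (y - x)) y =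
      (48 * τ) * (v y * KK 2 τ (y - x)) - (48 + 8 * n) * (v y * KK 3 τ (y - x)) := by
    intro y
    have := KK_lap 2 (by norm_num) τ x y
    rw [show 2 + 2 = 4 by norm_num] at this
    rw [this]
    have h3 : KK 3 τ (y - x) = (τ - ‖y - x‖ ^ 2) * KK 2 τ (y - x) := pp_succ 2 (by norm_num) _
    rw [show 2 + 1 = 3 by norm_num, h3]; push_cast; ring
  simp_rw [e]
  rw [integral_sub ((AA_int hv (by norm_num) x τ).const_mul _) ((AA_int hv (by norm_num) x τ).const_mul _),
    integral_const_mul, integral_const_mul]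
  unfold AA ax; ring

lemma Nv_deriv {n : ℕ} {v : EE n → ℝ} (hv : LocallyIntegrable v) (x : EE n) {τ : ℝ} (hτ : 0 < τ) :
    HasDerivAt (Nv v x) (τ ^ (-ax n - 1) / 16 * ∫ y, v y * lap (fun y => KK 4 τ (y - x)) y) τ := by
  have h := (Real.hasDerivAt_rpow_const (p := -ax n) (Or.inl hτ.ne')).mul (AA_deriv hv x τ)
  refine h.congr_deriv ?_
  rw [lap_test hv]
  have : τ ^ (-ax n) = τ ^ (-ax n - 1) * τ := by
    rw [← Real.rpow_add_one hτ.ne']; congr 1; ring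
  rw [this]; ring

lemma KK4_cd {n : ℕ} (m : ℕ) (hm : 3 ≤ m) (τ : ℝ) (x : EE n) : ContDiff ℝ 2 (fun y => KK m τ (y - x)) :=
  (KK_contDiff m hm τ).comp (contDiff_id.sub contDiff_const)

lemma FF.Nv_mono {n : ℕ} {S : Set (EE n)} {k : ℝ} {v : EE n → ℝ} (h : FF S k v) {x : EE n} {τ₁ τ₂ : ℝ}
    (h0 : 0 < τ₁) (h1 : τ₁ ≤ τ₂) (h2 : √τ₂ < ‖x‖) : Nv v x τ₁ ≤ Nv v x τ₂ := by
  have hm : MonotoneOn (Nv v x) (Icc τ₁ τ₂) := by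
    refine monotoneOn_of_hasDerivWithinAt_nonneg (convex_Icc _ _)
      (fun τ hτ => (Nv_deriv h.li x (h0.trans_le hτ.1)).continuousAt.continuousWithinAt)
      (fun τ hτ => (Nv_deriv h.li x (h0.trans_le (interior_subset hτ).1)).hasDerivWithinAt) ?_
    intro τ hτ
    have hτ' := interior_subset hτ
    have hp := h0.trans_le hτ'.1
    refine mul_nonneg (by positivity) (h.ge _ (KK4_cd 4 (by norm_num) τ x) (KK_hcs (by norm_num) τ x) ?_ fun y => KK_nonneg _ _ _)
    intro hh
    have := KK_tsupport (by norm_num) τ x hh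
    rw [mem_closedBall, dist_zero_left] at this
    have := Real.sqrt_le_sqrt hτ'.2
    linarith
  exact hm (left_mem_Icc.2 h1) (right_mem_Icc.2 h1) h1

lemma FF.Nv_const {n : ℕ} {S : Set (EE n)} {k : ℝ} {v : EE n → ℝ} (h : FF S k v) {x : EE n} {τ₁ τ₂ : ℝ}
    (h0 : 0 < τ₁) (h1 : τ₁ ≤ τ₂) (h2 : closedBall x (√τ₂) ⊆ coneOf S) : Nv v x τ₁ = Nv v x τ₂ := by
  have hd : ∀ τ ∈ Icc τ₁ τ₂, HasDerivAt (Nv v x) 0 τ := by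
    intro τ hτ
    have := Nv_deriv h.li x (h0.trans_le hτ.1)
    rwa [h.eq _ (KK4_cd 4 (by norm_num) τ x) (KK_hcs (by norm_num) τ x) ((KK_tsupport (by norm_num) τ x).trans
      ((closedBall_subset_closedBall (Real.sqrt_le_sqrt hτ.2)).trans h2)), mul_zero] at this
  exact (constant_of_has_deriv_right_zero (fun τ hτ => (hd τ hτ).continuousAt.continuousWithinAt)
    (fun τ hτ => (hd τ (Ico_subset_Icc_self hτ)).hasDerivWithinAt) τ₂ (right_mem_Icc.2 h1)).symm

/-- normalisation constant -/
def cK (n : ℕ) : ℝ := ∫ z : EE n, KK 3 1 z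

lemma KK_int {n : ℕ} {m : ℕ} (hm : m ≠ 0) (τ : ℝ) (x : EE n) : Integrable (fun y => KK m τ (y - x)) :=
  ((KK_cont m τ).comp (by fun_prop)).integrable_of_hasCompactSupport (KK_hcs hm τ x)

lemma cK_pos (n : ℕ) : 0 < cK n := by
  unfold cK
  have hi : Integrable (fun z : EE n => KK 3 1 z) := by simpa using KK_int (n := n) (m := 3) (by norm_num) 1 0
  rw [integral_pos_iff_support_of_nonneg (fun z => KK_nonneg _ _ _) hi]
  refine (isOpen_ball.measure_pos volume ⟨0, mem_ball_self one_pos⟩).trans_le (measure_mono (s := ball (0 : EE n) 1) ?_)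
  intro z hz
  rw [mem_ball_zero_iff] at hz
  have : 0 < 1 - ‖z‖ ^ 2 := by nlinarith [norm_nonneg z]
  have h2 : max 0 (1 - ‖z‖ ^ 2) = 1 - ‖z‖ ^ 2 := max_eq_right this.le
  simp only [Function.mem_support, KK, pp, h2]
  positivity

lemma KK_scale {n : ℕ} (m : ℕ) (τ : ℝ) {t : ℝ} (z : EE n) :
    KK m (t ^ 2 * τ) (t • z) = t ^ (2 * m) * KK m τ z := by
  unfold KK pp
  rw [norm_smul, mul_pow, Real.norm_eq_abs, sq_abs, ← mul_sub, pow_mul, ← mul_pow]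
  congr 1
  rw [mul_max_of_nonneg _ _ (sq_nonneg t), mul_zero]

lemma KK_total {n : ℕ} {τ : ℝ} (hτ : 0 < τ) (x : EE n) : ∫ y, KK 3 τ (y - x) = cK n * τ ^ ax n := by
  rw [integral_sub_right_eq_self (fun y => KK 3 τ y) x]
  have h := Measure.integral_comp_smul (volume : Measure (EE n)) (fun y => KK 3 τ y) (√τ)
  have h2 : ∀ z : EE n, KK 3 τ (√τ • z) = τ ^ 3 * KK 3 1 z := by
    intro z
    have := KK_scale 3 1 (t := √τ) z
    rw [Real.sq_sqrt hτ.le, mul_one, pow_mul, Real.sq_sqrt hτ.le] at this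
    exact this
  simp only [h2] at h
  rw [integral_const_mul, finrank_euclideanSpace_fin, smul_eq_mul, abs_of_nonneg (by positivity)] at h
  have h3 : τ ^ ax n = √τ ^ n * τ ^ 3 := by
    rw [ax, Real.sqrt_eq_rpow, ← Real.rpow_natCast (τ ^ (1/2:ℝ)), ← Real.rpow_natCast τ, ← Real.rpow_mul hτ.le,
      ← Real.rpow_add hτ]
    congr 1; push_cast; ring
  have hs : (√τ ^ n) ≠ 0 := by positivity
  rw [h3, cK]
  field_simp at h
  linarith

lemma FF.AA_scale {n : ℕ} {S : Set (EE n)} {k : ℝ} {v : EE n → ℝ} (h : FF S k v) {x : EE n} {t τ : ℝ} (ht : 0 < t) (hτ : 0 < τ) :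
    Nv v (t • x) (t ^ 2 * τ) = t ^ k * Nv v x τ := by
  have h1 := Measure.integral_comp_smul (volume : Measure (EE n)) (fun y => v y * KK 3 (t ^ 2 * τ) (y - t • x)) t
  have h2 : ∀ z : EE n, v (t • z) * KK 3 (t ^ 2 * τ) (t • z - t • x) = (t ^ k * t ^ 6) * (v z * KK 3 τ (z - x)) := by
    intro z
    rw [← smul_sub, KK_scale, h.hom t ht]; ring
  simp only [h2] at h1
  rw [integral_const_mul, finrank_euclideanSpace_fin, smul_eq_mul, abs_of_nonneg (by positivity)] at h1
  have hs : t ^ n ≠ 0 := by positivity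
  have h3 : AA 3 v (t • x) (t ^ 2 * τ) = t ^ n * (t ^ k * t ^ 6) * AA 3 v x τ := by
    unfold AA
    field_simp at h1
    linarith
  unfold Nv
  rw [h3, Real.mul_rpow (by positivity) hτ.le]
  have h4 : (t ^ 2) ^ (-ax n) * (t ^ n * t ^ 6) = 1 := by
    rw [← Real.rpow_natCast t 2, ← Real.rpow_natCast t n, ← Real.rpow_natCast t 6, ← Real.rpow_mul ht.le,
      ← Real.rpow_add ht, ← Real.rpow_add ht]
    rw [ax]; push_cast
    rw [show (2:ℝ) * -(3 + n / 2) + (n + 6) = 0 by ring, Real.rpow_zero]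
  linear_combination (τ ^ (-ax n) * t ^ k * AA 3 v x τ) * h4
end

open MeasureTheory Metric Set Filter Topology
open scoped RealInnerProductSpace
noncomputable section

lemma conv_d {n : ℕ} {v : EE n → ℝ} (hv : LocallyIntegrable v) {g : EE n → ℝ} (hg : ContDiff ℝ 1 g) (hc : HasCompactSupport g)
    (x : EE n) : DifferentiableAt ℝ (fun x => ∫ y, v y * g (x - y)) x ∧
      ∀ e, fderiv ℝ (fun x => ∫ y, v y * g (x - y)) x e = ∫ y, v y * fderiv ℝ g (x - y) e := by
  have h := HasCompactSupport.hasFDerivAt_convolution_right (ContinuousLinearMap.lsmul ℝ ℝ) hc hv hg x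
  refine ⟨h.differentiableAt, fun e => ?_⟩
  have h2 := h.fderiv
  have h3 := convolution_precompR_apply (L := ContinuousLinearMap.lsmul ℝ ℝ) hv (hc.fderiv (𝕜 := ℝ)) (hg.continuous_fderiv (by norm_num)) x e
  rw [← h2] at h3
  exact h3

lemma conv_cd {n : ℕ} {v : EE n → ℝ} (hv : LocallyIntegrable v) {g : EE n → ℝ} (hg : ContDiff ℝ 2 g) (hc : HasCompactSupport g) :
    ContDiff ℝ 2 (fun x => ∫ y, v y * g (x - y)) :=
  HasCompactSupport.contDiff_convolution_right (ContinuousLinearMap.lsmul ℝ ℝ) hc hv hg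

lemma conv_lap {n : ℕ} {v : EE n → ℝ} (hv : LocallyIntegrable v) {g : EE n → ℝ} (hg : ContDiff ℝ 2 g) (hc : HasCompactSupport g)
    (x : EE n) : lap (fun x => ∫ y, v y * g (x - y)) x = ∫ y, v y * lap g (x - y) := by
  have h1 := fun x => conv_d hv (hg.of_le (by norm_num)) hc x
  have cg := conv_cd hv hg hc
  have cf1 : ContDiff ℝ 1 (fderiv ℝ g) := hg.fderiv_right (by norm_num)
  have hcf : HasCompactSupport (fderiv ℝ g) := hc.fderiv (𝕜 := ℝ)
  have key : ∀ e : EE n, dd (fun x => ∫ y, v y * g (x - y)) x e e = ∫ y, v y * dd g (x - y) e e ∧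
      Integrable (fun y => v y * dd g (x - y) e e) := by
    intro e
    have hge : ContDiff ℝ 1 (fun z => fderiv ℝ g z e) := cf1.clm_apply contDiff_const
    have hce : HasCompactSupport (fun z => fderiv ℝ g z e) := by
      refine hcf.mono' (fun z hz => ?_)
      refine subset_tsupport _ fun h0 => hz ?_
      simp only [h0]; rfl
    have ddg : ∀ z, fderiv ℝ (fun z => fderiv ℝ g z e) z e = dd g z e e := by
      intro z
      have hd : DifferentiableAt ℝ (fderiv ℝ g) z := cf1.differentiable (by norm_num) z
      have := (hd.hasFDerivAt.clm_apply (hasFDerivAt_const e z)).fderiv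
      rw [this]; simp [dd]
    constructor
    · have hd : DifferentiableAt ℝ (fderiv ℝ (fun x => ∫ y, v y * g (x - y))) x :=
        (cg.fderiv_right (m := 1) (by norm_num)).differentiable (by norm_num) x
      have h3 := (hd.hasFDerivAt.clm_apply (hasFDerivAt_const e x)).fderiv
      have h4 : dd (fun x => ∫ y, v y * g (x - y)) x e e = fderiv ℝ (fun x => fderiv ℝ (fun x => ∫ y, v y * g (x - y)) x e) x e := by
        rw [h3]; simp [dd]
      rw [h4]
      have h5 : (fun x => fderiv ℝ (fun x => ∫ y, v y * g (x - y)) x e) = fun x => ∫ y, v y * fderiv ℝ g (x - y) e :=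
        funext fun x => (h1 x).2 e
      rw [h5, (conv_d hv hge hce x).2 e]
      simp only [ddg]
    · have hc2 : HasCompactSupport (fun z => dd g z e e) := by
        have := hce.fderiv (𝕜 := ℝ)
        refine this.mono' (fun z hz => ?_)
        refine subset_tsupport _ fun h0 => hz ?_
        simp only [← ddg z, h0]; rfl
      have hcont : Continuous (fun z => dd g z e e) :=
        ((cf1.continuous_fderiv (by norm_num)).clm_apply continuous_const).clm_apply continuous_const
      have hcs : HasCompactSupport (fun y => dd g (x - y) e e) := hc2.comp_homeomorph (Homeomorph.subLeft x)
      have := hv.integrable_smul_left_of_hasCompactSupport (g := fun y => dd g (x - y) e e)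
        (hcont.comp (by fun_prop)) hcs
      simpa only [smul_eq_mul, mul_comm] using this
  rw [lap_eq]
  simp only [lap_eq g, Finset.mul_sum]
  rw [integral_finsetSum _ fun i _ => (key _).2]
  exact Finset.sum_congr rfl fun i _ => (key _).1

lemma KK_even {n : ℕ} (m : ℕ) (τ : ℝ) (x y : EE n) : KK m τ (x - y) = KK m τ (y - x) := by
  unfold KK; rw [norm_sub_rev]

def vs {n : ℕ} (S : Set (EE n)) (v : EE n → ℝ) (x : EE n) : ℝ := Nv v x ((infDist x (coneOf S)ᶜ / 2) ^ 2) / cK n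

lemma good_ball {n : ℕ} {S : Set (EE n)} (hS : IsSphDomain S) {x : EE n} (hx : x ∈ coneOf S) :
    0 < infDist x (coneOf S)ᶜ / 2 ∧ closedBall x (infDist x (coneOf S)ᶜ / 2) ⊆ coneOf S := by
  have hne : (coneOf S)ᶜ.Nonempty := ⟨0, fun h => cone_ne h rfl⟩
  have hpos : 0 < infDist x (coneOf S)ᶜ := by
    rw [← (cone_open hS).isClosed_compl.notMem_iff_infDist_pos hne]
    exact fun h => h hx
  refine ⟨by linarith, fun y hy => ?_⟩
  by_contra hh
  have := infDist_le_dist_of_mem (x := x) (show y ∈ (coneOf S)ᶜ from hh)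
  rw [mem_closedBall, dist_comm] at hy
  linarith

lemma FF.vs_eq {n : ℕ} {S : Set (EE n)} (hS : IsSphDomain S) {k : ℝ} {v : EE n → ℝ} (h : FF S k v) {x : EE n} (hx : x ∈ coneOf S)
    {τ : ℝ} (hτ : 0 < τ) (hb : closedBall x (√τ) ⊆ coneOf S) : vs S v x = Nv v x τ / cK n := by
  obtain ⟨h1, h2⟩ := good_ball hS hx
  unfold vs
  congr 1
  rcases le_total ((infDist x (coneOf S)ᶜ / 2) ^ 2) τ with h3 | h3
  · exact h.Nv_const (by positivity) h3 hb
  · refine (h.Nv_const hτ h3 ?_).symm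
    rwa [Real.sqrt_sq h1.le]

lemma FF.vs_le {n : ℕ} {S : Set (EE n)} (hS : IsSphDomain S) {k : ℝ} {v : EE n → ℝ} (h : FF S k v) {x : EE n} (hx : x ∈ coneOf S)
    {τ : ℝ} (hτ : 0 < τ) (hb : √τ < ‖x‖) : vs S v x ≤ Nv v x τ / cK n := by
  obtain ⟨h1, h2⟩ := good_ball hS hx
  have hm : 0 < min τ ((infDist x (coneOf S)ᶜ / 2) ^ 2) := lt_min hτ (by positivity)
  rw [h.vs_eq hS hx hm]
  · exact div_le_div_of_nonneg_right (h.Nv_mono hm (min_le_left _ _) hb) (cK_pos n).le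
  · refine (closedBall_subset_closedBall ?_).trans h2
    calc _ ≤ √((infDist x (coneOf S)ᶜ / 2) ^ 2) := Real.sqrt_le_sqrt (min_le_right _ _)
      _ = _ := Real.sqrt_sq h1.le

lemma FF.vs_nonneg {n : ℕ} {S : Set (EE n)} {k : ℝ} {v : EE n → ℝ} (h : FF S k v) (x : EE n) : 0 ≤ vs S v x :=
  div_nonneg (mul_nonneg (Real.rpow_nonneg (sq_nonneg _) _) (AA_nonneg h.nn 3 x _)) (cK_pos n).le

lemma FF.vs_hom {n : ℕ} {S : Set (EE n)} (hS : IsSphDomain S) {k : ℝ} {v : EE n → ℝ} (h : FF S k v) {x : EE n} (hx : x ∈ coneOf S)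
    {t : ℝ} (ht : 0 < t) : vs S v (t • x) = t ^ k * vs S v x := by
  obtain ⟨h1, h2⟩ := good_ball hS hx
  have hτ : 0 < (infDist x (coneOf S)ᶜ / 2) ^ 2 := by positivity
  rw [h.vs_eq hS ((cone_smul ht).2 hx) (τ := t ^ 2 * (infDist x (coneOf S)ᶜ / 2) ^ 2) (by positivity), h.AA_scale ht hτ, vs]
  · ring
  · rw [← mul_pow, Real.sqrt_sq (by positivity)]
    intro y hy
    have : y = t • (t⁻¹ • y) := by rw [smul_smul, mul_inv_cancel₀ ht.ne', one_smul]
    rw [this, cone_smul ht]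
    apply h2
    rw [mem_closedBall, dist_eq_norm] at hy ⊢
    have h3 : y - t • x = t • (t⁻¹ • y - x) := by rw [smul_sub, smul_smul, mul_inv_cancel₀ ht.ne', one_smul]
    rw [h3, norm_smul, Real.norm_eq_abs, abs_of_pos ht] at hy
    exact le_of_mul_le_mul_left hy ht

lemma FF.vs_cd {n : ℕ} {S : Set (EE n)} (hS : IsSphDomain S) {k : ℝ} {v : EE n → ℝ} (h : FF S k v) {x : EE n} (hx : x ∈ coneOf S) :
    ContDiffAt ℝ 2 (vs S v) x ∧ lap (vs S v) x = 0 := by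
  obtain ⟨h1, h2⟩ := good_ball hS hx
  set r := infDist x (coneOf S)ᶜ / 2 / 2 with hr
  have hr0 : 0 < r := by positivity
  have hbr : ∀ y ∈ ball x r, closedBall y r ⊆ coneOf S := by
    intro y hy
    refine (closedBall_subset_closedBall' ?_).trans h2
    rw [mem_ball] at hy; linarith
  set τ := r ^ 2
  have hτ : 0 < τ := by positivity
  have hs : √τ = r := Real.sqrt_sq hr0.le
  have hev : vs S v =ᶠ[𝓝 x] fun y => ∫ z, v z * ((τ ^ (-ax n) / cK n) * KK 3 τ (y - z)) := by
    filter_upwards [ball_mem_nhds x hr0] with y hy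
    rw [h.vs_eq hS (hbr y hy (mem_closedBall_self hr0.le)) hτ (by rw [hs]; exact hbr y hy), Nv, AA]
    simp only [KK_even 3 τ y]
    rw [mul_div_right_comm, ← integral_const_mul]
    congr 1; ext z; ring
  have hg : ContDiff ℝ 2 (fun z : EE n => (τ ^ (-ax n) / cK n) * KK 3 τ z) := contDiff_const.mul (KK_contDiff 3 le_rfl τ)
  have hc0 : HasCompactSupport (fun z : EE n => KK 3 τ z) := by simpa using KK_hcs (n := n) (m := 3) (by norm_num) τ 0
  have hc : HasCompactSupport (fun z : EE n => (τ ^ (-ax n) / cK n) * KK 3 τ z) := hc0.mul_left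
  refine ⟨((conv_cd h.li hg hc).contDiffAt).congr_of_eventuallyEq hev, ?_⟩
  rw [lap_congr hev, conv_lap h.li hg hc]
  have h3 := h.eq (fun y => (τ ^ (-ax n) / cK n) * KK 3 τ (y - x)) (contDiff_const.mul (KK4_cd 3 le_rfl τ x))
    (HasCompactSupport.mul_left (KK_hcs (by norm_num) τ x)) (by
      refine (closure_mono (Function.support_mul_subset_right _ _)).trans ((KK_tsupport (by norm_num) τ x).trans ?_)
      rw [hs]; exact hbr x (mem_ball_self hr0))
  rw [← h3]
  congr 1; ext y; congr 1
  -- reflection and translation invariance of the Laplacian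
  rw [lap_eq, lap_eq]
  refine Finset.sum_congr rfl fun i _ => ?_
  have hg2 : ContDiff ℝ 2 (fun y => (τ ^ (-ax n) / cK n) * KK 3 τ (y - x)) := contDiff_const.mul (KK4_cd 3 le_rfl τ x)
  have q1 := dd_line (hg.contDiffAt (x := x - y)) (-EuclideanSpace.single i (1:ℝ))
  have q2 := dd_line (hg2.contDiffAt (x := y)) (EuclideanSpace.single i (1:ℝ))
  simp only [map_neg, ContinuousLinearMap.neg_apply, neg_neg] at q1
  rw [q1, q2]
  congr 2; ext t
  rw [← KK_even]
  congr 2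
  rw [smul_neg]; abel

lemma FF.vs_ae {n : ℕ} {S : Set (EE n)} (hS : IsSphDomain S) {k : ℝ} {v : EE n → ℝ} (h : FF S k v) :
    ∀ᵐ x, x ∈ coneOf S → vs S v x = v x := by
  filter_upwards [IsUnifLocDoublingMeasure.ae_tendsto_average_norm_sub (μ := volume) h.li 1] with x hxl hx
  obtain ⟨h1, h2⟩ := good_ball hS hx
  set r := infDist x (coneOf S)ᶜ / 2 with hr
  have hδ : Tendsto (fun δ : ℝ => δ) (𝓝[>] 0) (𝓝[>] 0) := tendsto_id
  have hl := hxl (l := 𝓝[>] (0:ℝ)) (fun _ => x) (fun δ => δ) hδ (by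
    filter_upwards [self_mem_nhdsWithin] with δ hδ
    rw [mem_Ioi] at hδ
    simp [hδ.le])
  set ω := volume.real (closedBall (0 : EE n) 1)
  have hl2 := hl.const_mul (ω / cK n)
  rw [mul_zero] at hl2
  have hb : ∀ᶠ δ in 𝓝[>] (0:ℝ), ‖vs S v x - v x‖ ≤ ω / cK n * ⨍ y in closedBall x δ, ‖v y - v x‖ := by
    filter_upwards [Ioo_mem_nhdsGT h1] with δ hδ
    have hδ0 := hδ.1
    have hτ : 0 < δ ^ 2 := by positivity
    have hs : √(δ ^ 2) = δ := Real.sqrt_sq hδ0.le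
    have e1 : vs S v x = Nv v x (δ ^ 2) / cK n := h.vs_eq hS hx hτ (by
      rw [hs]; exact (closedBall_subset_closedBall hδ.2.le).trans h2)
    have hK := KK_total hτ x
    have hc := cK_pos n
    have hp : 0 < (δ ^ 2) ^ ax n := by positivity
    have e2 : vs S v x - v x = (δ ^ 2) ^ (-ax n) / cK n * ∫ y, (v y - v x) * KK 3 (δ ^ 2) (y - x) := by
      simp only [sub_mul]
      rw [integral_sub (AA_int h.li (by norm_num) x _) ((KK_int (by norm_num) _ x).const_mul _), integral_const_mul, hK, e1, Nv, AA,
        Real.rpow_neg hτ.le]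
      field_simp
    rw [e2, norm_mul, Real.norm_of_nonneg (by positivity)]
    have e3 : ‖∫ y, (v y - v x) * KK 3 (δ ^ 2) (y - x)‖ ≤ ∫ y in closedBall x δ, ‖v y - v x‖ * (δ ^ 2) ^ 3 := by
      refine (norm_integral_le_integral_norm _).trans ?_
      rw [← integral_indicator measurableSet_closedBall]
      have hloc : IntegrableOn (fun y => ‖v y - v x‖ * (δ ^ 2) ^ 3) (closedBall x δ) := by
        have hvi : IntegrableOn v (closedBall x δ) := h.li.integrableOn_isCompact (isCompact_closedBall x δ)
        have hci : IntegrableOn (fun _ : EE n => v x) (closedBall x δ) := integrableOn_const (by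
          exact (isCompact_closedBall x δ).measure_lt_top.ne)
        exact (hvi.sub hci).norm.mul_const _
      refine integral_mono_of_nonneg (ae_of_all _ fun y => norm_nonneg _)
        ((integrable_indicator_iff measurableSet_closedBall).2 hloc) (ae_of_all _ fun y => ?_)
      simp only
      rw [norm_mul, Real.norm_of_nonneg (KK_nonneg _ _ _)]
      by_cases hy : y ∈ closedBall x δ
      · rw [indicator_of_mem hy]
        refine mul_le_mul_of_nonneg_left ?_ (norm_nonneg _)
        unfold KK pp
        refine pow_le_pow_left₀ (le_max_left _ _) (max_le hτ.le ?_) 3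
        nlinarith [norm_nonneg (y - x)]
      · rw [indicator_of_notMem hy, KK_zero (by norm_num), mul_zero]
        rw [mem_closedBall, dist_eq_norm, not_le] at hy
        rw [hs]; exact hy.le
    rw [integral_mul_const] at e3
    have e4 : volume.real (closedBall x δ) = δ ^ n * ω := by
      simp only [ω, measureReal_def]
      rw [Measure.addHaar_closedBall' volume x hδ0.le, ENNReal.toReal_mul, finrank_euclideanSpace_fin,
        ENNReal.toReal_ofReal (by positivity)]
    have hω : 0 < ω := by
      simp only [ω, measureReal_def]
      exact ENNReal.toReal_pos (measure_closedBall_pos volume _ one_pos).ne' (isCompact_closedBall _ _).measure_lt_top.ne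
    have hax : (δ ^ 2) ^ ax n = δ ^ n * (δ ^ 2) ^ 3 := by
      rw [ax, ← Real.rpow_natCast δ n, ← pow_mul, ← Real.rpow_natCast δ 2, ← Real.rpow_natCast δ (2 * 3), ← Real.rpow_mul hδ0.le,
        ← Real.rpow_add hδ0]
      congr 1; push_cast; ring
    rw [setAverage_eq, e4, smul_eq_mul, Real.rpow_neg hτ.le]
    calc ((δ ^ 2) ^ ax n)⁻¹ / cK n * ‖∫ y, (v y - v x) * KK 3 (δ ^ 2) (y - x)‖
        ≤ ((δ ^ 2) ^ ax n)⁻¹ / cK n * ((∫ y in closedBall x δ, ‖v y - v x‖) * (δ ^ 2) ^ 3) :=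
          mul_le_mul_of_nonneg_left e3 (by positivity)
      _ = ω / cK n * ((δ ^ n * ω)⁻¹ * ∫ y in closedBall x δ, ‖v y - v x‖) := by
          rw [hax]; field_simp
  have := ge_of_tendsto hl2 hb
  exact sub_eq_zero.1 (norm_le_zero_iff.1 this)
end

open MeasureTheory Metric Set Filter Topology
open scoped RealInnerProductSpace
noncomputable section

lemma out_ball {n : ℕ} {S : Set (EE n)} (hS : IsC2SphDomain S) {x0 : EE n} (hx : x0 ∈ frontier (coneOf S) \ {0}) :
    ∃ ν : EE n, ‖ν‖ = 1 ∧ ∃ R0 > 0, ∀ R, 0 < R → R ≤ R0 → ∀ y ∈ ball (x0 + (R / 2) • ν) (R / 8), y ∉ coneOf S := by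
  obtain ⟨U, f, hU, hxU, hf, hdf, hcone⟩ := hS.2 x0 hx
  set D := fderiv ℝ f x0 with hD
  have hDp : 0 < ‖D‖ := norm_pos_iff.2 hdf
  set g := (InnerProductSpace.toDual ℝ (EE n)).symm D with hg
  have hgn : ‖g‖ = ‖D‖ := by rw [hg]; exact LinearIsometryEquiv.norm_map _ _
  have hDg : ∀ y, D y = inner ℝ g y := fun y => by rw [hg, InnerProductSpace.toDual_symm_apply]
  have hx0 : 0 ≤ f x0 := by
    by_contra hc
    push Not at hc
    have : x0 ∈ coneOf S ∩ U := by rw [hcone]; exact ⟨hxU, hc⟩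
    have h2 := hx.1
    rw [(cone_open hS.1).frontier_eq] at h2
    exact h2.2 this.1
  have hfd : HasFDerivAt f D x0 := (hf.differentiable (by norm_num) x0).hasFDerivAt
  have hlit := (hasFDerivAt_iff_isLittleO.1 hfd).def (show 0 < ‖D‖ / 2 by positivity)
  obtain ⟨δ, hδ, hb⟩ := Metric.eventually_nhds_iff_ball.1 (hlit.and (hU.mem_nhds hxU))
  refine ⟨‖g‖⁻¹ • g, ?_, δ, hδ, ?_⟩
  · rw [norm_smul, norm_inv, norm_norm, inv_mul_cancel₀ (by rw [hgn]; exact hDp.ne')]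
  intro R hR hRd y hy hyc
  set ν := ‖g‖⁻¹ • g with hν
  have hν1 : ‖ν‖ = 1 := by
    rw [hν, norm_smul, norm_inv, norm_norm, inv_mul_cancel₀ (by rw [hgn]; exact hDp.ne')]
  have hDν : D ν = ‖D‖ := by
    rw [hDg, hν, inner_smul_right, real_inner_self_eq_norm_sq, hgn]
    field_simp
  set e := y - (x0 + (R / 2) • ν) with he
  have hen : ‖e‖ < R / 8 := by rwa [mem_ball, dist_eq_norm] at hy
  have hyx : y - x0 = (R / 2) • ν + e := by rw [he]; abel
  have hyn : ‖y - x0‖ < 5 / 8 * R := by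
    rw [hyx]
    refine (norm_add_le _ _).trans_lt ?_
    rw [norm_smul, hν1, Real.norm_eq_abs, abs_of_pos (by positivity)]
    linarith
  have hyb : y ∈ ball x0 δ := by rw [mem_ball, dist_eq_norm]; linarith
  obtain ⟨h1, h2⟩ := hb y hyb
  have hfy : f y < 0 := by
    have : y ∈ coneOf S ∩ U := ⟨hyc, h2⟩
    rw [hcone] at this
    exact this.2
  have hDy : D (y - x0) ≥ ‖D‖ * (3 / 8 * R) := by
    rw [hyx, map_add, map_smul, hDν, smul_eq_mul]
    have := D.le_opNorm e
    have h3 := (abs_le.1 (show |D e| ≤ ‖D‖ * ‖e‖ from this)).1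
    nlinarith
  rw [Real.norm_eq_abs] at h1
  have h4 := (abs_le.1 h1).1
  nlinarith

def c0 (n : ℕ) : ℝ := min (1 / 2) ((7 / 16) ^ 3 * ((1 / 8) ^ n * volume.real (ball (0 : EE n) 1)) / cK n)

lemma c0_pos (n : ℕ) : 0 < c0 n := by
  refine lt_min (by norm_num) (div_pos ?_ (cK_pos n))
  have : 0 < volume.real (ball (0 : EE n) 1) := by
    rw [Measure.real]
    exact ENNReal.toReal_pos (measure_ball_pos _ _ one_pos).ne' measure_ball_lt_top.ne
  positivity

lemma KK_lower {n : ℕ} {R : ℝ} (hR : 0 < R) {x z : EE n} (hxz : dist x z ≤ 5 / 8 * R) :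
    (7 / 16) ^ 3 * ((1 / 8) ^ n * volume.real (ball (0 : EE n) 1)) * (R ^ 2) ^ ax n ≤
      ∫ y in ball z (R / 8), KK 3 (R ^ 2) (y - x) := by
  have hvol : volume.real (ball z (R / 8)) = (R / 8) ^ n * volume.real (ball (0 : EE n) 1) := by
    have := Measure.addHaar_ball_of_pos (volume : Measure (EE n)) z (show 0 < R / 8 by positivity)
    rw [Measure.real, this, ENNReal.toReal_mul, ENNReal.toReal_ofReal (by positivity)]; simp [Measure.real]
  have hpow : (R ^ 2) ^ ax n = R ^ 6 * R ^ n := by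
    rw [ax, Real.rpow_add (by positivity), ← Real.rpow_natCast R 6, ← Real.rpow_natCast R n, ← Real.rpow_natCast R 2,
      ← Real.rpow_mul hR.le, ← Real.rpow_mul hR.le]
    congr 2 <;> push_cast <;> ring
  have hc : ∫ y in ball z (R / 8), (7 / 16 * R ^ 2) ^ 3 = (7 / 16 * R ^ 2) ^ 3 * ((R / 8) ^ n * volume.real (ball (0 : EE n) 1)) := by
    rw [setIntegral_const, smul_eq_mul, hvol]; ring
  have e : (7 / 16) ^ 3 * ((1 / 8) ^ n * volume.real (ball (0 : EE n) 1)) * (R ^ 2) ^ ax n =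
      (7 / 16 * R ^ 2) ^ 3 * ((R / 8) ^ n * volume.real (ball (0 : EE n) 1)) := by
    rw [hpow, div_pow R 8 n, div_pow 1 8 n]; ring
  rw [e, ← hc]
  refine setIntegral_mono_on (integrableOn_const (measure_ball_lt_top.ne)) (KK_int (by norm_num) _ _).integrableOn measurableSet_ball fun y hy => ?_
  have hd : ‖y - x‖ ≤ 3 / 4 * R := by
    rw [← dist_eq_norm]
    have := dist_triangle y z x
    rw [dist_comm z x] at this
    rw [mem_ball] at hy
    linarith
  unfold KK pp
  refine pow_le_pow_left₀ (by positivity) (le_max_of_le_right ?_) 3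
  nlinarith [norm_nonneg (y - x)]

lemma FF.step {n : ℕ} {S : Set (EE n)} (hS : IsSphDomain S) {k : ℝ} {v : EE n → ℝ} (h : FF S k v) {x0 ν : EE n}
    (hν : ‖ν‖ = 1) {R : ℝ} (hR : 0 < R) (hR0 : R < ‖x0‖ / 2) (hb : ∀ y ∈ ball (x0 + (R / 2) • ν) (R / 8), y ∉ coneOf S)
    {B : ℝ} (hB : 0 ≤ B) (hvb : ∀ y ∈ coneOf S, dist y x0 < 9 / 8 * R → vs S v y ≤ B)
    {x : EE n} (hx : x ∈ coneOf S) (hxd : dist x x0 < R / 8) : vs S v x ≤ (1 - c0 n) * B := by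
  set z := x0 + (R / 2) • ν with hz
  have hxz : dist x z ≤ 5 / 8 * R := by
    have h1 : dist x0 z = R / 2 := by
      rw [hz, dist_eq_norm]; simp [norm_smul, hν, abs_of_pos hR]
    linarith [dist_triangle x x0 z]
  have hnx : R < ‖x‖ := by
    have := norm_sub_norm_le x0 x
    rw [← dist_eq_norm, dist_comm] at this
    linarith
  have hle := h.vs_le hS hx (τ := R ^ 2) (by positivity) (by rw [Real.sqrt_sq hR.le]; exact hnx)
  have hKi := KK_int (m := 3) (by norm_num) (R ^ 2) x
  have hAA : AA 3 v x (R ^ 2) ≤ B * (∫ y, KK 3 (R ^ 2) (y - x)) - B * ∫ y in ball z (R / 8), KK 3 (R ^ 2) (y - x) := by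
    rw [← integral_const_mul, ← integral_const_mul, ← integral_indicator measurableSet_ball, ← integral_sub (hKi.const_mul B)
      ((hKi.const_mul B).indicator measurableSet_ball)]
    refine integral_mono_ae (AA_int h.li (by norm_num) x _) ((hKi.const_mul B).sub
      ((hKi.const_mul B).indicator measurableSet_ball)) ?_
    filter_upwards [h.vs_ae hS] with y hy
    by_cases hyz : y ∈ ball z (R / 8)
    · simp only [indicator_of_mem hyz, h.off y (hb y hyz)]; simp
    · simp only [indicator_of_notMem hyz, sub_zero]
      by_cases hyx : R ≤ ‖y - x‖
      · rw [KK_zero (by norm_num) (by rw [Real.sqrt_sq hR.le]; exact hyx)]; simp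
      · refine mul_le_mul_of_nonneg_right ?_ (KK_nonneg _ _ _)
        by_cases hyc : y ∈ coneOf S
        · rw [← hy hyc]
          refine hvb y hyc ?_
          push Not at hyx
          rw [← dist_eq_norm] at hyx
          linarith [dist_triangle y x x0]
        · rw [h.off y hyc]; exact hB
  rw [KK_total (by positivity)] at hAA
  have hlow := KK_lower hR hxz
  refine hle.trans ?_
  have hτ : 0 < (R ^ 2) ^ ax n := by positivity
  have hc := cK_pos n
  have hcc : c0 n * cK n ≤ (7 / 16) ^ 3 * ((1 / 8) ^ n * volume.real (ball (0 : EE n) 1)) := by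
    have := min_le_right (1 / 2) ((7 / 16) ^ 3 * ((1 / 8) ^ n * volume.real (ball (0 : EE n) 1)) / cK n)
    rw [le_div_iff₀ hc] at this
    exact this
  rw [div_le_iff₀ hc, Nv, Real.rpow_neg (by positivity), inv_mul_le_iff₀ hτ]
  refine hAA.trans ?_
  have h5 := mul_le_mul_of_nonneg_right hcc hτ.le
  have h6 := mul_le_mul_of_nonneg_left (h5.trans hlow) hB
  nlinarith

lemma FF.vs_bdd {n : ℕ} {S : Set (EE n)} (hS : IsSphDomain S) {k : ℝ} {v : EE n → ℝ} (h : FF S k v) {x0 : EE n}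
    {R : ℝ} (hR : 0 < R) (hR0 : R < ‖x0‖ / 4) : ∃ B, 0 ≤ B ∧ ∀ x ∈ coneOf S, dist x x0 < 9 / 8 * R → vs S v x ≤ B := by
  have hc := cK_pos n
  have hint : IntegrableOn v (closedBall x0 (3 * R)) := h.li.integrableOn_isCompact (isCompact_closedBall _ _)
  have hnn : 0 ≤ ∫ y in closedBall x0 (3 * R), v y := integral_nonneg h.nn
  refine ⟨(R ^ 2) ^ (-ax n) * ((R ^ 2) ^ 3 * ∫ y in closedBall x0 (3 * R), v y) / cK n, by positivity, fun x hx hd => ?_⟩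
  have hnx : R < ‖x‖ := by
    have := norm_sub_norm_le x0 x
    rw [← dist_eq_norm, dist_comm] at this
    linarith
  refine (h.vs_le hS hx (τ := R ^ 2) (by positivity) (by rw [Real.sqrt_sq hR.le]; exact hnx)).trans ?_
  refine div_le_div_of_nonneg_right ?_ hc.le
  refine mul_le_mul_of_nonneg_left ?_ (by positivity)
  rw [← integral_const_mul, ← integral_indicator measurableSet_closedBall]
  refine integral_mono (AA_int h.li (by norm_num) x _) (IntegrableOn.integrable_indicator (hint.const_mul _) measurableSet_closedBall) fun y => ?_
  by_cases hy : y ∈ closedBall x0 (3 * R)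
  · simp only [indicator_of_mem hy]
    rw [mul_comm]
    refine mul_le_mul_of_nonneg_right ?_ (h.nn y)
    unfold KK pp
    refine pow_le_pow_left₀ (le_max_left _ _) (max_le (by positivity) ?_) 3
    nlinarith [sq_nonneg ‖y - x‖]
  · simp only [indicator_of_notMem hy]
    rw [KK_zero (by norm_num), mul_zero]
    rw [Real.sqrt_sq hR.le, ← dist_eq_norm]
    rw [mem_closedBall] at hy
    push Not at hy
    linarith [dist_triangle y x x0]

lemma FF.vs_bdry {n : ℕ} {S : Set (EE n)} (hS : IsC2SphDomain S) {k : ℝ} {v : EE n → ℝ} (h : FF S k v) {x0 : EE n}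
    (hx0 : x0 ∈ frontier (coneOf S) \ {0}) : Tendsto (vs S v) (𝓝[coneOf S] x0) (𝓝 0) := by
  obtain ⟨ν, hν, R0, hR0, hball⟩ := out_ball hS hx0
  have hxp : 0 < ‖x0‖ := norm_pos_iff.2 hx0.2
  set R := min R0 (‖x0‖ / 5) with hRdef
  have hR : 0 < R := lt_min hR0 (by positivity)
  have hR5 : R ≤ ‖x0‖ / 5 := min_le_right _ _
  obtain ⟨B, hB, hvB⟩ := h.vs_bdd hS.1 hR (x0 := x0) (by linarith)
  have hc0 := c0_pos n
  have hc1 : c0 n ≤ 1 / 2 := min_le_left _ _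
  have key : ∀ j : ℕ, ∀ x ∈ coneOf S, dist x x0 < 9 / 8 * (R * (1 / 9) ^ j) → vs S v x ≤ (1 - c0 n) ^ j * B := by
    intro j
    induction j with
    | zero => simpa using hvB
    | succ j ih =>
      intro x hx hd
      have hp : (0 : ℝ) < (1 / 9) ^ j := by positivity
      have hp1 : (1 / 9 : ℝ) ^ j ≤ 1 := pow_le_one₀ (by norm_num) (by norm_num)
      have hRj : R * (1 / 9) ^ j ≤ R := mul_le_of_le_one_right hR.le hp1
      have := h.step hS.1 (x0 := x0) hν (R := R * (1 / 9) ^ j) (by positivity) (by linarith)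
        (hball _ (by positivity) (hRj.trans (min_le_left _ _)))
        (B := (1 - c0 n) ^ j * B) (mul_nonneg (pow_nonneg (by linarith) _) hB) ih hx ?_
      · rw [pow_succ]; linarith
      · rw [pow_succ] at hd; linarith
  rw [Metric.tendsto_nhds]
  intro ε hε
  have hlim : Tendsto (fun j : ℕ => (1 - c0 n) ^ j * B) atTop (𝓝 0) := by
    simpa using (tendsto_pow_atTop_nhds_zero_of_lt_one (show 0 ≤ 1 - c0 n by linarith) (by linarith)).mul_const B
  obtain ⟨j, hj⟩ := (hlim.eventually_lt_const hε).exists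
  have hpos : 0 < 9 / 8 * (R * (1 / 9) ^ j) := by positivity
  filter_upwards [self_mem_nhdsWithin, mem_nhdsWithin_of_mem_nhds (ball_mem_nhds x0 hpos)] with x hx hxb
  rw [Real.dist_eq, sub_zero, abs_of_nonneg (h.vs_nonneg x)]
  exact (key j x hx hxb).trans_lt hj

end

open MeasureTheory Metric Set Filter Topology
open scoped RealInnerProductSpace
noncomputable section

lemma hom_derivs {n : ℕ} {f : EE n → ℝ} {σ : EE n} {k : ℝ} (hf : ContDiffAt ℝ 2 f σ)
    (hh : ∀ t : ℝ, 0 < t → f (t • σ) = t ^ k * f σ) :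
    fderiv ℝ f σ σ = k * f σ ∧ dd f σ σ σ = k * (k - 1) * f σ := by
  have hev : ∀ᶠ t : ℝ in 𝓝 0, 0 < 1 + t := by
    have : Tendsto (fun t : ℝ => 1 + t) (𝓝 0) (𝓝 (1 + 0)) := by
      exact tendsto_const_nhds.add tendsto_id
    exact this.eventually_const_lt (by norm_num)
  have hg : (fun t : ℝ => f (σ + t • σ)) =ᶠ[𝓝 0] fun t => (1 + t) ^ k * f σ := by
    filter_upwards [hev] with t ht
    rw [← hh _ ht, add_smul, one_smul]
  have hd : ∀ (j t : ℝ), 0 < 1 + t → HasDerivAt (fun t : ℝ => (1 + t) ^ j) (j * (1 + t) ^ (j - 1)) t := by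
    intro j t ht
    have h1 : HasDerivAt (fun t : ℝ => 1 + t) 1 t := (hasDerivAt_id t).const_add 1
    have := h1.rpow_const (p := j) (Or.inl ht.ne')
    refine this.congr_deriv (by ring)
  constructor
  · have h1 : HasDerivAt (fun t : ℝ => f (σ + t • σ)) (fderiv ℝ f σ σ) 0 := by
      have hl : HasDerivAt (fun t : ℝ => σ + t • σ) σ 0 := by
        have := ((hasDerivAt_id (0 : ℝ)).smul_const σ).const_add σ
        simpa using this
      have hfd : HasFDerivAt f (fderiv ℝ f σ) (σ + (0 : ℝ) • σ) := by
        rw [zero_smul, add_zero]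
        exact (hf.differentiableAt (by norm_num)).hasFDerivAt
      exact hfd.comp_hasDerivAt 0 hl
    have h2 := ((hd k 0 (by norm_num)).mul_const (f σ)).congr_of_eventuallyEq hg
    rw [h1.unique h2]; simp
  · rw [dd_line hf]
    have h3 : deriv (fun t : ℝ => f (σ + t • σ)) =ᶠ[𝓝 0] fun t => k * (1 + t) ^ (k - 1) * f σ := by
      refine hg.deriv.trans ?_
      filter_upwards [hev] with t ht
      exact ((hd k t ht).mul_const (f σ)).deriv
    rw [h3.deriv_eq, (((hd (k - 1) 0 (by norm_num)).const_mul k).mul_const (f σ)).deriv]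
    simp

lemma FF.eig {n : ℕ} {S : Set (EE n)} (hS : IsC2SphDomain S) {k : ℝ} {v : EE n → ℝ} (h : FF S k v)
    (hk : k * (k + n - 2) = lam1 S) : lam1 S ∈ spec S := by
  have hCo := cone_open hS.1
  set Φ := (coneOf S).indicator (vs S v) with hΦ
  have hev : ∀ x ∈ coneOf S, Φ =ᶠ[𝓝 x] vs S v := fun x hx => by
    filter_upwards [hCo.mem_nhds hx] with y hy using indicator_of_mem hy _
  have hcd : ∀ x ∈ coneOf S, ContDiffAt ℝ 2 Φ x := fun x hx =>
    (h.vs_cd hS.1 hx).1.congr_of_eventuallyEq (hev x hx)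
  have hcont : ∀ x : EE n, x ≠ 0 → ContinuousAt Φ x := by
    intro x hx0
    by_cases hx : x ∈ coneOf S
    · exact (hcd x hx).continuousAt
    · have hΦx : Φ x = 0 := indicator_of_notMem hx _
      rw [ContinuousAt, hΦx, ← nhdsWithin_univ, ← union_compl_self (coneOf S), nhdsWithin_union]
      refine Tendsto.sup ?_ ?_
      · by_cases hxc : x ∈ closure (coneOf S)
        · refine (h.vs_bdry hS ⟨⟨hxc, by rwa [hCo.interior_eq]⟩, hx0⟩).congr' ?_
          filter_upwards [self_mem_nhdsWithin] with y hy using (indicator_of_mem hy _).symm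
        · rw [notMem_closure_iff_nhdsWithin_eq_bot.1 hxc]; exact tendsto_bot
      · refine tendsto_const_nhds.congr' ?_
        filter_upwards [self_mem_nhdsWithin] with y hy using (indicator_of_notMem hy _).symm
  have hnz : ∀ x : EE n, x ≠ 0 → ‖x‖⁻¹ • x ≠ 0 := fun x hx => smul_ne_zero (inv_ne_zero (norm_ne_zero_iff.2 hx)) hx
  have hsp : ∀ σ ∈ S, ‖σ‖ = 1 := fun σ hσ => by simpa using hS.1.1 hσ
  have hmem : ∀ σ ∈ S, σ ∈ coneOf S := fun σ hσ => (mem_cone_sph (hsp σ hσ)).2 hσ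
  refine ⟨Φ, ?_, ?_, ?_, ?_, ?_⟩
  · intro x hx
    exact (ContinuousAt.comp (f := fun y : EE n => ‖y‖⁻¹ • y) (hcont _ (hnz x hx.1)) (nrm_contDiffAt hx.1 1).continuousAt).continuousWithinAt
  · intro x hx
    refine ContDiffAt.contDiffWithinAt ?_
    exact ContDiffAt.comp (f := fun y : EE n => ‖y‖⁻¹ • y) x (hcd _ (hmem _ hx.2)) (nrm_contDiffAt hx.1 2)
  · intro σ hσ
    refine indicator_of_notMem (fun hc => hσ.2 ?_) _
    exact (mem_cone_sph (by simpa using closure_sph hS.1 hσ.1)).1 hc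
  · by_contra hc
    push Not at hc
    have hz : ∀ x ∈ coneOf S, vs S v x = 0 := by
      intro x hx
      have h1 := hc _ hx.2
      have hxp : 0 < ‖x‖ := norm_pos_iff.2 hx.1
      have h2 := h.vs_hom hS.1 hx (inv_pos.2 hxp)
      rw [hΦ, indicator_of_mem (hmem _ hx.2)] at h1
      rw [h1] at h2
      have : 0 < ‖x‖⁻¹ ^ k := Real.rpow_pos_of_pos (inv_pos.2 hxp) _
      rcases mul_eq_zero.1 h2.symm with h3 | h3
      · exact absurd h3 this.ne'
      · exact h3
    have hv0 : ∀ᵐ x, v x = 0 := by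
      filter_upwards [h.vs_ae hS.1] with x hx
      by_cases hxc : x ∈ coneOf S
      · rw [← hx hxc, hz x hxc]
      · exact h.off x hxc
    have : ∫ x in ball 0 1, v x = 0 := integral_eq_zero_of_ae (ae_restrict_of_ae hv0)
    exact absurd h.pos (by rw [this]; exact lt_irrefl _)
  · intro σ hσ
    have hσ1 := hsp σ hσ
    have hσc := hmem σ hσ
    have hσ0 : σ ≠ 0 := hσc.1
    obtain ⟨hc2, hl⟩ := h.vs_cd hS.1 hσc
    have e1 : sphLap Φ σ = lap (fun y => vs S v ((1 : ℝ) • ‖y‖⁻¹ • y)) σ := by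
      unfold sphLap
      refine lap_congr ?_
      filter_upwards [hCo.mem_nhds hσc] with y hy
      rw [one_smul, hΦ, indicator_of_mem (hmem _ hy.2)]
    have e2 := polar_lap (f := vs S v) (σ := σ) (ρ := 1) one_pos hσ1 (by rwa [one_smul])
    rw [one_smul, hl] at e2
    obtain ⟨d1, d2⟩ := hom_derivs hc2 fun t ht => h.vs_hom hS.1 hσc ht
    rw [d1, d2] at e2
    rw [e1, ← hk, hΦ, indicator_of_mem hσc]
    simp only [one_pow, inv_one, one_mul, div_one] at e2
    linarith

lemma spec_le {n : ℕ} (hn : 2 ≤ n) {S : Set (EE n)} (hS : IsC2SphDomain S) : sInf (spec S) ≤ lam1 S := by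
  obtain ⟨k, v, _, hk, h⟩ := FF_exists hn hS.1
  by_cases hb : BddBelow (spec S)
  · exact csInf_le hb (h.eig hS hk)
  · rw [Real.sInf_of_not_bddBelow hb]; exact lam1_nonneg S

end

open MeasureTheory Metric Set Filter Topology
open scoped RealInnerProductSpace
noncomputable section

lemma lap_sub' {n : ℕ} {f g : EE n → ℝ} {x : EE n} (hf : ContDiffAt ℝ 2 f x) (hg : ContDiffAt ℝ 2 g x) :
    lap (fun y => f y - g y) x = lap f x - lap g x := by
  have : (fun y => f y - g y) = f - g := rfl
  unfold lap
  rw [this, ← Finset.sum_sub_distrib]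
  refine Finset.sum_congr rfl fun i _ => ?_
  rw [iteratedFDeriv_sub_apply hf hg]; rfl

lemma lap_cmul {n : ℕ} {f : EE n → ℝ} {x : EE n} (c : ℝ) (hf : ContDiffAt ℝ 2 f x) :
    lap (fun y => c * f y) x = c * lap f x := by
  have : (fun y => c * f y) = c • f := rfl
  unfold lap
  rw [this, Finset.mul_sum]
  refine Finset.sum_congr rfl fun i _ => ?_
  rw [iteratedFDeriv_const_smul_apply hf]; rfl

lemma glue {g g1 g2 : ℝ → ℝ} (hg : ContDiffOn ℝ 1 g (Ici 0)) (h0 : g 0 = 0) (h0' : derivWithin g (Ici 0) 0 = 0)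
    (h1 : ∀ s, 0 < s → HasDerivAt g (g1 s) s) (h2 : ∀ s, 0 < s → HasDerivAt g1 (g2 s) s) :
    (∀ s, HasDerivAt ((Ioi 0).indicator g) ((Ioi 0).indicator g1 s) s) ∧
    (∀ s, s ≠ 0 → HasDerivAt ((Ioi 0).indicator g1) ((Ioi 0).indicator g2 s) s) ∧
    Continuous ((Ioi 0).indicator g1) := by
  have evp : ∀ (f : ℝ → ℝ) (s : ℝ), 0 < s → (Ioi 0).indicator f =ᶠ[𝓝 s] f := fun f s hs => by
    filter_upwards [Ioi_mem_nhds hs] with t ht using indicator_of_mem ht _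
  have evn : ∀ (f : ℝ → ℝ) (s : ℝ), s < 0 → (Ioi 0).indicator f =ᶠ[𝓝 s] fun _ => 0 := fun f s hs => by
    filter_upwards [Iio_mem_nhds hs] with t ht using indicator_of_notMem (not_lt.2 (le_of_lt ht)) _
  have pos : ∀ (f f' : ℝ → ℝ) (s : ℝ), 0 < s → HasDerivAt f (f' s) s → HasDerivAt ((Ioi 0).indicator f) ((Ioi 0).indicator f' s) s := by
    intro f f' s hs h
    rw [indicator_of_mem (show s ∈ Ioi 0 from hs)]
    exact h.congr_of_eventuallyEq (evp f s hs)
  have neg : ∀ (f f' : ℝ → ℝ) (s : ℝ), s < 0 → HasDerivAt ((Ioi 0).indicator f) ((Ioi 0).indicator f' s) s := by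
    intro f f' s hs
    rw [indicator_of_notMem (show s ∉ Ioi 0 from not_lt.2 hs.le)]
    exact (hasDerivAt_const s (0 : ℝ)).congr_of_eventuallyEq (evn f s hs)
  have n0 : ∀ f : ℝ → ℝ, (Ioi (0 : ℝ)).indicator f 0 = 0 := fun f => indicator_of_notMem (lt_irrefl _) _
  have hs1 : ∀ s, s ≠ 0 → HasDerivAt ((Ioi 0).indicator g1) ((Ioi 0).indicator g2 s) s := by
    intro s hs
    rcases lt_or_gt_of_ne hs with h | h
    · exact neg _ _ s h
    · exact pos _ _ s h (h2 s h)
  refine ⟨fun s => ?_, hs1, ?_⟩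
  · rcases lt_trichotomy s 0 with h | h | h
    · exact neg _ _ s h
    · subst h
      rw [n0]
      have hr : HasDerivWithinAt ((Ioi 0).indicator g) 0 (Ici 0) 0 := by
        have := ((hg.differentiableOn (by norm_num)) 0 self_mem_Ici).hasDerivWithinAt
        rw [h0'] at this
        refine this.congr (fun t ht => ?_) ?_
        · rcases (show (0 : ℝ) ≤ t from ht).eq_or_lt with h | h
          · rw [← h, n0, h0]
          · exact indicator_of_mem h _
        · rw [n0, h0]
      have hl : HasDerivWithinAt ((Ioi 0).indicator g) 0 (Iic 0) 0 := by
        refine (hasDerivWithinAt_const (0 : ℝ) (Iic 0) (0 : ℝ)).congr (fun t ht => ?_) (n0 g)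
        exact indicator_of_notMem (not_lt.2 ht) _
      have := hl.union hr
      rwa [Iic_union_Ici, hasDerivWithinAt_univ] at this
    · exact pos _ _ s h (h1 s h)
  · rw [continuous_iff_continuousAt]
    intro s
    by_cases hs : s = 0
    · subst hs
      rw [ContinuousAt, n0]
      suffices hh : Tendsto ((Ioi 0).indicator g1) (𝓝[≤] (0 : ℝ) ⊔ 𝓝[>] (0 : ℝ)) (𝓝 0) by
        rwa [nhdsLE_sup_nhdsGT] at hh
      refine Tendsto.sup ?_ ?_
      · refine (tendsto_const_nhds (x := (0 : ℝ))).congr' ?_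
        filter_upwards [self_mem_nhdsWithin] with t ht using (indicator_of_notMem (not_lt.2 ht) _).symm
      · have hc := (hg.continuousOn_derivWithin (uniqueDiffOn_Ici 0) le_rfl) 0 self_mem_Ici
        rw [ContinuousWithinAt, h0'] at hc
        refine (hc.mono_left (nhdsWithin_mono _ Ioi_subset_Ici_self)).congr' ?_
        filter_upwards [self_mem_nhdsWithin] with t ht
        rw [indicator_of_mem ht, derivWithin_of_mem_nhds (Ici_mem_nhds ht), (h1 t ht).deriv]
    · exact (hs1 s hs).continuousAt

/-- Common setting for the interior and the exterior domain. -/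
structure Cx {n : ℕ} (S Ω : Set (EE n)) (ε : ℝ) (u : EE n → ℝ) : Prop where
  hn : 2 ≤ n
  hS : IsSphDomain S
  he : ε = 1 ∨ ε = -1
  hO : ∀ x, x ∈ Ω ↔ x ∈ coneOf S ∧ 0 < ε * Real.log ‖x‖
  hu : NavierAdm Ω u
  hg : ∀ x ∈ Metric.sphere (0 : EE n) 1 ∩ frontier Ω, fderivWithin ℝ u (closure Ω) x = 0

namespace Cx
variable {n : ℕ} {S Ω : Set (EE n)} {ε : ℝ} {u : EE n → ℝ}

lemma e2 (C : Cx S Ω ε u) : ε ^ 2 = 1 := by rcases C.he with h | h <;> rw [h] <;> norm_num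
lemma e0 (C : Cx S Ω ε u) : ε ≠ 0 := by rcases C.he with h | h <;> rw [h] <;> norm_num
lemma ea (C : Cx S Ω ε u) : |ε| = 1 := by rcases C.he with h | h <;> rw [h] <;> norm_num

lemma nexp {σ : EE n} (hσ : ‖σ‖ = 1) (s : ℝ) : ‖Real.exp (ε * s) • σ‖ = Real.exp (ε * s) := by
  rw [norm_smul, hσ, mul_one, Real.norm_eq_abs, abs_of_pos (Real.exp_pos _)]

lemma mem (C : Cx S Ω ε u) {σ : EE n} (hσ : ‖σ‖ = 1) (s : ℝ) : Real.exp (ε * s) • σ ∈ Ω ↔ σ ∈ coneOf S ∧ 0 < s := by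
  rw [C.hO, cone_smul (Real.exp_pos _), nexp hσ, Real.log_exp, ← mul_assoc, ← sq, C.e2, one_mul]

lemma op (C : Cx S Ω ε u) : IsOpen Ω := by
  have h1 : Ω = coneOf S ∩ {x | x ≠ 0 ∧ 0 < ε * Real.log ‖x‖} := by
    ext x
    rw [C.hO]
    constructor
    · rintro ⟨a, b⟩; exact ⟨a, a.1, b⟩
    · rintro ⟨a, _, b⟩; exact ⟨a, b⟩
  rw [h1]
  refine (cone_open C.hS).inter ?_
  have hc : ContinuousOn (fun x : EE n => ε * Real.log ‖x‖) {x | x ≠ 0} := fun x hx =>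
    (continuousAt_const.mul ((continuous_norm.continuousAt).log (norm_ne_zero_iff.2 hx))).continuousWithinAt
  exact hc.isOpen_inter_preimage isOpen_ne isOpen_Ioi

lemma cl (C : Cx S Ω ε u) {σ : EE n} (hσ : σ ∈ closure S) {s : ℝ} (hs : 0 ≤ s) : Real.exp (ε * s) • σ ∈ closure Ω := by
  have hpos : ∀ s, 0 < s → Real.exp (ε * s) • σ ∈ closure Ω := by
    intro s hs
    have hc : Continuous fun y : EE n => Real.exp (ε * s) • y := by fun_prop
    refine map_mem_closure hc hσ fun y hy => ?_
    have hy1 : ‖y‖ = 1 := by simpa using C.hS.1 hy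
    exact (C.mem hy1 s).2 ⟨(mem_cone_sph hy1).2 hy, hs⟩
  rcases hs.eq_or_lt with h | h
  · subst h
    have hc : Tendsto (fun s : ℝ => Real.exp (ε * s) • σ) (𝓝[>] 0) (𝓝 (Real.exp (ε * 0) • σ)) :=
      (Continuous.tendsto (by fun_prop) 0).mono_left nhdsWithin_le_nhds
    refine isClosed_closure.mem_of_tendsto hc ?_
    filter_upwards [self_mem_nhdsWithin] with s hs using hpos s hs
  · exact hpos s h

lemma cdO (C : Cx S Ω ε u) {x : EE n} (hx : x ∈ Ω) : ContDiffAt ℝ 2 u x :=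
  (C.hu.1 x (subset_closure hx)).contDiffAt (mem_of_superset (C.op.mem_nhds hx) subset_closure)

lemma far (C : Cx S Ω ε u) : ∃ R, 0 < R ∧ ∀ s, R ≤ s → ∀ σ : EE n, ‖σ‖ = 1 → u =ᶠ[𝓝 (Real.exp (ε * s) • σ)] fun _ => 0 := by
  obtain ⟨_, _, ⟨r, hr, h0⟩, ⟨R', hR⟩⟩ := C.hu
  rcases C.he with h | h
  · refine ⟨|R'| + 1, by positivity, fun s hs σ hσ => ?_⟩
    have h1 : R' < ‖Real.exp (ε * s) • σ‖ := by
      rw [nexp hσ, h, one_mul]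
      linarith [Real.add_one_le_exp s, le_abs_self R']
    filter_upwards [continuous_norm.continuousAt.eventually_const_lt h1] with y hy using hR y hy
  · refine ⟨|Real.log r| + 1, by positivity, fun s hs σ hσ => ?_⟩
    have h1 : ‖Real.exp (ε * s) • σ‖ < r := by
      rw [nexp hσ, h, ← Real.lt_log_iff_exp_lt hr]
      linarith [neg_abs_le (Real.log r)]
    filter_upwards [continuous_norm.continuousAt.eventually_lt_const h1] with y hy using h0 y hy

end Cx

def gI {n : ℕ} (S : Set (EE n)) (F : EE n → ℝ → ℝ) (p : Sph n) (s : ℝ) : ℝ :=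
  open Classical in if (p : EE n) ∈ coneOf S ∧ 0 < s then F p s else 0

lemma gI_pos {n : ℕ} {S : Set (EE n)} {F : EE n → ℝ → ℝ} {p : Sph n} {s : ℝ} (hp : (p : EE n) ∈ coneOf S) (hs : 0 < s) :
    gI S F p s = F p s := if_pos ⟨hp, hs⟩
lemma gI_neg {n : ℕ} {S : Set (EE n)} {F : EE n → ℝ → ℝ} {p : Sph n} {s : ℝ} (h : ¬ ((p : EE n) ∈ coneOf S ∧ 0 < s)) :
    gI S F p s = 0 := if_neg h

lemma gI_ind {n : ℕ} {S : Set (EE n)} {F : EE n → ℝ → ℝ} {p : Sph n} (hp : (p : EE n) ∈ coneOf S) :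
    gI S F p = (Ioi 0).indicator (F p) := by
  ext s
  by_cases hs : 0 < s
  · rw [gI_pos hp hs, indicator_of_mem (show s ∈ Ioi 0 from hs)]
  · rw [gI_neg fun h => hs h.2, indicator_of_notMem (show s ∉ Ioi 0 from hs)]

lemma gI_meas {n : ℕ} {S : Set (EE n)} (hS : IsSphDomain S) {F : EE n → ℝ → ℝ}
    (hF : ContinuousOn (fun q : Sph n × ℝ => F q.1 q.2) (AS S ×ˢ Ioi 0)) :
    Measurable fun q : Sph n × ℝ => gI S F q.1 q.2 := by
  classical
  have hm : MeasurableSet (AS S ×ˢ Ioi (0 : ℝ)) := (AS_meas hS).prod measurableSet_Ioi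
  have := hF.measurable_piecewise (g := fun _ => (0 : ℝ)) continuousOn_const hm
  have e : (fun q : Sph n × ℝ => gI S F q.1 q.2) = (AS S ×ˢ Ioi 0).piecewise (fun q : Sph n × ℝ => F q.1 q.2) fun _ => 0 := ?_
  · rw [e]; exact this
  refine funext fun q => ?_
  by_cases h : q ∈ AS S ×ˢ Ioi (0 : ℝ)
  · rw [piecewise_eq_of_mem _ _ _ h, gI_pos h.1 h.2]
  · rw [piecewise_eq_of_notMem _ _ _ h, gI_neg fun hc => h hc]

end

open MeasureTheory Metric Set Filter Topology
open scoped RealInnerProductSpace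
noncomputable section

def LL {n : ℕ} (α ε : ℝ) (f : EE n → ℝ) (σ : EE n) (t : ℝ) : ℝ :=
  W2 α ε f σ t + ε * (2 - α) * W1 α ε f σ t - Real.exp ((2 - bt n α) * (ε * t)) * lap f (Real.exp (ε * t) • σ)

namespace Cx
variable {n : ℕ} {S Ω : Set (EE n)} {ε : ℝ} {u : EE n → ℝ}

lemma cts (C : Cx S Ω ε u) (α : ℝ) :
    ContinuousOn (fun q : Sph n × ℝ => W0 α ε u q.1 q.2) (AS S ×ˢ Ioi 0) ∧
    ContinuousOn (fun q : Sph n × ℝ => W1 α ε u q.1 q.2) (AS S ×ˢ Ioi 0) ∧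
    ContinuousOn (fun q : Sph n × ℝ => W2 α ε u q.1 q.2) (AS S ×ˢ Ioi 0) ∧
    ContinuousOn (fun q : Sph n × ℝ => LL α ε u q.1 q.2) (AS S ×ˢ Ioi 0) := by
  have hπ : ContinuousOn (fun q : Sph n × ℝ => Real.exp (ε * q.2) • (q.1 : EE n)) (AS S ×ˢ Ioi 0) := by fun_prop
  have hm : MapsTo (fun q : Sph n × ℝ => Real.exp (ε * q.2) • (q.1 : EE n)) (AS S ×ˢ Ioi 0) Ω := fun q hq =>
    (C.mem (by simp) q.2).2 ⟨hq.1, hq.2⟩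
  have c1 : ∀ x ∈ Ω, ContDiffAt ℝ 1 (fderiv ℝ u) x := fun x hx => (C.cdO hx).fderiv_right (by norm_num)
  have c2 : ∀ x ∈ Ω, ContinuousAt (dd u) x := fun x hx => ((c1 x hx).fderiv_right (m := 0) (by norm_num)).continuousAt
  have h0 : ContinuousOn (fun q : Sph n × ℝ => u (Real.exp (ε * q.2) • (q.1 : EE n))) (AS S ×ˢ Ioi 0) :=
    ContinuousOn.comp (t := Ω) (fun x hx => (C.cdO hx).continuousAt.continuousWithinAt) hπ hm
  have h1 : ContinuousOn (fun q : Sph n × ℝ => fderiv ℝ u (Real.exp (ε * q.2) • (q.1 : EE n))) (AS S ×ˢ Ioi 0) :=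
    ContinuousOn.comp (t := Ω) (fun x hx => (c1 x hx).continuousAt.continuousWithinAt) hπ hm
  have h2 : ContinuousOn (fun q : Sph n × ℝ => dd u (Real.exp (ε * q.2) • (q.1 : EE n))) (AS S ×ˢ Ioi 0) :=
    ContinuousOn.comp (t := Ω) (fun x hx => (c2 x hx).continuousWithinAt) hπ hm
  have hp : ContinuousOn (fun q : Sph n × ℝ => (q.1 : EE n)) (AS S ×ˢ Ioi 0) := by fun_prop
  have h1' := h1.clm_apply hp
  have h2' := (h2.clm_apply hp).clm_apply hp
  have h3 : ContinuousOn (fun q : Sph n × ℝ => lap u (Real.exp (ε * q.2) • (q.1 : EE n))) (AS S ×ˢ Ioi 0) := by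
    simp only [lap_eq]
    exact continuousOn_finsetSum _ fun i _ => (h2.clm_apply continuousOn_const).clm_apply continuousOn_const
  have hE : ∀ c : ℝ, ContinuousOn (fun q : Sph n × ℝ => Real.exp (c * (ε * q.2))) (AS S ×ˢ Ioi 0) := fun c => by fun_prop
  have hE' : ContinuousOn (fun q : Sph n × ℝ => Real.exp (-(bt n α * (ε * q.2)))) (AS S ×ˢ Ioi 0) := by fun_prop
  have hE2 : ContinuousOn (fun q : Sph n × ℝ => Real.exp (ε * q.2)) (AS S ×ˢ Ioi 0) := by fun_prop
  have k0 : ContinuousOn (fun q : Sph n × ℝ => W0 α ε u q.1 q.2) (AS S ×ˢ Ioi 0) := hE'.mul h0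
  have k1 : ContinuousOn (fun q : Sph n × ℝ => W1 α ε u q.1 q.2) (AS S ×ˢ Ioi 0) :=
    hE'.mul (((continuousOn_const.mul hE2).mul h1').sub (continuousOn_const.mul h0))
  have k2 : ContinuousOn (fun q : Sph n × ℝ => W2 α ε u q.1 q.2) (AS S ×ˢ Ioi 0) :=
    hE'.mul ((((hE2.pow 2).mul h2').add ((continuousOn_const.mul hE2).mul h1')).add (continuousOn_const.mul h0))
  exact ⟨k0, k1, k2, (k2.add (continuousOn_const.mul k1)).sub ((hE _).mul h3)⟩

lemma zer (C : Cx S Ω ε u) (α : ℝ) {s : ℝ} {σ : EE n} (h : u =ᶠ[𝓝 (Real.exp (ε * s) • σ)] fun _ => 0) :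
    W0 α ε u σ s = 0 ∧ W1 α ε u σ s = 0 ∧ W2 α ε u σ s = 0 ∧ LL α ε u σ s = 0 := by
  have h0 := h.self_of_nhds
  have h1 : fderiv ℝ u (Real.exp (ε * s) • σ) = 0 := by rw [h.fderiv_eq]; simp
  have h2 : dd u (Real.exp (ε * s) • σ) = 0 := by rw [dd_congr h]; simp [dd]
  have h3 : lap u (Real.exp (ε * s) • σ) = 0 := by rw [lap_eq, h2]; simp
  have w0 : W0 α ε u σ s = 0 := by simp [W0, h0]
  have w1 : W1 α ε u σ s = 0 := by simp [W1, h0, h1]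
  have w2 : W2 α ε u σ s = 0 := by simp [W2, h0, h1, h2]
  exact ⟨w0, w1, w2, by simp [LL, w1, w2, h3]⟩

lemma bnd (C : Cx S Ω ε u) (α : ℝ) {R : ℝ} (hR : 0 < R) :
    ∃ M, 0 ≤ M ∧ ∀ σ : EE n, ‖σ‖ = 1 → σ ∈ coneOf S → ∀ s, 0 < s → s ≤ R →
    |W0 α ε u σ s| ≤ M ∧ |W1 α ε u σ s| ≤ M ∧ |W2 α ε u σ s| ≤ M ∧ |LL α ε u σ s| ≤ M := by
  set K := closure Ω ∩ closedBall 0 (Real.exp R) with hK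
  have hKc : IsCompact K := (isCompact_closedBall _ _).inter_left isClosed_closure
  obtain ⟨M0, hM0, hb⟩ := bdd_compact C.hu.1 C.op subset_closure hKc inter_subset_left
  set E1 := Real.exp (|bt n α| * R)
  set E2 := Real.exp R
  set E3 := Real.exp (|2 - bt n α| * R)
  have hE1 : 0 < E1 := Real.exp_pos _
  have hE2 : 0 < E2 := Real.exp_pos _
  have hE3 : 0 < E3 := Real.exp_pos _
  set B0 := E1 * M0
  set B1 := E1 * (E2 * M0 + |bt n α| * M0)
  set B2 := E1 * (E2 ^ 2 * M0 + |1 - 2 * bt n α| * E2 * M0 + bt n α ^ 2 * M0)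
  set B3 := B2 + |2 - α| * B1 + E3 * (n * M0)
  have p0 : 0 ≤ B0 := by positivity
  have p1 : 0 ≤ B1 := by positivity
  have p2 : 0 ≤ B2 := by positivity
  have p3 : 0 ≤ B3 := by positivity
  refine ⟨B0 + B1 + B2 + B3, by positivity, fun σ hσ hσc s hs hsR => ?_⟩
  have hx : Real.exp (ε * s) • σ ∈ Ω := (C.mem hσ s).2 ⟨hσc, hs⟩
  have hes : |ε * s| ≤ R := by rw [abs_mul, C.ea, one_mul, abs_of_pos hs]; exact hsR
  have hcs : ∀ c : ℝ, |c * (ε * s)| ≤ |c| * R := fun c => by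
    rw [abs_mul]; exact mul_le_mul_of_nonneg_left hes (abs_nonneg _)
  have he1 : Real.exp (-(bt n α * (ε * s))) ≤ E1 := Real.exp_le_exp.2 ((neg_le_abs _).trans (hcs _))
  have he2 : Real.exp (ε * s) ≤ E2 := Real.exp_le_exp.2 ((le_abs_self _).trans hes)
  have he3 : Real.exp ((2 - bt n α) * (ε * s)) ≤ E3 := Real.exp_le_exp.2 ((le_abs_self _).trans (hcs _))
  have hxK : Real.exp (ε * s) • σ ∈ K := ⟨subset_closure hx, by
    rw [mem_closedBall, dist_zero_right, nexp hσ]; exact he2⟩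
  obtain ⟨b0, b1, b2⟩ := hb _ ⟨hxK, hx⟩
  have b1' : |fderiv ℝ u (Real.exp (ε * s) • σ) σ| ≤ M0 := by
    have := (fderiv ℝ u (Real.exp (ε * s) • σ)).le_opNorm σ
    rw [hσ, mul_one] at this
    exact this.trans b1
  have b2' : |dd u (Real.exp (ε * s) • σ) σ σ| ≤ M0 := by
    have := (dd u (Real.exp (ε * s) • σ)).le_opNorm₂ σ σ
    rw [hσ, mul_one, mul_one] at this
    exact this.trans b2
  have b3 : |lap u (Real.exp (ε * s) • σ)| ≤ n * M0 :=
    (lap_abs_le _ _).trans (mul_le_mul_of_nonneg_left b2 (Nat.cast_nonneg n))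
  have ab : ∀ {a : ℝ}, 0 < a → |a| = a := fun h => abs_of_pos h
  have w0 : |W0 α ε u σ s| ≤ B0 := by
    unfold W0
    rw [abs_mul, ab (Real.exp_pos _)]
    exact mul_le_mul he1 b0 (abs_nonneg _) hE1.le
  have w1 : |W1 α ε u σ s| ≤ B1 := by
    unfold W1
    rw [abs_mul, ab (Real.exp_pos _)]
    refine mul_le_mul he1 ((abs_sub _ _).trans ?_) (abs_nonneg _) hE1.le
    rw [abs_mul, abs_mul, abs_mul (bt n α * ε), abs_mul (bt n α), C.ea, one_mul, mul_one, ab (Real.exp_pos _)]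
    exact add_le_add (mul_le_mul he2 b1' (abs_nonneg _) hE2.le) (mul_le_mul_of_nonneg_left b0 (abs_nonneg _))
  have w2 : |W2 α ε u σ s| ≤ B2 := by
    unfold W2
    rw [abs_mul, ab (Real.exp_pos _)]
    refine mul_le_mul he1 ((abs_add_three _ _ _).trans ?_) (abs_nonneg _) hE1.le
    rw [abs_mul, abs_mul, abs_mul (1 - 2 * bt n α), abs_mul (bt n α ^ 2), abs_pow, ab (Real.exp_pos _), abs_of_nonneg (sq_nonneg (bt n α))]
    refine add_le_add (add_le_add (mul_le_mul (pow_le_pow_left₀ (Real.exp_pos _).le he2 2) b2' (abs_nonneg _) (by positivity)) ?_)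
      (mul_le_mul_of_nonneg_left b0 (sq_nonneg _))
    exact mul_le_mul (mul_le_mul_of_nonneg_left he2 (abs_nonneg _)) b1' (abs_nonneg _) (by positivity)
  have w3 : |LL α ε u σ s| ≤ B3 := by
    unfold LL
    refine (abs_sub _ _).trans (add_le_add ((abs_add_le _ _).trans (add_le_add w2 ?_)) ?_)
    · rw [abs_mul, abs_mul, C.ea, one_mul]
      exact mul_le_mul_of_nonneg_left w1 (abs_nonneg _)
    · rw [abs_mul, ab (Real.exp_pos _)]
      exact mul_le_mul he3 b3 (abs_nonneg _) hE3.le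
  exact ⟨by linarith, by linarith, by linarith, by linarith⟩

lemma reg (C : Cx S Ω ε u) (α : ℝ) (p : Sph n) :
    (∀ s, HasDerivAt (gI S (W0 α ε u) p) (gI S (W1 α ε u) p s) s) ∧
    (∀ s, s ≠ 0 → HasDerivAt (gI S (W1 α ε u) p) (gI S (W2 α ε u) p s) s) ∧
    Continuous (gI S (W1 α ε u) p) := by
  have hp1 : ‖(p : EE n)‖ = 1 := by simp
  by_cases hp : (p : EE n) ∈ coneOf S
  · rw [gI_ind hp, gI_ind hp, gI_ind hp]
    have hpS : (p : EE n) ∈ S := (mem_cone_sph hp1).1 hp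
    have hmem : ∀ s, 0 < s → ContDiffAt ℝ 2 u (Real.exp (ε * s) • (p : EE n)) := fun s hs =>
      C.cdO ((C.mem hp1 s).2 ⟨hp, hs⟩)
    have hx0 : (p : EE n) ∈ closure Ω := by
      have := C.cl (subset_closure hpS) (le_refl (0 : ℝ))
      simpa using this
    have hfr : (p : EE n) ∈ frontier Ω := by
      rw [C.op.frontier_eq]
      refine ⟨hx0, fun hc => ?_⟩
      have := (C.mem hp1 0).1 (by simpa using hc)
      exact lt_irrefl _ this.2
    have hu0 : u p = 0 := C.hu.2.1 _ hfr
    have hcurve : ContDiff ℝ 2 (fun s : ℝ => Real.exp (ε * s) • (p : EE n)) := by fun_prop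
    have hmaps : MapsTo (fun s : ℝ => Real.exp (ε * s) • (p : EE n)) (Ici 0) (closure Ω) := fun s hs =>
      C.cl (subset_closure hpS) hs
    have hcomp : ContDiffOn ℝ 2 (fun s : ℝ => u (Real.exp (ε * s) • (p : EE n))) (Ici 0) :=
      ContDiffOn.comp (t := closure Ω) C.hu.1 hcurve.contDiffOn hmaps
    have hW : ContDiffOn ℝ 2 (W0 α ε u p) (Ici 0) := by
      unfold W0
      have he : ContDiff ℝ 2 (fun s : ℝ => Real.exp (-(bt n α * (ε * s)))) := by fun_prop
      exact he.contDiffOn.mul hcomp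
    refine glue (hW.of_le (by norm_num)) (by simp [W0, hu0]) ?_ (fun s hs => ((W_deriv C.e2 (hmem s hs)).1).self_of_nhds)
      (fun s hs => (W_deriv C.e2 (hmem s hs)).2)
    have hd1 : HasDerivWithinAt (fun s : ℝ => u (Real.exp (ε * s) • (p : EE n))) 0 (Ici 0) 0 := by
      have hc : HasDerivAt (fun s : ℝ => Real.exp (ε * s) • (p : EE n)) ((ε * Real.exp (ε * 0)) • (p : EE n)) 0 :=
        (exp_der ε 0).smul_const _
      have hd : HasFDerivWithinAt u (0 : EE n →L[ℝ] ℝ) (closure Ω) (Real.exp (ε * 0) • (p : EE n)) := by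
        have h1 : Real.exp (ε * 0) • (p : EE n) = p := by simp
        rw [h1]
        have h2 := ((C.hu.1 p hx0).differentiableWithinAt (by norm_num)).hasFDerivWithinAt
        rwa [C.hg p ⟨p.2, hfr⟩] at h2
      have := hd.comp_hasDerivWithinAt 0 hc.hasDerivWithinAt hmaps
      exact this.congr_deriv (by simp)
    have hd2 := ((exp_der (-(bt n α * ε)) 0).hasDerivWithinAt (s := Ici 0)).mul hd1
    have hd3 : HasDerivWithinAt (W0 α ε u p) 0 (Ici 0) 0 := by
      have h4 : HasDerivWithinAt (fun s : ℝ => Real.exp (-(bt n α * ε) * s) * u (Real.exp (ε * s) • (p : EE n))) 0 (Ici 0) 0 := by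
        refine hd2.congr_deriv ?_
        simp [hu0]
      refine h4.congr (fun s _ => ?_) ?_
      · unfold W0; congr 2; ring
      · unfold W0; congr 2; ring
    exact hd3.derivWithin (uniqueDiffOn_Ici 0 0 self_mem_Ici)
  · have hz : ∀ F : EE n → ℝ → ℝ, gI S F p = fun _ => 0 := fun F => funext fun s => gI_neg fun h => hp h.1
    rw [hz, hz, hz]
    exact ⟨fun s => hasDerivAt_const _ _, fun s _ => hasDerivAt_const _ _, continuous_const⟩

end Cx
end

open MeasureTheory Metric Set Filter Topology
open scoped RealInnerProductSpace
noncomputable section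

lemma gI_int {n : ℕ} {S : Set (EE n)} (hS : IsSphDomain S) {F : Sph n → ℝ} (h : ∀ p : Sph n, (p : EE n) ∉ coneOf S → F p = 0) :
    ∫ p, F p ∂(sg n) = ∫ p in AS S, F p ∂(sg n) :=
  (setIntegral_eq_integral_of_forall_compl_eq_zero fun p hp => h p hp).symm

lemma NN.int_mul {n : ℕ} {S : Set (EE n)} (hS : IsSphDomain S) {Φ Ψ : EE n → ℝ} (h : NN S Φ) (h' : NN S Ψ) :
    IntegrableOn (fun p : Sph n => Φ p * Ψ p) (AS S) (sg n) ∧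
    IntegrableOn (fun p : Sph n => Φ p * lap Ψ p) (AS S) (sg n) := by
  obtain ⟨M, hM0, hM⟩ := h.bdd
  obtain ⟨N, hN0, hN⟩ := h'.bdd
  refine ⟨int_cone hS (F := fun x => Φ x * Ψ x) (fun x hx => (h.cd x hx).continuousAt.mul (h'.cd x hx).continuousAt) (M * N) fun x hx hx1 => ?_,
    int_cone hS (F := fun x => Φ x * lap Ψ x) (fun x hx => (h.cd x hx).continuousAt.mul (lap_cont (h'.cd x hx))) (M * (n * N)) fun x hx hx1 => ?_⟩
  · rw [abs_mul]; exact mul_le_mul (hM x hx hx1).1 (hN x hx hx1).1 (abs_nonneg _) hM0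
  · rw [abs_mul]
    exact mul_le_mul (hM x hx hx1).1 ((lap_abs_le _ _).trans (mul_le_mul_of_nonneg_left (hN x hx hx1).2.2 (Nat.cast_nonneg n))) (abs_nonneg _) hM0

/-- The slice at time `t`, as a function on the sphere. -/
def slc {n : ℕ} (α ε : ℝ) (u : EE n → ℝ) (t : ℝ) : EE n → ℝ :=
  fun y => open Classical in if 0 < t then W0 α ε u y t else 0

def Phi {n : ℕ} (S : Set (EE n)) (φ : EE n → ℝ) : EE n → ℝ := (coneOf S).indicator (hext φ)

lemma hext_sph {n : ℕ} (φ : EE n → ℝ) (p : Sph n) : hext φ p = φ p := by simp [hext]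

lemma Phi_lap {n : ℕ} {S : Set (EE n)} (hS : IsSphDomain S) (φ : EE n → ℝ) {x : EE n} (hx : x ∈ coneOf S) :
    lap (Phi S φ) x = lap (hext φ) x := by
  refine lap_congr ?_
  filter_upwards [(cone_open hS).mem_nhds hx] with y hy using indicator_of_mem hy _

namespace Cx
variable {n : ℕ} {S Ω : Set (EE n)} {ε : ℝ} {u : EE n → ℝ}

lemma nav (C : Cx S Ω ε u) (α t : ℝ) : NavAdmS S (slc α ε u t) := by
  by_cases ht : 0 < t
  · have e : slc α ε u t = fun y => W0 α ε u y t := funext fun y => if_pos ht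
    rw [e]
    constructor
    · unfold W0
      refine contDiffOn_const.mul ?_
      refine ContDiffOn.comp (t := closure Ω) (f := fun x : EE n => Real.exp (ε * t) • ‖x‖⁻¹ • x) C.hu.1 ?_ ?_
      · intro x hx
        exact ((nrm_contDiffAt hx.1 2).const_smul (Real.exp (ε * t))).contDiffWithinAt
      · intro x hx
        exact C.cl hx.2 ht.le
    · intro σ hσ
      have hσ1 : ‖σ‖ = 1 := by simpa using closure_sph C.hS hσ.1
      have hfr : Real.exp (ε * t) • σ ∈ frontier Ω := by
        rw [C.op.frontier_eq]
        refine ⟨C.cl hσ.1 ht.le, fun hc => hσ.2 ?_⟩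
        exact (mem_cone_sph hσ1).1 ((C.mem hσ1 t).1 hc).1
      simp [W0, C.hu.2.1 _ hfr]
  · have e : slc α ε u t = fun y => 0 := funext fun y => if_neg ht
    rw [e]
    exact ⟨contDiffOn_const, fun _ _ => rfl⟩

lemma w_eq (C : Cx S Ω ε u) (α t : ℝ) (p : Sph n) : gI S (W0 α ε u) p t = Phi S (slc α ε u t) p := by
  unfold Phi
  by_cases hp : (p : EE n) ∈ coneOf S
  · rw [indicator_of_mem hp, hext_sph]
    by_cases ht : 0 < t
    · rw [gI_pos hp ht]; exact (if_pos ht).symm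
    · rw [gI_neg fun h => ht h.2]; exact (if_neg ht).symm
  · rw [indicator_of_notMem hp, gI_neg fun h => hp h.1]

lemma l_eq (C : Cx S Ω ε u) (α t : ℝ) {p : Sph n} (hp : (p : EE n) ∈ coneOf S) :
    gI S (LL α ε u) p t = gam n α * Phi S (slc α ε u t) p - lap (Phi S (slc α ε u t)) p := by
  have hp1 : ‖(p : EE n)‖ = 1 := by simp
  rw [Phi_lap C.hS _ hp, ← C.w_eq α t p]
  by_cases ht : 0 < t
  · rw [gI_pos hp ht, gI_pos hp ht]
    have hx := (C.mem hp1 t).2 ⟨hp, ht⟩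
    have hcd := C.cdO hx
    have h1 := W_lap (α := α) C.e2 hp1 hcd
    have h2 : lap (hext (slc α ε u t)) p = Real.exp (-(bt n α * (ε * t))) * lap (fun y => u (Real.exp (ε * t) • ‖y‖⁻¹ • y)) p := by
      rw [← lap_cmul]
      · congr 1
        exact funext fun y => if_pos ht
      · refine ContDiffAt.comp (f := fun x : EE n => Real.exp (ε * t) • ‖x‖⁻¹ • x) (g := u) (p : EE n) ?_
          ((nrm_contDiffAt (cone_ne hp) 2).const_smul (Real.exp (ε * t)))
        simpa using hcd
    rw [h2]
    unfold LL
    linarith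
  · rw [gI_neg fun h => ht h.2, gI_neg fun h => ht h.2]
    have : hext (slc α ε u t) = fun _ => 0 := funext fun y => if_neg ht
    rw [this]
    have h0 : lap (fun _ : EE n => (0 : ℝ)) p = 0 := by rw [lap_eq]; simp [dd]
    rw [h0]; simp

lemma nn (C : Cx S Ω ε u) (α t : ℝ) : NN S (Phi S (slc α ε u t)) := NN_of_nav C.hS (C.nav α t)

lemma sym (C : Cx S Ω ε u) (α s t : ℝ) : ∫ p, gI S (W0 α ε u) p s * gI S (LL α ε u) p t ∂(sg n) =
    ∫ p, gI S (W0 α ε u) p t * gI S (LL α ε u) p s ∂(sg n) := by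
  have key : ∀ s t, ∫ p, gI S (W0 α ε u) p s * gI S (LL α ε u) p t ∂(sg n) =
      gam n α * ∫ p in AS S, Phi S (slc α ε u s) p * Phi S (slc α ε u t) p ∂(sg n)
      - ∫ p in AS S, Phi S (slc α ε u s) p * lap (Phi S (slc α ε u t)) p ∂(sg n) := by
    intro s t
    obtain ⟨i1, i2⟩ := (C.nn α s).int_mul C.hS (C.nn α t)
    rw [gI_int C.hS (F := fun p => gI S (W0 α ε u) p s * gI S (LL α ε u) p t)
      (fun p hp => by rw [gI_neg fun h => hp h.1, zero_mul]), ← integral_const_mul, ← integral_sub (i1.const_mul _) i2]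
    refine setIntegral_congr_fun (AS_meas C.hS) fun p hp => ?_
    rw [C.w_eq, C.l_eq α t hp]; ring
  rw [key, key, (C.nn α s).symm (by linarith [C.hn]) C.hS (C.nn α t)]
  simp only [mul_comm]

lemma posi (C : Cx S Ω ε u) (α s t : ℝ) :
    (lam1 S + gam n α) * ∫ p, (gI S (W0 α ε u) p s - gI S (W0 α ε u) p t) ^ 2 ∂(sg n) ≤
    ∫ p, (gI S (W0 α ε u) p s - gI S (W0 α ε u) p t) * (gI S (LL α ε u) p s - gI S (LL α ε u) p t) ∂(sg n) := by
  set ψ : EE n → ℝ := fun y => slc α ε u s y - slc α ε u t y with hψ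
  have hnav : NavAdmS S ψ := by
    refine ⟨(C.nav α s).1.sub (C.nav α t).1, fun σ hσ => ?_⟩
    simp only [hψ]
    rw [(C.nav α s).2 σ hσ, (C.nav α t).2 σ hσ, sub_zero]
  have hN : NN S (Phi S ψ) := NN_of_nav C.hS hnav
  have hw : ∀ p : Sph n, gI S (W0 α ε u) p s - gI S (W0 α ε u) p t = Phi S ψ p := by
    intro p
    rw [C.w_eq, C.w_eq]
    unfold Phi
    by_cases hp : (p : EE n) ∈ coneOf S
    · rw [indicator_of_mem hp, indicator_of_mem hp, indicator_of_mem hp]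
    · rw [indicator_of_notMem hp, indicator_of_notMem hp, indicator_of_notMem hp, sub_zero]
  have hl : ∀ p : Sph n, (p : EE n) ∈ coneOf S → gI S (LL α ε u) p s - gI S (LL α ε u) p t =
      gam n α * Phi S ψ p - lap (Phi S ψ) p := by
    intro p hp
    have e : lap (Phi S ψ) p = lap (Phi S (slc α ε u s)) p - lap (Phi S (slc α ε u t)) p := by
      rw [← lap_sub' ((C.nn α s).cd _ hp) ((C.nn α t).cd _ hp)]
      refine lap_congr ?_
      filter_upwards [(cone_open C.hS).mem_nhds hp] with y hy
      unfold Phi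
      rw [indicator_of_mem hy, indicator_of_mem hy, indicator_of_mem hy]
    rw [C.l_eq α s hp, C.l_eq α t hp, e, ← hw, C.w_eq, C.w_eq]; ring
  obtain ⟨i1, i2⟩ := hN.int_mul C.hS hN
  have hP := hN.poincare (by linarith [C.hn]) C.hS
  have e1 : ∫ p, (gI S (W0 α ε u) p s - gI S (W0 α ε u) p t) ^ 2 ∂(sg n) = ∫ p in AS S, Phi S ψ p ^ 2 ∂(sg n) := by
    simp only [hw]
    exact gI_int C.hS fun p hp => by rw [hN.zero _ hp]; norm_num
  have e2 : ∫ p, (gI S (W0 α ε u) p s - gI S (W0 α ε u) p t) * (gI S (LL α ε u) p s - gI S (LL α ε u) p t) ∂(sg n)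
      = gam n α * ∫ p in AS S, Phi S ψ p ^ 2 ∂(sg n) - ∫ p in AS S, Phi S ψ p * lap (Phi S ψ) p ∂(sg n) := by
    simp only [hw]
    rw [gI_int C.hS (F := fun p => Phi S ψ p * (gI S (LL α ε u) p s - gI S (LL α ε u) p t))
      (fun p hp => by rw [hN.zero _ hp, zero_mul])]
    have i1' : IntegrableOn (fun p : Sph n => Phi S ψ p ^ 2) (AS S) (sg n) := by simpa only [sq] using i1
    rw [← integral_const_mul, ← integral_sub (i1'.const_mul _) i2]
    refine setIntegral_congr_fun (AS_meas C.hS) fun p hp => ?_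
    rw [hl p hp]; ring
  rw [e1, e2]
  linarith

lemma muu (C : Cx S Ω ε u) (α s : ℝ) : muN (coneOf S) α * ∫ p, gI S (W0 α ε u) p s ^ 2 ∂(sg n) ≤
    ∫ p, gI S (LL α ε u) p s ^ 2 ∂(sg n) := by
  have h := muN_le (by linarith [C.hn]) C.hS (C.nav α s) α
  rw [gI_int C.hS (F := fun p => gI S (W0 α ε u) p s ^ 2) (fun p hp => by rw [gI_neg fun h => hp h.1]; norm_num),
    gI_int C.hS (F := fun p => gI S (LL α ε u) p s ^ 2) (fun p hp => by rw [gI_neg fun h => hp h.1]; norm_num)]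
  have e1 : ∀ p ∈ AS S, Phi S (slc α ε u s) p = slc α ε u s p := fun p hp => by
    unfold Phi; rw [indicator_of_mem (show (p : EE n) ∈ coneOf S from hp), hext_sph]
  have e2 : ∫ p in AS S, gI S (W0 α ε u) p s ^ 2 ∂(sg n) = ∫ p in AS S, slc α ε u s p ^ 2 ∂(sg n) :=
    setIntegral_congr_fun (AS_meas C.hS) fun p hp => by rw [C.w_eq, e1 p hp]
  have e3 : ∫ p in AS S, gI S (LL α ε u) p s ^ 2 ∂(sg n) =
      ∫ p in AS S, (gam n α * slc α ε u s p - lap (hext (slc α ε u s)) p) ^ 2 ∂(sg n) :=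
    setIntegral_congr_fun (AS_meas C.hS) fun p hp => by rw [C.l_eq α s hp, e1 p hp, Phi_lap C.hS _ hp]
  rw [e2, e3]
  exact h

lemma dat (C : Cx S Ω ε u) (α : ℝ) : ∃ M R, Dat (sg n) (gI S (W0 α ε u)) (gI S (W1 α ε u)) (gI S (W2 α ε u)) (gI S (LL α ε u)) M R := by
  obtain ⟨R, hR, hfar⟩ := C.far
  obtain ⟨M, hM, hb⟩ := C.bnd α hR
  obtain ⟨c0, c1, c2, c3⟩ := C.cts α
  have hz : ∀ (p : Sph n) s, s ≤ 0 ∨ R ≤ s → gI S (W0 α ε u) p s = 0 ∧ gI S (W1 α ε u) p s = 0 ∧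
      gI S (W2 α ε u) p s = 0 ∧ gI S (LL α ε u) p s = 0 := by
    intro p s hs
    by_cases h : (p : EE n) ∈ coneOf S ∧ 0 < s
    · rcases hs with hs | hs
      · exact absurd h.2 (not_lt.2 hs)
      · rw [gI_pos h.1 h.2, gI_pos h.1 h.2, gI_pos h.1 h.2, gI_pos h.1 h.2]
        exact C.zer α (hfar s hs p (by simp))
    · rw [gI_neg h, gI_neg h, gI_neg h, gI_neg h]; simp
  have hbb : ∀ (p : Sph n) s, |gI S (W0 α ε u) p s| ≤ M ∧ |gI S (W1 α ε u) p s| ≤ M ∧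
      |gI S (W2 α ε u) p s| ≤ M ∧ |gI S (LL α ε u) p s| ≤ M := by
    intro p s
    by_cases hs : s ≤ 0 ∨ R ≤ s
    · obtain ⟨a, b, c, d⟩ := hz p s hs
      rw [a, b, c, d]; simp [hM]
    · push Not at hs
      by_cases h : (p : EE n) ∈ coneOf S ∧ 0 < s
      · rw [gI_pos h.1 h.2, gI_pos h.1 h.2, gI_pos h.1 h.2, gI_pos h.1 h.2]
        exact hb p (by simp) h.1 s h.2 hs.2.le
      · rw [gI_neg h, gI_neg h, gI_neg h, gI_neg h]; simp [hM]
  exact ⟨M, R, {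
    hR := hR.le
    hM := hM
    mw := gI_meas C.hS c0
    mw1 := gI_meas C.hS c1
    mw2 := gI_meas C.hS c2
    ml := gI_meas C.hS c3
    bw := fun p s => (hbb p s).1
    bw1 := fun p s => (hbb p s).2.1
    bw2 := fun p s => (hbb p s).2.2.1
    bl := fun p s => (hbb p s).2.2.2
    zw := fun p s h => (hz p s h).1
    zw1 := fun p s h => (hz p s h).2.1
    zw2 := fun p s h => (hz p s h).2.2.1
    zl := fun p s h => (hz p s h).2.2.2
    dw := fun p => (C.reg α p).1
    dw1 := fun p => (C.reg α p).2.1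
    cw1 := fun p => (C.reg α p).2.2
    sym := C.sym α }⟩

lemma pol (C : Cx S Ω ε u) (F : EE n → ℝ) (G : Sph n × ℝ → ℝ)
    (h : ∀ p : Sph n, ∀ s, (p : EE n) ∈ coneOf S → 0 < s →
      Real.exp (n * (ε * s)) * F (Real.exp (ε * s) • (p : EE n)) = G (p, s))
    (h0 : ∀ p : Sph n, ∀ s, ¬ ((p : EE n) ∈ coneOf S ∧ 0 < s) → G (p, s) = 0) :
    ∫ x in Ω, F x = ∫ q, G q ∂((sg n).prod volume) := by
  rw [← integral_indicator C.op.measurableSet, polar_integral (by linarith [C.hn]) C.he]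
  congr 1
  ext ⟨p, s⟩
  have hp1 : ‖(p : EE n)‖ = 1 := by simp
  by_cases hq : (p : EE n) ∈ coneOf S ∧ 0 < s
  · simp only
    rw [indicator_of_mem ((C.mem hp1 s).2 hq)]
    exact h p s hq.1 hq.2
  · simp only
    rw [indicator_of_notMem (fun hc => hq ((C.mem hp1 s).1 hc)), mul_zero, h0 p s hq]

lemma final (C : Cx S Ω ε u) (α lam : ℝ) (hlam : lam ≤ lam1 S) :
    ((gbar n α + lam) / 2) * (∫ x in Ω, ‖x‖ ^ (α - 4) * ((Real.log ‖x‖) ^ 2)⁻¹ * (u x) ^ 2) +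
      (9 / 16) * (∫ x in Ω, ‖x‖ ^ (α - 4) * ((Real.log ‖x‖) ^ 4)⁻¹ * (u x) ^ 2) ≤
      (∫ x in Ω, ‖x‖ ^ α * (lap u x) ^ 2) -
        muN (coneOf S) α * (∫ x in Ω, ‖x‖ ^ (α - 4) * (u x) ^ 2) := by
  obtain ⟨M, R, D⟩ := C.dat α
  have hg : 2 * (lam1 S + gam n α) + (ε * (2 - α)) ^ 2 = 2 * (gbar n α + lam1 S) := by
    rw [mul_pow, C.e2, gam, gbar]; ring
  have hmain := D.main (L := lam1 S + gam n α) (μ := muN (coneOf S) α) (b := ε * (2 - α)) (C.posi α) (C.muu α)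
    (by rw [hg]; have := lam1_nonneg S; unfold gbar; positivity)
  rw [hg] at hmain
  have hw2 : ∀ (p : Sph n) s, Real.exp (n * (ε * s)) * (‖Real.exp (ε * s) • (p : EE n)‖ ^ (α - 4) * u (Real.exp (ε * s) • (p : EE n)) ^ 2)
      = W0 α ε u p s ^ 2 := by
    intro p s
    rw [nexp (by simp), ← Real.exp_mul, W0, mul_pow, ← Real.exp_nat_mul, ← mul_assoc, ← Real.exp_add]
    congr 2
    unfold bt
    push_cast; ring
  have hlog : ∀ (p : Sph n) s, Real.log ‖Real.exp (ε * s) • (p : EE n)‖ = ε * s := fun p s => by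
    rw [nexp (by simp), Real.log_exp]
  have I0 : ∫ x in Ω, ‖x‖ ^ (α - 4) * (u x) ^ 2 = ∫ q : Sph n × ℝ, gI S (W0 α ε u) q.1 q.2 ^ 2 ∂((sg n).prod volume) := by
    refine C.pol _ _ (fun p s hp hs => ?_) (fun p s h => ?_)
    · simp only
      rw [gI_pos hp hs, hw2]
    · simp only
      rw [gI_neg h]; norm_num
  have I2 : ∫ x in Ω, ‖x‖ ^ (α - 4) * ((Real.log ‖x‖) ^ 2)⁻¹ * (u x) ^ 2 =
      ∫ q : Sph n × ℝ, gI S (W0 α ε u) q.1 q.2 ^ 2 * (q.2 ^ 2)⁻¹ ∂((sg n).prod volume) := by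
    refine C.pol _ _ (fun p s hp hs => ?_) (fun p s h => ?_)
    · simp only
      rw [gI_pos hp hs, ← hw2, hlog, mul_pow, C.e2, one_mul]; ring
    · simp only
      rw [gI_neg h]; norm_num
  have I4 : ∫ x in Ω, ‖x‖ ^ (α - 4) * ((Real.log ‖x‖) ^ 4)⁻¹ * (u x) ^ 2 =
      ∫ q : Sph n × ℝ, gI S (W0 α ε u) q.1 q.2 ^ 2 * (q.2 ^ 4)⁻¹ ∂((sg n).prod volume) := by
    refine C.pol _ _ (fun p s hp hs => ?_) (fun p s h => ?_)
    · have e4 : ε ^ 4 = 1 := by rw [show ε ^ 4 = (ε ^ 2) ^ 2 by ring, C.e2]; norm_num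
      simp only
      rw [gI_pos hp hs, ← hw2, hlog, mul_pow, e4, one_mul]; ring
    · simp only
      rw [gI_neg h]; norm_num
  have IL : ∫ x in Ω, ‖x‖ ^ α * (lap u x) ^ 2 = ∫ q : Sph n × ℝ, (gI S (W2 α ε u) q.1 q.2 + ε * (2 - α) * gI S (W1 α ε u) q.1 q.2
      - gI S (LL α ε u) q.1 q.2) ^ 2 ∂((sg n).prod volume) := by
    refine C.pol _ _ (fun p s hp hs => ?_) (fun p s h => ?_)
    · simp only
      rw [gI_pos hp hs, gI_pos hp hs, gI_pos hp hs, LL, sub_sub_cancel, mul_pow, ← Real.exp_nat_mul, nexp (by simp), ← Real.exp_mul,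
        ← mul_assoc, ← Real.exp_add]
      congr 2
      unfold bt
      push_cast; ring
    · simp only
      rw [gI_neg h, gI_neg h, gI_neg h]; norm_num
  have hI2 : 0 ≤ ∫ q : Sph n × ℝ, gI S (W0 α ε u) q.1 q.2 ^ 2 * (q.2 ^ 2)⁻¹ ∂((sg n).prod volume) :=
    integral_nonneg fun q => by positivity
  rw [I0, I2, I4, IL]
  have h5 := mul_le_mul_of_nonneg_right (show (gbar n α + lam) / 2 ≤ 2 * (gbar n α + lam1 S) / 4 by linarith) hI2
  linarith

end Cx
end

open MeasureTheory Metric Set Filter Topology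
open scoped RealInnerProductSpace
noncomputable section

/-- Theorem 3(ii) of the paper, mixed Navier–Dirichlet case:
improved Rellich inequality with two logarithmic remainder terms on cone-like
domains, for functions with vanishing gradient on the spherical part of the
boundary. -/
theorem rellich_log_navier_dirichlet {n : ℕ} (hn : 2 ≤ n) (α : ℝ)
    (S : Set (EuclideanSpace ℝ (Fin n))) (hS : IsC2SphDomain S)
    (Ω : Set (EuclideanSpace ℝ (Fin n)))
    (hΩ : Ω = coneOf S ∩ Metric.ball 0 1 ∨ Ω = coneOf S \ Metric.closedBall 0 1)
    (u : EuclideanSpace ℝ (Fin n) → ℝ) (hu : NavierAdm Ω u)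
    (hgrad : ∀ x ∈ Metric.sphere (0 : EuclideanSpace ℝ (Fin n)) 1 ∩ frontier Ω,
      fderivWithin ℝ u (closure Ω) x = 0) :
    ((gbar n α + sInf (spec S)) / 2) *
        (∫ x in Ω, ‖x‖ ^ (α - 4) * ((Real.log ‖x‖) ^ 2)⁻¹ * (u x) ^ 2) +
      (9 / 16) *
        (∫ x in Ω, ‖x‖ ^ (α - 4) * ((Real.log ‖x‖) ^ 4)⁻¹ * (u x) ^ 2) ≤
      (∫ x in Ω, ‖x‖ ^ α * (lap u x) ^ 2) -
        muN (coneOf S) α * (∫ x in Ω, ‖x‖ ^ (α - 4) * (u x) ^ 2) := by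
  rcases hΩ with rfl | rfl
  · refine (Cx.mk hn hS.1 (Or.inr rfl) (fun x => ?_) hu hgrad : Cx S _ (-1) u).final α _ (spec_le hn hS)
    constructor
    · rintro ⟨h1, h2⟩
      have h0 : 0 < ‖x‖ := norm_pos_iff.2 (cone_ne h1)
      have h3 : Real.log ‖x‖ < 0 := Real.log_neg h0 (by simpa using h2)
      exact ⟨h1, by linarith⟩
    · rintro ⟨h1, h2⟩
      have h0 : 0 < ‖x‖ := norm_pos_iff.2 (cone_ne h1)
      have h3 : Real.log ‖x‖ < 0 := by linarith
      refine ⟨h1, ?_⟩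
      have h4 := (Real.log_neg_iff h0).1 h3
      simpa using h4
  · refine (Cx.mk hn hS.1 (Or.inl rfl) (fun x => ?_) hu hgrad : Cx S _ 1 u).final α _ (spec_le hn hS)
    constructor
    · rintro ⟨h1, h2⟩
      have h3 : 0 < Real.log ‖x‖ := Real.log_pos (by simpa using h2)
      exact ⟨h1, by linarith⟩
    · rintro ⟨h1, h2⟩
      have h0 : 0 < ‖x‖ := norm_pos_iff.2 (cone_ne h1)
      have h3 : 0 < Real.log ‖x‖ := by linarith
      refine ⟨h1, ?_⟩
      have h4 := (Real.log_pos_iff h0.le).1 h3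
      simpa using h4

end
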